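/- Let K be a valued field whose value group has a least positive element, regarded as an L_VR-structure, elementarily equivalent to ℂ((t)), with residue field k. Then for every algebraically closed subfield D ⊆ k, there exists an elementary L_VR-substructure K₀ of K whose residue field, as a subfield of k, equals D. -/

import Mathlib

open FirstOrder

/-- The function symbols of the language `L_VR`: the ring language `{0, 1, +, ×}`. -/
inductive LVRFunc : ℕ → Type
  | zero : LVRFunc 0
  | one : LVRFunc 0
  | add : LVRFunc 2
  | mul : LVRFunc 2

/-- The relation symbols of the language `L_VR`: a binary divisibility relation `|`,
a unary relation `N`, and a unary relation `P_n` for each `n ≥ 1`. -/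
inductive LVRRel : ℕ → Type
  | dvd : LVRRel 2
  | N : LVRRel 1
  | pow : ℕ+ → LVRRel 1

/-- The first-order language `L_VR` of valuation rings. -/
def LVR : FirstOrder.Language where
  Functions := LVRFunc
  Relations := LVRRel

/-- Interpretation of the `L_VR` function symbols in a field. -/
def LVRfun (K : Type*) [Field K] : ∀ {n : ℕ}, LVRFunc n → (Fin n → K) → K
  | _, .zero => fun _ => 0
  | _, .one => fun _ => 1
  | _, .add => fun x => x 0 + x 1
  | _, .mul => fun x => x 0 * x 1

/-- Interpretation of the `L_VR` relation symbols in a valued field (Mathlib's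
multiplicative convention for valuations is order-reversing w.r.t. the additive
convention of the paper: `x | y` means `v_add(x) ≤ v_add(y)`, i.e. multiplicatively
`v (x 1) ≤ v (x 0)`; `N x` means `v_add(x) = 1_Γ`, where `γ₁` is the multiplicative
avatar of the least positive element of the value group; `P_n x` means `x` is an
`n`-th power). -/
def LVRrel {K : Type*} [Field K] {Γ₀ : Type*} [LinearOrderedCommGroupWithZero Γ₀]
    (v : Valuation K Γ₀) (γ₁ : Γ₀) : ∀ {n : ℕ}, LVRRel n → (Fin n → K) → Prop
  | _, .dvd => fun x => v (x 1) ≤ v (x 0)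
  | _, .N => fun x => v (x 0) = γ₁
  | _, .pow m => fun x => ∃ y : K, x 0 = y ^ (m : ℕ)

/-- A valued field, together with the (multiplicative avatar of the) least positive
element of its value group, as an `L_VR`-structure. -/
def valuedStructure {K : Type*} [Field K] {Γ₀ : Type*} [LinearOrderedCommGroupWithZero Γ₀]
    (v : Valuation K Γ₀) (γ₁ : Γ₀) : LVR.Structure K where
  funMap := LVRfun K
  RelMap := LVRrel v γ₁

/-- `γ₁` is the multiplicative avatar of the least positive element of the value
group: the greatest element of `Γ₀ ∖ {0}` that is `< 1`. -/
def IsLeastPos {Γ₀ : Type*} [LinearOrderedCommGroupWithZero Γ₀] (γ₁ : Γ₀) : Prop :=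
  γ₁ ≠ 0 ∧ γ₁ < 1 ∧ ∀ δ : Γ₀, δ ≠ 0 → δ < 1 → δ ≤ γ₁

/-- `ℂ((t))`, the field of formal Laurent series over `ℂ` with its `t`-adic
valuation, as an `L_VR`-structure. -/
noncomputable def laurentStructure : LVR.Structure (LaurentSeries ℂ) :=
  valuedStructure (Valued.v : Valuation (LaurentSeries ℂ) (WithZero (Multiplicative ℤ)))
    ((Multiplicative.ofAdd (-1 : ℤ) : Multiplicative ℤ) : WithZero (Multiplicative ℤ))

open Polynomial in
/-- The properties of the valued field `ℂ((t))` used below. -/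
structure IsT {K : Type*} [Field K] {Γ : Type*} [LinearOrderedCommGroupWithZero Γ]
    (v : Valuation K Γ) (t : K) : Prop where
  ne_zero : t ≠ 0
  lt_one : v t < 1
  le_of_lt_one : ∀ x, v x < 1 → v x ≤ v t
  natCast : ∀ n : ℕ, n ≠ 0 → v (n : K) = 1
  hensel : ∀ g : K[X], (∀ i, v (g.coeff i) < 1) → ∀ a, v a ≤ 1 →
    ∃ y, v y ≤ 1 ∧ a + y + y ^ 2 * g.eval y = 0
  residue : ∀ p : K[X], p.Monic → 0 < p.natDegree → (∀ i, v (p.coeff i) ≤ 1) →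
    ∃ y, v y ≤ 1 ∧ v (p.eval y) < 1
  div : ∀ n : ℕ, 0 < n → ∀ x, x ≠ 0 → ∃ i < n, ∃ y, v x = v (t ^ i * y ^ n)

section Hensel

open Polynomial

variable {K : Type*} [Field K] {Γ : Type*} [LinearOrderedCommGroupWithZero Γ]
  {v : Valuation K Γ} {t : K}

theorem val_eval_le_one {f : K[X]} (hf : ∀ i, v (f.coeff i) ≤ 1) {a : K} (ha : v a ≤ 1) :
    v (f.eval a) ≤ 1 := by
  rw [eval_eq_sum_range]
  refine v.map_sum_le fun i _ => ?_
  rw [map_mul, map_pow]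
  exact mul_le_one' (hf i) (pow_le_one' ha i)

theorem val_eval_lt {f : K[X]} {γ : Γ} (hγ : γ ≠ 0) (hf : ∀ i, v (f.coeff i) < γ) {a : K}
    (ha : v a ≤ 1) : v (f.eval a) < γ := by
  rw [eval_eq_sum_range]
  refine v.map_sum_lt hγ fun i _ => ?_
  rw [map_mul, map_pow]
  exact (mul_le_of_le_one_right' (pow_le_one' ha i)).trans_lt (hf i)

theorem val_natCast_le_one (n : ℕ) : v (n : K) ≤ 1 := by
  induction n with
  | zero => simp
  | succ n ih =>
    rw [Nat.cast_succ]
    exact (v.map_add _ _).trans (max_le ih (by simp))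

theorem val_hasseDeriv_eval_le_one {f : K[X]} (hf : ∀ i, v (f.coeff i) ≤ 1) {a : K}
    (ha : v a ≤ 1) (j : ℕ) : v ((hasseDeriv j f).eval a) ≤ 1 := by
  refine val_eval_le_one (fun i => ?_) ha
  rw [hasseDeriv_coeff, map_mul]
  exact mul_le_one' (val_natCast_le_one _) (hf _)

/-- Newton approximation in a henselian field. -/
theorem IsT.newton (h : IsT v t) (f : K[X]) (a d : K)
    (h0 : v (f.eval a) ≤ v ((hasseDeriv 1 f).eval a) * v d)
    (hj : ∀ j, 2 ≤ j → v ((hasseDeriv j f).eval a) * v d ^ j <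
      v ((hasseDeriv 1 f).eval a) * v d) :
    ∃ x, f.eval x = 0 ∧ v (x - a) * v ((hasseDeriv 1 f).eval a) = v (f.eval a) := by
  set f1 := (hasseDeriv 1 f).eval a with hf1
  have hpos : f1 * d ≠ 0 := by
    intro hz
    have := hj 2 le_rfl
    rw [← map_mul, hz, map_zero] at this
    exact not_lt_zero this
  have hd : d ≠ 0 := right_ne_zero_of_mul hpos
  have hf1' : f1 ≠ 0 := left_ne_zero_of_mul hpos
  have hvpos : 0 < v (f1 * d) := (v.pos_iff).2 hpos
  set T := taylor a f with hT
  set P := C (f1 * d)⁻¹ * T.comp (C d * X) with hP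
  have hPc : ∀ i, P.coeff i = (f1 * d)⁻¹ * ((hasseDeriv i f).eval a * d ^ i) := by
    intro i
    rw [hP, coeff_C_mul, comp_C_mul_X_coeff, hT, taylor_coeff]
  have hPev : ∀ y, P.eval y = (f1 * d)⁻¹ * f.eval (a + d * y) := by
    intro y
    rw [hP, eval_mul, eval_C, eval_comp, hT, taylor_eval]
    simp [add_comm]
  set g := P.divX.divX with hg
  have hPg : ∀ y, P.eval y = (f1 * d)⁻¹ * f.eval a + y + y ^ 2 * g.eval y := by
    intro y
    have e1 := P.divX_mul_X_add
    have e2 := P.divX.divX_mul_X_add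
    have c0 : P.coeff 0 = (f1 * d)⁻¹ * f.eval a := by rw [hPc]; simp
    have c1 : P.divX.coeff 0 = 1 := by
      rw [coeff_divX, hPc, zero_add, pow_one]
      exact inv_mul_cancel₀ hpos
    conv_lhs => rw [← e1, ← e2, c0, c1]
    simp only [eval_add, eval_mul, eval_X, eval_C, hg]
    ring
  obtain ⟨y, hy, hy0⟩ := h.hensel g (fun i => by
    rw [hg, coeff_divX, coeff_divX, hPc, map_mul, map_inv₀]
    rw [inv_mul_lt_iff₀ hvpos, mul_one, map_mul, map_pow, map_mul]
    exact hj _ (by omega)) ((f1 * d)⁻¹ * f.eval a) (by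
    rw [map_mul, map_inv₀, inv_mul_le_iff₀ hvpos, mul_one, map_mul]
    exact h0)
  refine ⟨a + d * y, ?_, ?_⟩
  · have := hPg y
    rw [hy0, hPev] at this
    exact (mul_eq_zero.1 this).resolve_left (inv_ne_zero hpos)
  · have hsm : v (g.eval y) < 1 := by
      refine val_eval_lt one_ne_zero (fun i => ?_) hy
      rw [hg, coeff_divX, coeff_divX, hPc, map_mul, map_inv₀]
      rw [inv_mul_lt_iff₀ hvpos, mul_one, map_mul, map_pow, map_mul]
      exact hj _ (by omega)
    have key : v ((f1 * d)⁻¹ * f.eval a) = v y := by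
      have e : (f1 * d)⁻¹ * f.eval a = -(y * (1 + y * g.eval y)) := by linear_combination hy0
      rw [e, Valuation.map_neg, map_mul, Valuation.map_add_eq_of_lt_left, map_one, mul_one]
      rw [map_one, map_mul]
      exact (mul_le_of_le_one_left' hy).trans_lt hsm
    rw [add_sub_cancel_left, map_mul, ← key, map_mul, map_inv₀, map_mul]
    have h1 : v f1 ≠ 0 := v.ne_zero_iff.2 hf1'
    have h2 : v d ≠ 0 := v.ne_zero_iff.2 hd
    field_simp

theorem IsT.hensel_root (h : IsT v t) (f : K[X]) (hf : ∀ i, v (f.coeff i) ≤ 1) (a : K)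
    (ha : v a ≤ 1) (h0 : v (f.eval a) < 1) (h1 : v (f.derivative.eval a) = 1) :
    ∃ x, f.eval x = 0 ∧ v (x - a) < 1 := by
  by_cases hz : f.eval a = 0
  · exact ⟨a, hz, by simp⟩
  have hpos : 0 < v (f.eval a) := v.pos_iff.2 hz
  obtain ⟨x, hx, hx'⟩ := h.newton f a (f.eval a) (by rw [hasseDeriv_one, h1, one_mul])
    (fun j hj => by
      rw [hasseDeriv_one, h1, one_mul]
      calc _ ≤ v (f.eval a) ^ j :=
            mul_le_of_le_one_left' (val_hasseDeriv_eval_le_one hf ha j)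
        _ < v (f.eval a) := by
            simpa using pow_lt_pow_right_of_lt_one₀ hpos h0 (show 1 < j by omega))
  refine ⟨x, hx, ?_⟩
  rw [hasseDeriv_one, h1, mul_one] at hx'
  rwa [hx']

/-- `n`-th roots of elements close to an `n`-th power of a unit. -/
theorem IsT.exists_pow_eq_of_close (h : IsT v t) {n : ℕ} (hn : 0 < n) {u a : K} (ha : v a = 1)
    (hu : v (a ^ n - u) < 1) : ∃ x, x ^ n = u ∧ v (x - a) < 1 := by
  have hu1 : v u ≤ 1 := by
    have : u = a ^ n - (a ^ n - u) := by ring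
    rw [this]
    exact v.map_sub_le (by simp [ha]) hu.le
  obtain ⟨x, hx, hx'⟩ := h.hensel_root (X ^ n - C u) (fun i => by
    rw [coeff_sub, coeff_X_pow, coeff_C]
    refine v.map_sub_le ?_ ?_ <;> split_ifs <;> simp [hu1]) a ha.le (by simpa using hu) (by
    rw [derivative_sub, derivative_X_pow, derivative_C, sub_zero]
    simp [ha, h.natCast n hn.ne'])
  exact ⟨x, by simpa [sub_eq_zero] using hx, hx'⟩

theorem IsT.exists_pow_eq (h : IsT v t) {n : ℕ} (hn : 0 < n) {u : K} (hu : v u = 1) :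
    ∃ x, x ^ n = u := by
  obtain ⟨a, ha, ha'⟩ := h.residue (X ^ n - C u) (monic_X_pow_sub_C _ hn.ne')
    (by rwa [natDegree_X_pow_sub_C]) (fun i => by
    rw [coeff_sub, coeff_X_pow, coeff_C]
    refine v.map_sub_le ?_ ?_ <;> split_ifs <;> simp [hu])
  simp only [eval_sub, eval_pow, eval_X, eval_C] at ha'
  have h1 : v a = 1 := by
    have : v (a ^ n) = 1 := by
      rw [← hu]
      have : a ^ n = u + (a ^ n - u) := by ring
      rw [this, Valuation.map_add_eq_of_lt_left _ (by rwa [hu])]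
    rw [map_pow] at this
    exact (pow_left_inj₀ zero_le zero_le hn.ne').1 (this.trans (one_pow n).symm)
  obtain ⟨x, hx, _⟩ := h.exists_pow_eq_of_close hn h1 ha'
  exact ⟨x, hx⟩

/-- Elements whose values differ by the value of an `n`-th power differ by an `n`-th power. -/
theorem IsT.exists_eq_mul_pow (h : IsT v t) {n : ℕ} (hn : 0 < n) {x z y : K} (hx : x ≠ 0)
    (hxy : v x = v (z * y ^ n)) : ∃ y', x = z * y' ^ n := by
  have hzy : z * y ^ n ≠ 0 := by rw [← v.ne_zero_iff, ← hxy]; exact v.ne_zero_iff.2 hx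
  obtain ⟨u, hu⟩ := h.exists_pow_eq hn (u := x / (z * y ^ n)) (by
    rw [map_div₀, hxy, div_self (v.ne_zero_iff.2 hzy)])
  refine ⟨u * y, ?_⟩
  rw [mul_pow, hu, mul_left_comm, div_mul_cancel₀ _ hzy]

theorem IsT.t_pos (h : IsT v t) : 0 < v t := v.pos_iff.2 h.ne_zero

theorem IsT.zpow_dvd (h : IsT v t) {n : ℕ} {k : ℤ} {y : K} (hk : v (t ^ k) = v (y ^ n))
    (hn : n ≠ 0) : (n : ℤ) ∣ k := by
  by_contra hnd
  obtain ⟨hr0, hrn⟩ : 0 < k % n ∧ k % n < n :=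
    ⟨lt_of_le_of_ne (Int.emod_nonneg _ (by omega)) fun h => hnd (Int.dvd_of_emod_eq_zero h.symm),
      Int.emod_lt_of_pos _ (by omega)⟩
  have ht := h.ne_zero
  have e : v (y * t ^ (-(k / n))) ^ n = v t ^ (k % n) := by
    rw [← map_pow, mul_pow, map_mul, ← hk, ← map_mul, ← zpow_natCast, ← zpow_mul,
      ← zpow_add₀ ht, map_zpow₀]
    congr 1
    have := Int.emod_add_mul_ediv k n
    linarith
  set γ := v (y * t ^ (-(k / n))) with hγ
  have h1 : γ < 1 := by
    by_contra! h1
    have : v t ^ (k % n) < 1 := zpow_lt_one₀ h.t_pos h.lt_one hr0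
    rw [← e] at this
    exact absurd (one_le_pow_of_one_le' h1 n) (not_le.2 this)
  have h2 : γ ≤ v t := h.le_of_lt_one _ h1
  have h3 : γ ^ n ≤ v t ^ n := pow_le_pow_left' h2 n
  rw [e, ← zpow_natCast] at h3
  exact absurd ((zpow_le_zpow_iff_right_of_lt_one₀ h.t_pos h.lt_one).1 h3) (by omega)

end Hensel

section Same

open Polynomial IntermediateField

variable {E B M : Type*} [Field E] [Field B] [Field M] [Algebra E B] [Algebra E M]
  {Γ Γ' : Type*} [LinearOrderedCommGroupWithZero Γ] [LinearOrderedCommGroupWithZero Γ']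

/-- `c` and `c'` have the same valued-field type over `E`. -/
def SameType (E : Type*) [Field E] [Algebra E B] [Algebra E M]
    (v : Valuation B Γ) (w : Valuation M Γ') (c : B) (c' : M) : Prop :=
  ∀ q r : E[X], v (aeval c q) ≤ v (aeval c r) ↔ w (aeval c' q) ≤ w (aeval c' r)

variable {v : Valuation B Γ} {w : Valuation M Γ'} {c : B} {c' : M}

theorem SameType.eq_zero_iff (h : SameType E v w c c') (q : E[X]) :
    aeval c q = 0 ↔ aeval c' q = 0 := by
  simpa using h q 0

theorem SameType.exists_algHom (h : SameType E v w c c') :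
    ∃ σ : E⟮c⟯ →ₐ[E] M, σ (AdjoinSimple.gen E c) = c' ∧
      ∀ x y : E⟮c⟯, v x ≤ v y ↔ w (σ x) ≤ w (σ y) := by
  have hex : ∀ z : E⟮c⟯, ∃ r s : E[X], aeval c s ≠ 0 ∧ (z : B) = aeval c r / aeval c s := by
    rintro ⟨z, hz⟩
    obtain ⟨r, s, hrs⟩ := mem_adjoin_simple_iff E z |>.1 hz
    by_cases hs : aeval c s = 0
    · exact ⟨0, 1, by simp, by simp [hrs, hs]⟩
    · exact ⟨r, s, hs, hrs⟩
  choose r s hs hz using hex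
  have hs' : ∀ z, aeval c' (s z) ≠ 0 := fun z => (h.eq_zero_iff _).not.1 (hs z)
  have key : ∀ (z : E⟮c⟯) (p q : E[X]), aeval c q ≠ 0 → (z : B) = aeval c p / aeval c q →
      aeval c' (r z) / aeval c' (s z) = aeval c' p / aeval c' q := by
    intro z p q hq hpq
    have hq' := (h.eq_zero_iff _).not.1 hq
    rw [hz, div_eq_div_iff (hs z) hq, ← sub_eq_zero, ← map_mul, ← map_mul, ← map_sub,
      h.eq_zero_iff, map_sub, map_mul, map_mul, sub_eq_zero] at hpq
    rwa [div_eq_div_iff (hs' z) hq']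
  refine ⟨{ toFun := fun z => aeval c' (r z) / aeval c' (s z)
            map_one' := ?_, map_mul' := ?_, map_zero' := ?_, map_add' := ?_,
            commutes' := ?_ }, ?_, ?_⟩
  · rw [key 1 1 1 (by simp) (by simp)]
    simp
  · intro x y
    rw [key (x * y) (r x * r y) (s x * s y) (by simp [hs])
      (by rw [MulMemClass.coe_mul, hz x, hz y, div_mul_div_comm, map_mul, map_mul])]
    rw [div_mul_div_comm, map_mul, map_mul]
  · rw [key 0 0 1 (by simp) (by simp)]
    simp
  · intro x y
    rw [key (x + y) (r x * s y + s x * r y) (s x * s y) (by simp [hs])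
      (by rw [AddMemClass.coe_add, hz x, hz y, div_add_div _ _ (hs x) (hs y)]; simp)]
    rw [div_add_div _ _ (hs' x) (hs' y)]
    simp
  · intro e
    rw [key (algebraMap E _ e) (C e) 1 (by simp) (by simp)]
    simp
  · change aeval c' (r _) / aeval c' (s _) = c'
    rw [key _ X 1 (by simp) (by simp)]
    simp
  · intro x y
    change _ ↔ w (aeval c' (r x) / aeval c' (s x)) ≤ w (aeval c' (r y) / aeval c' (s y))
    rw [hz x, hz y]
    simp only [map_div₀]
    rw [div_le_div_iff₀ (v.pos_iff.2 (hs x)) (v.pos_iff.2 (hs y)),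
      div_le_div_iff₀ (w.pos_iff.2 (hs' x)) (w.pos_iff.2 (hs' y))]
    simpa using h (r x * s y) (r y * s x)

/-- For a root of the minimal polynomial it suffices to compare values of polynomials of
small degree. -/
theorem SameType.of_minpoly (hc : IsIntegral E c) (hc' : aeval c' (minpoly E c) = 0)
    (h : ∀ q r : E[X], q.natDegree < (minpoly E c).natDegree →
      r.natDegree < (minpoly E c).natDegree →
      (v (aeval c q) ≤ v (aeval c r) ↔ w (aeval c' q) ≤ w (aeval c' r))) :
    SameType E v w c c' := by
  have hm := minpoly.monic hc
  have e1 : ∀ q : E[X], aeval c q = aeval c (q %ₘ minpoly E c) := fun q =>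
    (aeval_modByMonic_eq_self_of_root (minpoly.aeval E c)).symm
  have e2 : ∀ q : E[X], aeval c' q = aeval c' (q %ₘ minpoly E c) := fun q =>
    (aeval_modByMonic_eq_self_of_root hc').symm
  intro q r
  rw [e1 q, e1 r, e2 q, e2 r]
  have h1 : minpoly E c ≠ 1 := minpoly.ne_one E c
  exact h _ _ (natDegree_modByMonic_lt _ hm h1) (natDegree_modByMonic_lt _ hm h1)

/-- If no monic integral polynomial of small degree has a small value at `c`, then values of
polynomials at `c` are given by the Gauss valuation. -/
theorem gauss_val {n : ℕ} (hc : v c ≤ 1)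
    (h : ∀ p : E[X], p.Monic → p.natDegree < n → (∀ i, v (algebraMap E B (p.coeff i)) ≤ 1) →
      v (aeval c p) = 1) (q : E[X]) (hq0 : q ≠ 0) (hq : q.natDegree < n) :
    ∃ j, v (aeval c q) = v (algebraMap E B (q.coeff j)) ∧
      ∀ i, v (algebraMap E B (q.coeff i)) ≤ v (algebraMap E B (q.coeff j)) := by
  induction hk : q.support.card using Nat.strong_induction_on generalizing q with
  | _ k ih =>
  have hlead : v (algebraMap E B q.leadingCoeff) ≠ 0 := by simpa using hq0
  by_cases hmax : ∀ i, v (algebraMap E B (q.coeff i)) ≤ v (algebraMap E B q.leadingCoeff)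
  · refine ⟨q.natDegree, ?_, hmax⟩
    have hl : q.leadingCoeff ≠ 0 := leadingCoeff_ne_zero.2 hq0
    have := h (q * C q.leadingCoeff⁻¹) (monic_mul_leadingCoeff_inv hq0)
      (by rwa [natDegree_mul_C (inv_ne_zero hl)]) (fun i => by
        rw [coeff_mul_C, map_mul, map_mul, map_inv₀, map_inv₀,
          mul_inv_le_iff₀ (zero_lt_iff.2 hlead), one_mul]
        exact hmax i)
    rw [map_mul, aeval_C, map_mul, map_inv₀, map_inv₀, mul_inv_eq_one₀ hlead] at this
    exact this
  push Not at hmax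
  obtain ⟨i, hi⟩ := hmax
  have hcoeff : ∀ j, j ≠ q.natDegree → q.eraseLead.coeff j = q.coeff j :=
    fun j hj => eraseLead_coeff_of_ne j hj
  have hin : i ≠ q.natDegree := by rintro rfl; exact lt_irrefl _ hi
  have he0 : q.eraseLead ≠ 0 := by
    intro h0
    rw [← hcoeff i hin, h0] at hi
    simp at hi
  obtain ⟨j, hj, hjmax⟩ := ih _ (hk ▸ eraseLead_support_card_lt hq0) q.eraseLead he0
    ((eraseLead_natDegree_le q).trans_lt (by omega)) rfl
  have hij := hjmax i
  rw [hcoeff i hin] at hij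
  have hjn : j ≠ q.natDegree := by
    rintro rfl
    rw [eraseLead_coeff_natDegree] at hij
    simp only [map_zero] at hij
    exact absurd (hi.trans_le hij) not_lt_zero
  rw [hcoeff j hjn] at hj hij hjmax
  refine ⟨j, ?_, fun k => ?_⟩
  · conv_lhs => rw [← eraseLead_add_C_mul_X_pow q]
    rw [map_add, map_mul, aeval_C, map_pow, aeval_X, Valuation.map_add_eq_of_lt_left, hj]
    rw [hj, map_mul, map_pow]
    exact (mul_le_of_le_one_right' (pow_le_one' hc _)).trans_lt (hi.trans_le hij)
  · by_cases hkn : k = q.natDegree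
    · rw [hkn]; exact (hi.trans_le hij).le
    · have := hjmax k
      rwa [hcoeff k hkn] at this

end Same

section Taylor

open Polynomial

variable {E B : Type*} [Field E] [Field B] [Algebra E B]
  {Γ : Type*} [LinearOrderedCommGroupWithZero Γ] {v : Valuation B Γ}

theorem hasseDeriv_map_algebraMap (q : E[X]) (j : ℕ) :
    hasseDeriv j (q.map (algebraMap E B)) = (hasseDeriv j q).map (algebraMap E B) := by
  ext i
  simp [hasseDeriv_coeff]

theorem eval_hasseDeriv_map (q : E[X]) (j : ℕ) (x : B) :
    (hasseDeriv j (q.map (algebraMap E B))).eval x = aeval x (hasseDeriv j q) := by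
  rw [hasseDeriv_map_algebraMap, eval_map_algebraMap]

theorem algebraMap_eval (q : E[X]) (e : E) :
    algebraMap E B (q.eval e) = aeval (algebraMap E B e) q := by
  rw [aeval_algebraMap_apply, coe_aeval_eq_eval]

theorem aeval_taylor (q : E[X]) (x y : B) :
    aeval y q = ∑ j ∈ Finset.range (q.natDegree + 1),
      aeval x (hasseDeriv j q) * (y - x) ^ j := by
  have h := taylor_eval x (q.map (algebraMap E B)) (y - x)
  rw [sub_add_cancel, eval_map_algebraMap, eval_eq_sum_range, natDegree_taylor,
    natDegree_map] at h
  rw [← h]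
  refine Finset.sum_congr rfl fun j _ => ?_
  rw [taylor_coeff, eval_hasseDeriv_map]

theorem val_eq_of_taylor_lt {q : E[X]} {x y : B}
    (h : ∀ j, 1 ≤ j → v (aeval x (hasseDeriv j q)) * v (y - x) ^ j < v (aeval x q)) :
    v (aeval y q) = v (aeval x q) := by
  have h0 : v (aeval x q) ≠ 0 := ((zero_le).trans_lt (h 1 le_rfl)).ne'
  rw [aeval_taylor q x y, Finset.sum_range_succ']
  simp only [hasseDeriv_zero', pow_zero, mul_one]
  refine v.map_add_eq_of_lt_right (v.map_sum_lt h0 fun j _ => ?_)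
  rw [map_mul, map_pow]
  exact h _ (by omega)

theorem val_sub_eq_of_taylor_lt {q : E[X]} {x y : B}
    (h : ∀ j, 2 ≤ j → v (aeval x (hasseDeriv j q)) * v (y - x) ^ j <
      v (aeval x (hasseDeriv 1 q)) * v (y - x)) :
    v (aeval y q - aeval x q) = v (aeval x (hasseDeriv 1 q)) * v (y - x) := by
  have h0 : v (aeval x (hasseDeriv 1 q)) * v (y - x) ≠ 0 := ((zero_le).trans_lt (h 2 le_rfl)).ne'
  have hd : q.natDegree ≠ 0 := by
    intro hd
    rw [hasseDeriv_eq_zero_of_lt_natDegree _ _ (by omega)] at h0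
    simp at h0
  obtain ⟨n, hn⟩ := Nat.exists_eq_succ_of_ne_zero hd
  rw [aeval_taylor q x y, hn, Finset.sum_range_succ', Finset.sum_range_succ']
  simp only [hasseDeriv_zero', pow_zero, mul_one, add_sub_cancel_right, zero_add, pow_one]
  rw [v.map_add_eq_of_lt_right, map_mul]
  refine v.map_sum_lt (by rwa [map_mul]) fun j _ => ?_
  rw [map_mul, map_mul, map_pow]
  exact h _ (by omega)

end Taylor

section Immediate

open Polynomial

variable {E B M : Type*} [Field E] [Field B] [Field M] [Algebra E B] [Algebra E M]
  {Γ Γ' : Type*} [LinearOrderedCommGroupWithZero Γ] [LinearOrderedCommGroupWithZero Γ']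

/-- The filter of elements of `E` approaching `c`. -/
def approx (E : Type*) [Field E] [Algebra E B] (v : Valuation B Γ) (c : B) : Filter E where
  sets := {S | ∃ e₀ : E, ∀ e, v (c - algebraMap E B e) ≤ v (c - algebraMap E B e₀) → e ∈ S}
  univ_sets := ⟨0, fun _ _ => trivial⟩
  sets_of_superset := fun ⟨e, h⟩ hs => ⟨e, fun x hx => hs (h x hx)⟩
  inter_sets := by
    rintro S T ⟨e, h⟩ ⟨e', h'⟩
    rcases le_total (v (c - algebraMap E B e)) (v (c - algebraMap E B e')) with hl | hl
    · exact ⟨e, fun x hx => ⟨h x hx, h' x (hx.trans hl)⟩⟩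
    · exact ⟨e', fun x hx => ⟨h x (hx.trans hl), h' x hx⟩⟩

variable {v : Valuation B Γ} {w : Valuation M Γ'} {c : B} {c' : M}

open Filter

theorem eventually_approx {P : E → Prop} : (∀ᶠ e in approx E v c, P e) ↔
    ∃ e₀ : E, ∀ e, v (c - algebraMap E B e) ≤ v (c - algebraMap E B e₀) → P e := Iff.rfl

instance : (approx E v c).NeBot := by
  rw [neBot_iff]
  intro h
  have : ∀ᶠ e in approx E v c, False := by rw [h]; trivial
  obtain ⟨e, he⟩ := eventually_approx.1 this
  exact he e le_rfl

theorem eventually_le (e : E) :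
    ∀ᶠ e' in approx E v c, v (c - algebraMap E B e') ≤ v (c - algebraMap E B e) :=
  eventually_approx.2 ⟨e, fun _ h => h⟩

/-- `c` has no best approximation in `E`. -/
def IsLimitOver (E : Type*) [Field E] [Algebra E B] (v : Valuation B Γ) (c : B) : Prop :=
  ∀ e : E, ∃ e' : E, v (c - algebraMap E B e') < v (c - algebraMap E B e)

theorem IsLimitOver.eventually_lt (h : IsLimitOver E v c) (e : E) :
    ∀ᶠ e' in approx E v c, v (c - algebraMap E B e') < v (c - algebraMap E B e) := by
  obtain ⟨e', he'⟩ := h e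
  exact (eventually_le e').mono fun x hx => hx.trans_lt he'

theorem IsLimitOver.pos (h : IsLimitOver E v c) (e : E) : 0 < v (c - algebraMap E B e) := by
  obtain ⟨e', he'⟩ := h e
  exact zero_le.trans_lt he'

theorem val_sub_of_lt {e e' : E} (h : v (c - algebraMap E B e') < v (c - algebraMap E B e)) :
    v (algebraMap E B e' - algebraMap E B e) = v (c - algebraMap E B e) := by
  have : algebraMap E B e' - algebraMap E B e =
    (c - algebraMap E B e) - (c - algebraMap E B e') := by ring
  rw [this, v.map_sub_eq_of_lt_left h]

theorem IsLimitOver.mono_or (h : IsLimitOver E v c) {i j : ℕ} (hij : i < j) (a b : Γ)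
    (hab : a ≠ 0 ∨ b ≠ 0) :
    (∀ᶠ e in approx E v c, a * v (c - algebraMap E B e) ^ i < b * v (c - algebraMap E B e) ^ j) ∨
    ∀ᶠ e in approx E v c, b * v (c - algebraMap E B e) ^ j < a * v (c - algebraMap E B e) ^ i := by
  obtain ⟨k, rfl⟩ := Nat.exists_eq_add_of_lt hij
  by_cases hex : ∃ e, b * v (c - algebraMap E B e) ^ (k + 1) ≤ a
  · right
    obtain ⟨e, he⟩ := hex
    filter_upwards [h.eventually_lt e] with x hx
    rw [add_assoc, pow_add, mul_left_comm, mul_comm a]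
    refine mul_lt_mul_of_pos_left ?_ (pow_pos (h.pos x) i)
    by_cases hb : b = 0
    · simpa [hb, zero_lt_iff] using hab
    · exact (mul_lt_mul_of_pos_left (pow_lt_pow_left₀ hx zero_le (by omega))
        (zero_lt_iff.2 hb)).trans_le he
  · left
    push Not at hex
    refine Eventually.of_forall fun x => ?_
    rw [add_assoc, pow_add, mul_left_comm, mul_comm a]
    exact mul_lt_mul_of_pos_left (hex x) (pow_pos (h.pos x) i)

theorem IsLimitOver.exists_dominant (h : IsLimitOver E v c) (g : ℕ → Γ) (S : Finset ℕ)
    (hS : ∃ j ∈ S, g j ≠ 0) : ∃ j₀ ∈ S, g j₀ ≠ 0 ∧ ∀ᶠ e in approx E v c, ∀ j ∈ S, j ≠ j₀ →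
      g j * v (c - algebraMap E B e) ^ j < g j₀ * v (c - algebraMap E B e) ^ j₀ := by
  induction S using Finset.induction_on with
  | empty => simp at hS
  | insert a S ha ih =>
    by_cases hS' : ∃ j ∈ S, g j ≠ 0
    · obtain ⟨j₀, hj₀, hg, hev⟩ := ih hS'
      have hne : a ≠ j₀ := by rintro rfl; exact ha hj₀
      have hcmp : (∀ᶠ e in approx E v c, g a * v (c - algebraMap E B e) ^ a <
            g j₀ * v (c - algebraMap E B e) ^ j₀) ∨
          (∀ᶠ e in approx E v c, g j₀ * v (c - algebraMap E B e) ^ j₀ <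
            g a * v (c - algebraMap E B e) ^ a) := by
        rcases lt_or_gt_of_ne hne with hl | hl
        · exact h.mono_or hl _ _ (Or.inr hg)
        · exact (h.mono_or hl _ _ (Or.inl hg)).symm
      rcases hcmp with hc | hc
      · refine ⟨j₀, Finset.mem_insert_of_mem hj₀, hg, ?_⟩
        filter_upwards [hev, hc] with e h1 h2 j hj hjj
        rcases Finset.mem_insert.1 hj with rfl | hj
        · exact h2
        · exact h1 j hj hjj
      · obtain ⟨e, he⟩ := hc.exists
        refine ⟨a, Finset.mem_insert_self _ _, ?_, ?_⟩
        · intro h0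
          rw [h0, zero_mul] at he
          exact not_lt_zero he
        filter_upwards [hev, hc] with e h1 h2 j hj hjj
        have hj := (Finset.mem_insert.1 hj).resolve_left hjj
        by_cases hjj' : j = j₀
        · rwa [hjj']
        · exact (h1 j hj hjj').trans h2
    · push Not at hS'
      obtain ⟨j, hj, hg⟩ := hS
      rcases Finset.mem_insert.1 hj with rfl | hj
      · refine ⟨j, hj, hg, Eventually.of_forall fun e i hi hij => ?_⟩
        rw [hS' i ((Finset.mem_insert.1 hi).resolve_left hij), zero_mul]
        exact mul_pos (zero_lt_iff.2 hg) (pow_pos (h.pos e) _)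
      · exact absurd (hS' j hj) hg

/-- The value of `q` at approximations to `c` stabilises. -/
def Stable (E : Type*) [Field E] [Algebra E B] (v : Valuation B Γ) (c : B) (q : E[X]) : Prop :=
  ∀ᶠ e in approx E v c, ∀ j, 1 ≤ j →
    v (algebraMap E B ((hasseDeriv j q).eval e)) * v (c - algebraMap E B e) ^ j <
      v (algebraMap E B (q.eval e))

theorem Stable.eventually_eq {q : E[X]} (h : Stable E v c q) :
    ∀ᶠ e in approx E v c, v (algebraMap E B (q.eval e)) = v (aeval c q) := by
  filter_upwards [h] with e he
  simp only [algebraMap_eval] at he ⊢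
  exact (val_eq_of_taylor_lt he).symm

theorem stable_of_natDegree_eq_zero {q : E[X]} (hq : q ≠ 0) (hd : q.natDegree = 0) :
    Stable E v c q := by
  refine Eventually.of_forall fun e j hj => ?_
  rw [hasseDeriv_eq_zero_of_lt_natDegree _ _ (by omega)]
  rw [eq_C_of_natDegree_eq_zero hd] at hq ⊢
  simp only [eval_zero, map_zero, zero_mul, eval_C]
  exact v.pos_iff.2 ((_root_.map_ne_zero _).2 (by simpa using hq))

/-- Value behaviour of a polynomial with a root closer to `c` than all elements of `E`. -/
structure Linear (E : Type*) [Field E] [Algebra E B] (v : Valuation B Γ) (c : B)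
    (q : E[X]) : Prop where
  lt : ∀ e : E, v (aeval c q) < v (aeval c (hasseDeriv 1 q)) * v (c - algebraMap E B e)
  dom : ∀ᶠ e in approx E v c, ∀ j, 2 ≤ j →
    v (aeval c (hasseDeriv j q)) * v (c - algebraMap E B e) ^ j <
      v (aeval c (hasseDeriv 1 q)) * v (c - algebraMap E B e)

theorem eventually_dom (hchar : ∀ n : ℕ, n ≠ 0 → v (n : B) = 1) (h : IsLimitOver E v c)
    {q : E[X]} (hd : q.natDegree ≠ 0)
    (hq : ∀ᶠ e in approx E v c, v (algebraMap E B ((hasseDeriv 1 q).eval e)) =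
      v (aeval c (hasseDeriv 1 q))) :
    ∀ᶠ e in approx E v c, ∀ j, 2 ≤ j →
      v (aeval c (hasseDeriv j q)) * v (c - algebraMap E B e) ^ j <
      v (aeval c (hasseDeriv 1 q)) * v (c - algebraMap E B e) := by
  have hlead : v (aeval c (hasseDeriv q.natDegree q)) ≠ 0 := by
    rw [hasseDeriv_natDegree_eq_C, aeval_C, v.ne_zero_iff, _root_.map_ne_zero, Ne,
      leadingCoeff_eq_zero]
    rintro rfl
    simp at hd
  have hzero : ∀ j, q.natDegree < j → v (aeval c (hasseDeriv j q)) = 0 := fun j hj => by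
    rw [hasseDeriv_eq_zero_of_lt_natDegree _ _ hj]; simp
  by_cases hd1 : q.natDegree = 1
  · refine Eventually.of_forall fun e j hj => ?_
    rw [hzero j (by omega), zero_mul, ← hd1]
    exact mul_pos (zero_lt_iff.2 hlead) (h.pos e)
  obtain ⟨j₀, hj₀, hg, hev⟩ := h.exists_dominant (fun j => v (aeval c (hasseDeriv j q)))
    (Finset.Icc 2 q.natDegree) ⟨q.natDegree, by simp; omega, hlead⟩
  rw [Finset.mem_Icc] at hj₀
  set g := fun j => v (aeval c (hasseDeriv j q)) with hgdef
  have hdiff : ∀ᶠ e in approx E v c, g j₀ * v (c - algebraMap E B e) ^ j₀ ≤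
      g 1 * v (c - algebraMap E B e) := by
    filter_upwards [hev, hq] with e he hqe
    have hp := h.pos e
    suffices g j₀ * v (c - algebraMap E B e) ^ (j₀ - 1) ≤ g 1 by
      calc _ = g j₀ * v (c - algebraMap E B e) ^ (j₀ - 1) * v (c - algebraMap E B e) := by
            rw [mul_assoc, ← pow_succ]; congr 2; omega
        _ ≤ _ := mul_le_mul_left this _
    have hexp := aeval_taylor (hasseDeriv 1 q) c (algebraMap E B e)
    rw [Finset.sum_range_succ'] at hexp
    simp only [hasseDeriv_zero', pow_zero, mul_one] at hexp
    have hterm : ∀ k, v (aeval c (hasseDeriv (k + 1) (hasseDeriv 1 q)) *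
        (algebraMap E B e - c) ^ (k + 1)) = g (k + 2) * v (c - algebraMap E B e) ^ (k + 1) := by
      intro k
      have : hasseDeriv (k + 1) (hasseDeriv 1 q) = ((k + 2 : ℕ) : E[X]) * hasseDeriv (k + 2) q := by
        have := congrArg (fun f => f q) (hasseDeriv_comp (R := E) (k + 1) 1)
        simp only [LinearMap.comp_apply, LinearMap.smul_apply] at this
        rw [this, nsmul_eq_mul]
        congr 2
        simp
      rw [this, map_mul, map_mul, map_pow, map_mul, map_natCast, hchar _ (by omega), one_mul,
        v.map_sub_swap]
    have hsum : v (∑ k ∈ Finset.range (hasseDeriv 1 q).natDegree,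
        aeval c (hasseDeriv (k + 1) (hasseDeriv 1 q)) * (algebraMap E B e - c) ^ (k + 1)) =
        g j₀ * v (c - algebraMap E B e) ^ (j₀ - 1) := by
      have e1 : j₀ - 2 + 2 = j₀ := by omega
      have e2 : j₀ - 2 + 1 = j₀ - 1 := by omega
      have hpos : g j₀ * v (c - algebraMap E B e) ^ (j₀ - 1) ≠ 0 :=
        mul_ne_zero hg (pow_ne_zero _ hp.ne')
      have hnd : j₀ - 2 < (hasseDeriv 1 q).natDegree := by
        by_contra! hcon
        have hz : hasseDeriv (j₀ - 2 + 1) (hasseDeriv 1 q) = 0 :=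
          hasseDeriv_eq_zero_of_lt_natDegree _ _ (by omega)
        have := hterm (j₀ - 2)
        rw [hz, e1, e2] at this
        simp only [map_zero, zero_mul] at this
        exact hpos this.symm
      rw [v.map_sum_eq_of_lt (j := j₀ - 2) (Finset.mem_range.2 hnd), hterm, e1, e2]
      · intro k hk
        rw [Finset.mem_sdiff, Finset.mem_range, Finset.mem_singleton] at hk
        rw [hterm, hterm, e1, e2]
        by_cases hk2 : k + 2 ≤ q.natDegree
        · have := he (k + 2) (Finset.mem_Icc.2 ⟨by omega, hk2⟩) (by omega)
          have e3 : k + 2 = (k + 1) + 1 := rfl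
          have e4 : j₀ = (j₀ - 1) + 1 := by omega
          change g (k + 2) * _ < g j₀ * _ at this
          conv at this => rw [show v (c - algebraMap E B e) ^ (k + 2) =
            v (c - algebraMap E B e) ^ (k + 1) * v (c - algebraMap E B e) from pow_succ _ _]
          conv at this => rhs; rw [show v (c - algebraMap E B e) ^ j₀ =
            v (c - algebraMap E B e) ^ (j₀ - 1) * v (c - algebraMap E B e) by
              rw [← pow_succ]; congr 1]
          rw [← mul_assoc, ← mul_assoc] at this
          exact lt_of_mul_lt_mul_right this zero_le
        · change v _ * _ < _
          rw [hzero (k + 2) (by omega), zero_mul]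
          exact zero_lt_iff.2 hpos
    rw [← hsum, ← sub_eq_of_eq_add hexp, ← algebraMap_eval]
    exact v.map_sub_le hqe.le le_rfl
  obtain ⟨e₁, he₁⟩ := hdiff.exists
  filter_upwards [hev, h.eventually_lt e₁] with e he hlt j hj
  have hp := h.pos e
  have hmain : g j₀ * v (c - algebraMap E B e) ^ j₀ < g 1 * v (c - algebraMap E B e) := by
    have e4 : j₀ = (j₀ - 1) + 1 := by omega
    have h1 : g j₀ * v (c - algebraMap E B e₁) ^ (j₀ - 1) ≤ g 1 := by
      rw [show v (c - algebraMap E B e₁) ^ j₀ = v (c - algebraMap E B e₁) ^ (j₀ - 1) *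
        v (c - algebraMap E B e₁) by rw [← pow_succ, ← e4], ← mul_assoc] at he₁
      exact le_of_mul_le_mul_right he₁ (h.pos e₁)
    have h2 : g j₀ * v (c - algebraMap E B e) ^ (j₀ - 1) < g 1 :=
      (mul_lt_mul_of_pos_left (pow_lt_pow_left₀ hlt zero_le (by omega))
        (zero_lt_iff.2 hg)).trans_le h1
    calc _ = g j₀ * v (c - algebraMap E B e) ^ (j₀ - 1) * v (c - algebraMap E B e) := by
          rw [mul_assoc, ← pow_succ, ← e4]
      _ < _ := mul_lt_mul_of_pos_right h2 hp
  by_cases hjd : j ≤ q.natDegree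
  · by_cases hjj : j = j₀
    · rw [hjj]; exact hmain
    · exact (he j (Finset.mem_Icc.2 ⟨hj, hjd⟩) hjj).trans hmain
  · rw [hzero j (by omega), zero_mul]
    exact zero_le.trans_lt hmain

theorem stable_or_linear (hchar : ∀ n : ℕ, n ≠ 0 → v (n : B) = 1) (h : IsLimitOver E v c)
    {q : E[X]} (hd : q.natDegree ≠ 0)
    (hq : ∀ᶠ e in approx E v c, ∀ j, 1 ≤ j → v (algebraMap E B ((hasseDeriv j q).eval e)) =
      v (aeval c (hasseDeriv j q))) :
    Stable E v c q ∨ Linear E v c q := by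
  have hdom := eventually_dom hchar h hd (hq.mono fun e he => he 1 le_rfl)
  by_cases hlt : ∀ e : E, v (aeval c q) <
      v (aeval c (hasseDeriv 1 q)) * v (c - algebraMap E B e)
  · exact Or.inr ⟨hlt, hdom⟩
  push Not at hlt
  obtain ⟨e₁, he₁⟩ := hlt
  left
  filter_upwards [hdom, hq, h.eventually_lt e₁] with e he hqe hlt
  have h1 : v (aeval c (hasseDeriv 1 q)) ≠ 0 := by
    intro h0
    have := he 2 le_rfl
    rw [h0, zero_mul] at this
    exact not_lt_zero this
  have h2 : v (aeval c (hasseDeriv 1 q)) * v (c - algebraMap E B e) < v (aeval c q) :=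
    (mul_lt_mul_of_pos_left hlt (zero_lt_iff.2 h1)).trans_le he₁
  have h3 : ∀ j, 1 ≤ j →
      v (aeval c (hasseDeriv j q)) * v (algebraMap E B e - c) ^ j < v (aeval c q) := by
    intro j hj
    rw [v.map_sub_swap]
    rcases hj.eq_or_lt with rfl | hj
    · simpa using h2
    · exact (he j hj).trans h2
  intro j hj
  rw [hqe j hj, algebraMap_eval, val_eq_of_taylor_lt h3, ← v.map_sub_swap]
  exact h3 j hj

end Immediate

section Transfer

open Polynomial Filter

variable {E B M : Type*} [Field E] [Field B] [Field M] [Algebra E B] [Algebra E M]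
  {Γ Γ' : Type*} [LinearOrderedCommGroupWithZero Γ] [LinearOrderedCommGroupWithZero Γ']

/-- Two valuations induce the same preorder on `E`. -/
def IsoOn (E : Type*) [Field E] [Algebra E B] [Algebra E M]
    (v : Valuation B Γ) (w : Valuation M Γ') : Prop :=
  ∀ x y : E, v (algebraMap E B x) ≤ v (algebraMap E B y) ↔
    w (algebraMap E M x) ≤ w (algebraMap E M y)

variable {v : Valuation B Γ} {w : Valuation M Γ'} {c : B} {c' : M} {t : B} {t' : M}

theorem IsoOn.lt_iff (h : IsoOn E v w) (x y : E) :
    v (algebraMap E B x) < v (algebraMap E B y) ↔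
    w (algebraMap E M x) < w (algebraMap E M y) := by
  simpa using (h y x).not

theorem IsoOn.eq_iff (h : IsoOn E v w) (x y : E) :
    v (algebraMap E B x) = v (algebraMap E B y) ↔
    w (algebraMap E M x) = w (algebraMap E M y) := by
  rw [le_antisymm_iff, le_antisymm_iff, h x y, h y x]

theorem IsoOn.le_one_iff (h : IsoOn E v w) (x : E) :
    v (algebraMap E B x) ≤ 1 ↔ w (algebraMap E M x) ≤ 1 := by
  simpa using h x 1

theorem IsoOn.lt_one_iff (h : IsoOn E v w) (x : E) :
    v (algebraMap E B x) < 1 ↔ w (algebraMap E M x) < 1 := by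
  simpa using h.lt_iff x 1

theorem IsoOn.mul_pow_lt_iff (h : IsoOn E v w) (x y e e' : E) (j : ℕ) :
    v (algebraMap E B x) * v (algebraMap E B e' - algebraMap E B e) ^ j <
      v (algebraMap E B y) * v (algebraMap E B e' - algebraMap E B e) ↔
    w (algebraMap E M x) * w (algebraMap E M e' - algebraMap E M e) ^ j <
      w (algebraMap E M y) * w (algebraMap E M e' - algebraMap E M e) := by
  simpa only [map_mul, map_pow, map_sub] using h.lt_iff (x * (e' - e) ^ j) (y * (e' - e))

theorem IsoOn.eq_mul_iff (h : IsoOn E v w) (x y e e' : E) :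
    v (algebraMap E B x) = v (algebraMap E B y) * v (algebraMap E B e' - algebraMap E B e) ↔
    w (algebraMap E M x) = w (algebraMap E M y) * w (algebraMap E M e' - algebraMap E M e) := by
  simpa only [map_mul, map_pow, map_sub] using h.eq_iff x (y * (e' - e))

theorem mul_pow_lt_of_le {a b d δ : Γ} {j : ℕ} (hj : 1 ≤ j) (h : a * d ^ j < b * d) (hδ : 0 < δ)
    (hle : δ ≤ d) : a * δ ^ j < b * δ := by
  obtain ⟨k, rfl⟩ := Nat.exists_eq_add_of_le' hj
  rw [pow_succ, ← mul_assoc] at h ⊢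
  exact mul_lt_mul_of_pos_right ((mul_le_mul_right (pow_le_pow_left' hle k) a).trans_lt
    (lt_of_mul_lt_mul_right h zero_le)) hδ

theorem SameType.of_values (h : IsoOn E v w)
    (hv : ∀ q : E[X], ∃ x : E, v (aeval c q) = v (algebraMap E B x) ∧
      w (aeval c' q) = w (algebraMap E M x)) : SameType E v w c c' := by
  intro q r
  obtain ⟨x, h1, h2⟩ := hv q
  obtain ⟨y, h3, h4⟩ := hv r
  rw [h1, h2, h3, h4]
  exact h x y

theorem SameType.of_minpoly_values (h : IsoOn E v w) (hc : IsIntegral E c)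
    (hc' : aeval c' (minpoly E c) = 0)
    (hv : ∀ q : E[X], q.natDegree < (minpoly E c).natDegree → ∃ x : E,
      v (aeval c q) = v (algebraMap E B x) ∧ w (aeval c' q) = w (algebraMap E M x)) :
    SameType E v w c c' := by
  refine SameType.of_minpoly hc hc' fun q r hq hr => ?_
  obtain ⟨x, h1, h2⟩ := hv q hq
  obtain ⟨y, h3, h4⟩ := hv r hr
  rw [h1, h2, h3, h4]
  exact h x y

theorem Linear.exists_root (hB : IsT v t) {q : E[X]} (hq : Linear E v c q) :
    ∃ x : B, aeval x q = 0 ∧ ∀ e : E, v (c - x) < v (c - algebraMap E B e) := by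
  obtain ⟨e, he⟩ := hq.dom.exists
  obtain ⟨x, hx, hx'⟩ := hB.newton (q.map (algebraMap E B)) c (c - algebraMap E B e)
    (by rw [eval_hasseDeriv_map, eval_map_algebraMap]; exact (hq.lt e).le)
    (fun j hj => by rw [eval_hasseDeriv_map, eval_hasseDeriv_map]; exact he j hj)
  rw [eval_hasseDeriv_map, eval_map_algebraMap, v.map_sub_swap] at hx'
  rw [eval_map_algebraMap] at hx
  refine ⟨x, hx, fun e => ?_⟩
  have := hq.lt e
  rw [← hx', mul_comm] at this
  exact lt_of_mul_lt_mul_left this zero_le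

theorem stable_of_no_root (hB : IsT v t) (h : IsLimitOver E v c) {N : ℕ}
    (hroot : ∀ (x : B) (q : E[X]), q ≠ 0 → q.natDegree ≤ N → aeval x q = 0 →
      ∃ e : E, v (c - algebraMap E B e) ≤ v (c - x)) (q : E[X]) (hq : q ≠ 0)
    (hd : q.natDegree ≤ N) : Stable E v c q := by
  induction hk : q.natDegree using Nat.strong_induction_on generalizing q with
  | _ k ih =>
  by_cases hk0 : q.natDegree = 0
  · exact stable_of_natDegree_eq_zero hq hk0
  rcases stable_or_linear hB.natCast h hk0 (by
    have : ∀ᶠ e in approx E v c, ∀ j ∈ Finset.Icc 1 q.natDegree,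
        v (algebraMap E B ((hasseDeriv j q).eval e)) = v (aeval c (hasseDeriv j q)) := by
      rw [eventually_all_finset]
      intro j hj
      rw [Finset.mem_Icc] at hj
      by_cases hz : hasseDeriv j q = 0
      · simp [hz]
      · have := natDegree_hasseDeriv_le q j
        exact (ih _ (by omega) _ hz (by omega) rfl).eventually_eq
    filter_upwards [this] with e he j hj
    by_cases hjd : j ≤ q.natDegree
    · exact he j (Finset.mem_Icc.2 ⟨hj, hjd⟩)
    · rw [hasseDeriv_eq_zero_of_lt_natDegree _ _ (by omega)]
      simp) with hs | hl
  · exact hs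
  · obtain ⟨x, hx, hlt⟩ := hl.exists_root hB
    obtain ⟨e, he⟩ := hroot x q hq hd hx
    exact absurd (hlt e) (not_lt.2 he)

/-- `c'` approximates elements of `E` exactly as `c` does. -/
def SameApprox (E : Type*) [Field E] [Algebra E B] [Algebra E M]
    (v : Valuation B Γ) (w : Valuation M Γ') (c : B) (c' : M) : Prop :=
  ∀ᶠ e in approx E v c, ∀ e' : E, v (c - algebraMap E B e') < v (c - algebraMap E B e) →
    w (c' - algebraMap E M e) = w (algebraMap E M e' - algebraMap E M e)

theorem Stable.exists_value (hiso : IsoOn E v w) (hlim : IsLimitOver E v c)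
    (hap : SameApprox E v w c c') {q : E[X]} (hq : Stable E v c q) :
    ∃ x : E, v (aeval c q) = v (algebraMap E B x) ∧ w (aeval c' q) = w (algebraMap E M x) := by
  obtain ⟨e, ⟨he, hee⟩, hap⟩ := ((hq.and hq.eventually_eq).and hap).exists
  refine ⟨q.eval e, hee.symm, ?_⟩
  obtain ⟨e', he'⟩ := hlim e
  rw [algebraMap_eval]
  refine val_eq_of_taylor_lt fun j hj => ?_
  have := he j hj
  rw [← val_sub_of_lt he', ← map_sub, ← map_pow, ← map_pow, ← map_mul, ← map_mul,
    hiso.lt_iff] at this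
  rw [hap e' he', ← algebraMap_eval, ← algebraMap_eval]
  simpa using this

theorem exists_value_of_limit_transcendental (hB : IsT v t) (hiso : IsoOn E v w)
    (hlim : IsLimitOver E v c) (hap : SameApprox E v w c c')
    (halg : ∀ x : B, IsAlgebraic E x → ∃ e : E, algebraMap E B e = x) (q : E[X]) :
    ∃ x : E, v (aeval c q) = v (algebraMap E B x) ∧ w (aeval c' q) = w (algebraMap E M x) := by
  by_cases hq : q = 0
  · exact ⟨0, by simp [hq], by simp [hq]⟩
  · refine Stable.exists_value hiso hlim hap (stable_of_no_root hB hlim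
      (fun x p hp _ hx => ?_) q hq le_rfl)
    obtain ⟨e, rfl⟩ := halg x ⟨p, hp, hx⟩
    exact ⟨e, le_rfl⟩

theorem exists_sameType_of_limit_algebraic (hB : IsT v t) (hM : IsT w t') (hiso : IsoOn E v w)
    (hlim : IsLimitOver E v c) (hc : IsIntegral E c)
    (hmin : ∀ x : B, IsIntegral E x → (minpoly E x).natDegree < (minpoly E c).natDegree →
      ∃ e : E, algebraMap E B e = x) :
    ∃ c' : M, SameType E v w c c' := by
  have hst : ∀ q : E[X], q ≠ 0 → q.natDegree < (minpoly E c).natDegree → Stable E v c q := by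
    intro q hq hd
    refine stable_of_no_root hB hlim (N := q.natDegree) (fun x p hp hpd hx => ?_) q hq le_rfl
    obtain ⟨e, rfl⟩ := hmin x (IsAlgebraic.isIntegral ⟨p, hp, hx⟩)
      (((natDegree_le_of_dvd (minpoly.dvd E x hx) hp).trans hpd).trans_lt hd)
    exact ⟨e, le_rfl⟩
  set p := minpoly E c with hpdef
  have hp0 : p.natDegree ≠ 0 := (minpoly.natDegree_pos hc).ne'
  have hpev : ∀ᶠ e in approx E v c, ∀ j, 1 ≤ j →
      v (algebraMap E B ((hasseDeriv j p).eval e)) = v (aeval c (hasseDeriv j p)) := by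
    have : ∀ᶠ e in approx E v c, ∀ j ∈ Finset.Icc 1 p.natDegree,
        v (algebraMap E B ((hasseDeriv j p).eval e)) = v (aeval c (hasseDeriv j p)) := by
      rw [eventually_all_finset]
      intro j hj
      rw [Finset.mem_Icc] at hj
      by_cases hz : hasseDeriv j p = 0
      · simp [hz]
      · have := natDegree_hasseDeriv_le p j
        exact (hst _ hz (by omega)).eventually_eq
    filter_upwards [this] with e he j hj
    by_cases hjd : j ≤ p.natDegree
    · exact he j (Finset.mem_Icc.2 ⟨hj, hjd⟩)
    · rw [hasseDeriv_eq_zero_of_lt_natDegree _ _ (by omega)]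
      simp
  have hlin : Linear E v c p := by
    refine (stable_or_linear hB.natCast hlim hp0 hpev).resolve_left fun hs => ?_
    obtain ⟨e, he, he'⟩ := (hs.and hs.eventually_eq).exists
    rw [hpdef, minpoly.aeval, map_zero, ← hpdef] at he'
    have := he 1 le_rfl
    rw [he'] at this
    exact not_lt_zero this
  have hall : ∀ᶠ e in approx E v c,
      (∀ j, 1 ≤ j → v (algebraMap E B ((hasseDeriv j p).eval e)) = v (aeval c (hasseDeriv j p))) ∧
      (∀ j, 2 ≤ j → v (algebraMap E B ((hasseDeriv j p).eval e)) * v (c - algebraMap E B e) ^ j <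
        v (algebraMap E B ((hasseDeriv 1 p).eval e)) * v (c - algebraMap E B e)) ∧
      v (algebraMap E B (p.eval e)) =
        v (algebraMap E B ((hasseDeriv 1 p).eval e)) * v (c - algebraMap E B e) := by
    filter_upwards [hpev, hlin.dom] with e h1 h2
    have h3 : ∀ j, 2 ≤ j →
        v (algebraMap E B ((hasseDeriv j p).eval e)) * v (c - algebraMap E B e) ^ j <
        v (algebraMap E B ((hasseDeriv 1 p).eval e)) * v (c - algebraMap E B e) := by
      intro j hj
      rw [h1 j (by omega), h1 1 le_rfl]
      exact h2 j hj
    refine ⟨h1, h3, ?_⟩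
    have h4 := val_sub_eq_of_taylor_lt (v := v) (q := p) (x := algebraMap E B e) (y := c)
      (by simpa only [algebraMap_eval] using h3)
    rw [hpdef, minpoly.aeval, zero_sub, Valuation.map_neg, ← hpdef] at h4
    rw [algebraMap_eval, h4, algebraMap_eval]
  obtain ⟨e₀, he₀⟩ := eventually_approx.1 hall
  obtain ⟨hev₀, hdom₀, hval₀⟩ := he₀ e₀ le_rfl
  obtain ⟨e₁, he₁⟩ := hlim e₀
  simp only [← val_sub_of_lt he₁] at hdom₀ hval₀
  have hdomM : ∀ e, v (c - algebraMap E B e) ≤ v (c - algebraMap E B e₀) → ∀ j, 2 ≤ j →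
      w (algebraMap E M ((hasseDeriv j p).eval e)) *
        w (algebraMap E M e₁ - algebraMap E M e₀) ^ j <
      w (algebraMap E M ((hasseDeriv 1 p).eval e)) *
        w (algebraMap E M e₁ - algebraMap E M e₀) := by
    intro e he j hj
    have := hdom₀ j hj
    rw [hev₀ j (by omega), hev₀ 1 le_rfl, ← (he₀ e he).1 j (by omega),
      ← (he₀ e he).1 1 le_rfl] at this
    exact (hiso.mul_pow_lt_iff _ _ _ _ _).1 this
  have hderiv : ∀ e, v (c - algebraMap E B e) ≤ v (c - algebraMap E B e₀) →
      w (algebraMap E M ((hasseDeriv 1 p).eval e)) ≠ 0 := by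
    intro e he h0
    have := hdomM e he 2 le_rfl
    rw [h0, zero_mul] at this
    exact not_lt_zero this
  rw [hiso.eq_mul_iff] at hval₀
  obtain ⟨c', hc', hcv⟩ := hM.newton (p.map (algebraMap E M)) (algebraMap E M e₀)
    (algebraMap E M e₁ - algebraMap E M e₀) (by
      rw [eval_hasseDeriv_map, eval_map_algebraMap, ← algebraMap_eval, ← algebraMap_eval]
      exact hval₀.le) (fun j hj => by
      rw [eval_hasseDeriv_map, eval_hasseDeriv_map, ← algebraMap_eval, ← algebraMap_eval]
      exact hdomM e₀ le_rfl j hj)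
  rw [eval_hasseDeriv_map, eval_map_algebraMap, ← algebraMap_eval, ← algebraMap_eval, hval₀,
    mul_comm] at hcv
  rw [eval_map_algebraMap] at hc'
  have hcd := mul_left_cancel₀ (hderiv e₀ le_rfl) hcv
  have hap : SameApprox E v w c c' := by
    refine eventually_approx.2 ⟨e₀, fun e he e' he' => ?_⟩
    obtain ⟨-, hdom, hval⟩ := he₀ e he
    rw [← val_sub_of_lt he', hiso.eq_mul_iff] at hval
    have hδ : 0 < w (c' - algebraMap E M e) := by
      rw [Valuation.pos_iff, sub_ne_zero]
      rintro rfl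
      rw [← algebraMap_eval] at hc'
      rw [hc', map_zero] at hval
      rcases mul_eq_zero.1 hval.symm with h0 | h0
      · exact hderiv e he h0
      · have h1 := hiso.eq_iff (e' - e) 0
        simp only [map_sub, map_zero] at h1
        rw [← h1, val_sub_of_lt he'] at h0
        exact (hlim.pos e).ne' h0
    have hle : w (c' - algebraMap E M e) ≤ w (algebraMap E M e₁ - algebraMap E M e₀) := by
      have h1 : w (algebraMap E M e - algebraMap E M e₀) ≤
          w (algebraMap E M e₁ - algebraMap E M e₀) := by
        have := hiso (e - e₀) (e₁ - e₀)
        simp only [map_sub] at this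
        rw [← this, val_sub_of_lt he₁]
        have h2 : algebraMap E B e - algebraMap E B e₀ =
          (c - algebraMap E B e₀) - (c - algebraMap E B e) := by ring
        rw [h2]
        exact v.map_sub_le le_rfl he
      have h2 : c' - algebraMap E M e =
        (c' - algebraMap E M e₀) - (algebraMap E M e - algebraMap E M e₀) := by ring
      rw [h2]
      exact w.map_sub_le hcd.le h1
    have h4 := val_sub_eq_of_taylor_lt (v := w) (q := p) (x := algebraMap E M e) (y := c')
      (fun j hj => by
        rw [← algebraMap_eval, ← algebraMap_eval]
        exact mul_pow_lt_of_le (by omega) (hdomM e he j hj) hδ hle)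
    rw [hc', zero_sub, Valuation.map_neg, ← algebraMap_eval, hval, ← algebraMap_eval] at h4
    exact (mul_left_cancel₀ (hderiv e he) h4).symm
  refine ⟨c', SameType.of_minpoly_values hiso hc hc' fun q hq => ?_⟩
  by_cases hq0 : q = 0
  · exact ⟨0, by simp [hq0], by simp [hq0]⟩
  · exact (hst q hq0 hq).exists_value hiso hlim hap

end Transfer

section Residual

open Polynomial

variable {E B M : Type*} [Field E] [Field B] [Field M] [Algebra E B] [Algebra E M]
  {Γ Γ' : Type*} [LinearOrderedCommGroupWithZero Γ] [LinearOrderedCommGroupWithZero Γ']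

/-- Monic polynomials over `E` whose coefficients are integral with respect to `v`. -/
structure MonicInt (v : Valuation B Γ) (p : E[X]) : Prop where
  monic : p.Monic
  coeff_le : ∀ i, v (algebraMap E B (p.coeff i)) ≤ 1

/-- Monic integral polynomials of positive degree less than `n` have roots in the residue field
of `E`. -/
def ResClosed (E : Type*) [Field E] [Algebra E B] (v : Valuation B Γ) (n : ℕ) : Prop :=
  ∀ p : E[X], MonicInt v p → 0 < p.natDegree → p.natDegree < n →
    ∃ e : E, v (algebraMap E B e) ≤ 1 ∧ v (algebraMap E B (p.eval e)) < 1

/-- The residue of `y` is not a residue of an element of `E`. -/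
def ResNew (E : Type*) [Field E] [Algebra E B] (v : Valuation B Γ) (y : B) : Prop :=
  v y ≤ 1 ∧ ∀ e : E, v (algebraMap E B e) ≤ 1 → 1 ≤ v (y - algebraMap E B e)

variable {v : Valuation B Γ} {w : Valuation M Γ'} {t : B} {t' : M}

theorem IsoOn.monicInt_iff (h : IsoOn E v w) (p : E[X]) : MonicInt v p ↔ MonicInt w p :=
  ⟨fun hp => ⟨hp.monic, fun i => (h.le_one_iff _).1 (hp.coeff_le i)⟩,
    fun hp => ⟨hp.monic, fun i => (h.le_one_iff _).2 (hp.coeff_le i)⟩⟩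

theorem IsoOn.resClosed (h : IsoOn E v w) {n : ℕ} (hE : ResClosed E v n) : ResClosed E w n := by
  intro p hp h0 hn
  obtain ⟨e, he, he'⟩ := hE p ((h.monicInt_iff p).2 hp) h0 hn
  exact ⟨e, (h.le_one_iff _).1 he, (h.lt_one_iff _).1 he'⟩

theorem MonicInt.val_aeval_le_one {p : E[X]} (hp : MonicInt v p) {y : B} (hy : v y ≤ 1) :
    v (aeval y p) ≤ 1 := by
  rw [← eval_map_algebraMap]
  exact val_eval_le_one (fun i => by rw [coeff_map]; exact hp.coeff_le i) hy

theorem MonicInt.exists_factor {p : E[X]} (hp : MonicInt v p) (h0 : 0 < p.natDegree) {e : E}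
    (he : v (algebraMap E B e) ≤ 1) :
    ∃ q : E[X], MonicInt v q ∧ q.natDegree + 1 = p.natDegree ∧
      p = (X - C e) * q + C (p.eval e) := by
  refine ⟨p /ₘ (X - C e), ⟨?_, fun i => ?_⟩, ?_, ?_⟩
  · rw [Monic, leadingCoeff_divByMonic_X_sub_C _ (natDegree_pos_iff_degree_pos.1 h0).ne',
      hp.monic.leadingCoeff]
  · rw [coeff_divByMonic_X_sub_C, map_sum]
    refine v.map_sum_le fun j _ => ?_
    rw [map_mul, map_mul, map_pow, map_pow]
    exact mul_le_one' (pow_le_one' he _) (hp.coeff_le _)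
  · rw [natDegree_divByMonic _ (monic_X_sub_C e), natDegree_X_sub_C]
    omega
  · have := modByMonic_add_div p (X - C e)
    rw [modByMonic_X_sub_C_eq_C_eval, add_comm] at this
    exact this.symm

theorem MonicInt.eval_lt_one_of_sub {p : E[X]} (hp : MonicInt v p) {y : B} (hy : v y ≤ 1)
    {e : E} (he : v (algebraMap E B e) ≤ 1) (h : v (y - algebraMap E B e) < 1)
    (hpy : v (aeval y p) < 1) : v (algebraMap E B (p.eval e)) < 1 := by
  by_cases h0 : 0 < p.natDegree
  · obtain ⟨q, hq, -, hpq⟩ := hp.exists_factor h0 he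
    have h1 : aeval y p = (y - algebraMap E B e) * aeval y q + algebraMap E B (p.eval e) := by
      conv_lhs => rw [hpq]
      simp
    have h2 : algebraMap E B (p.eval e) = aeval y p - (y - algebraMap E B e) * aeval y q := by
      rw [h1]; ring
    rw [h2]
    refine v.map_sub_lt hpy ?_
    rw [map_mul]
    exact (mul_le_of_le_one_right' (hq.val_aeval_le_one hy)).trans_lt h
  · have : p = 1 := hp.monic.natDegree_eq_zero.1 (by omega)
    simp [this] at hpy

theorem ResNew.val_aeval {n : ℕ} (hE : ResClosed E v n) {y : B} (hy : ResNew E v y) (q : E[X])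
    (hq : MonicInt v q) (hn : q.natDegree < n) : v (aeval y q) = 1 := by
  induction hk : q.natDegree generalizing q with
  | zero => simp [hq.monic.natDegree_eq_zero.1 hk]
  | succ k ih =>
    obtain ⟨e, he, hqe⟩ := hE q hq (by omega) hn
    obtain ⟨r, hr, hrd, hqr⟩ := hq.exists_factor (by omega) he
    have h1 := ih r hr (by omega) (by omega)
    have h2 : v (y - algebraMap E B e) = 1 :=
      le_antisymm (v.map_sub_le hy.1 he) (hy.2 e he)
    have h3 : aeval y q = (y - algebraMap E B e) * aeval y r + algebraMap E B (q.eval e) := by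
      conv_lhs => rw [hqr]
      simp
    have h4 : v ((y - algebraMap E B e) * aeval y r) = 1 := by rw [map_mul, h1, h2, one_mul]
    rw [h3, v.map_add_eq_of_lt_left (by rwa [h4]), h4]

theorem exists_value_of_resNew {n : ℕ} (hiso : IsoOn E v w) (hE : ResClosed E v n) {y : B} {y' : M}
    (hy : ResNew E v y) (hy' : ResNew E w y') (q : E[X]) (hq : q.natDegree < n) :
    ∃ x : E, v (aeval y q) = v (algebraMap E B x) ∧ w (aeval y' q) = w (algebraMap E M x) := by
  by_cases hq0 : q = 0
  · exact ⟨0, by simp [hq0], by simp [hq0]⟩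
  obtain ⟨j, hj, hjm⟩ := gauss_val hy.1
    (fun p hp hpn hpi => hy.val_aeval hE p ⟨hp, hpi⟩ hpn) q hq0 hq
  obtain ⟨i, hi, him⟩ := gauss_val hy'.1
    (fun p hp hpn hpi => hy'.val_aeval (hiso.resClosed hE) p ⟨hp, hpi⟩ hpn) q hq0 hq
  exact ⟨q.coeff j, hj, hi.trans ((le_antisymm (him j) ((hiso _ _).1 (hjm i)))).symm⟩

theorem minpoly_natDegree_ge {n : ℕ} (hE : ResClosed E v n) {y : B} (hy : ResNew E v y)
    (hc : IsIntegral E y) : n ≤ (minpoly E y).natDegree := by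
  by_contra! hlt
  obtain ⟨j, hj, hjm⟩ := gauss_val hy.1
    (fun p hp hpn hpi => hy.val_aeval hE p ⟨hp, hpi⟩ hpn) _ (minpoly.ne_zero hc) hlt
  rw [minpoly.aeval, map_zero] at hj
  have := hjm (minpoly E y).natDegree
  rw [← hj, coeff_natDegree, (minpoly.monic hc).leadingCoeff] at this
  simp at this

theorem IsT.exists_root_of_resNew (hB : IsT v t) {p : E[X]} (hp : MonicInt v p)
    (h0 : 0 < p.natDegree) (hE : ResClosed E v p.natDegree)
    (hno : ∀ e : E, v (algebraMap E B e) ≤ 1 → 1 ≤ v (algebraMap E B (p.eval e))) :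
    ∃ c : B, aeval c p = 0 ∧ ResNew E v c := by
  obtain ⟨y, hy, hpy⟩ := hB.residue (p.map (algebraMap E B)) (hp.monic.map _)
    (by rwa [natDegree_map]) (fun i => by rw [coeff_map]; exact hp.coeff_le i)
  have hm := hB.natCast _ h0.ne'
  have hmB : (p.natDegree : B) ≠ 0 := fun h => by rw [h] at hm; simp at hm
  have hmE : (p.natDegree : E) ≠ 0 := fun h => hmB (by
    rw [← map_natCast (algebraMap E B), h, map_zero])
  have hnew : ResNew E v y := ⟨hy, fun e he => by
    by_contra! h
    exact (hno e he).not_gt (hp.eval_lt_one_of_sub hy he h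
      (by rwa [eval_map_algebraMap] at hpy))⟩
  have hd : v ((p.map (algebraMap E B)).derivative.eval y) = 1 := by
    rw [derivative_map, eval_map_algebraMap]
    have hdd : p.derivative.natDegree < p.natDegree := natDegree_derivative_lt h0.ne'
    have hlead : p.derivative.coeff (p.natDegree - 1) = p.natDegree := by
      rw [coeff_derivative, Nat.sub_add_cancel h0, coeff_natDegree, hp.monic.leadingCoeff,
        one_mul]
      exact_mod_cast congrArg (Nat.cast : ℕ → E) (Nat.sub_add_cancel h0)
    have hq : MonicInt v (C (p.natDegree : E)⁻¹ * p.derivative) := by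
      refine ⟨monic_of_natDegree_le_of_coeff_eq_one (p.natDegree - 1)
        ((natDegree_C_mul_le _ _).trans (by omega)) ?_, fun i => ?_⟩
      · rw [coeff_C_mul, hlead, inv_mul_cancel₀ hmE]
      · rw [coeff_C_mul, coeff_derivative, map_mul, map_mul, map_inv₀, map_inv₀, map_natCast, hm,
          inv_one, one_mul, map_mul, map_mul]
        refine mul_le_one' (hp.coeff_le _) ?_
        exact_mod_cast val_natCast_le_one (v := v) (i + 1)
    have := hnew.val_aeval hE _ hq ((natDegree_C_mul_le _ _).trans_lt hdd)
    rwa [map_mul, aeval_C, map_mul, map_inv₀, map_inv₀, map_natCast, hm, inv_one, one_mul] at this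
  obtain ⟨c, hc, hcy⟩ := hB.hensel_root _
    (fun i => by rw [coeff_map]; exact hp.coeff_le i) y hy hpy hd
  refine ⟨c, by rwa [eval_map_algebraMap] at hc, ?_, fun e he => ?_⟩
  · rw [← sub_add_cancel c y]
    exact (v.map_add _ _).trans (max_le hcy.le hy)
  · by_contra! h
    refine (hnew.2 e he).not_gt ?_
    rw [← sub_add_sub_cancel y c]
    refine v.map_add_lt ?_ h
    rwa [v.map_sub_swap]

theorem exists_sameType_of_not_resClosed (hB : IsT v t) (hM : IsT w t') (hiso : IsoOn E v w)
    {n : ℕ} (hE : ¬ ResClosed E v n) : ∃ (c : B) (c' : M), IsIntegral E c ∧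
      (∀ e, algebraMap E B e ≠ c) ∧ SameType E v w c c' := by
  classical
  have hex : ∃ m, ∃ p : E[X], p.natDegree = m ∧ MonicInt v p ∧ 0 < p.natDegree ∧
      ∀ e : E, v (algebraMap E B e) ≤ 1 → 1 ≤ v (algebraMap E B (p.eval e)) := by
    simp only [ResClosed, not_forall, not_exists, not_and, not_lt] at hE
    obtain ⟨p, hp, h0, -, h⟩ := hE
    exact ⟨_, p, rfl, hp, h0, h⟩
  obtain ⟨p, hpm, hp, h0, hno⟩ := Nat.find_spec hex
  have hmin : ResClosed E v p.natDegree := by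
    intro q hq hq0 hqp
    by_contra! h
    exact Nat.find_min hex (hpm ▸ hqp) ⟨q, rfl, hq, hq0, h⟩
  obtain ⟨c, hc, hcn⟩ := hB.exists_root_of_resNew hp h0 hmin hno
  obtain ⟨c', hc', hcn'⟩ := hM.exists_root_of_resNew ((hiso.monicInt_iff p).1 hp) h0
    (hiso.resClosed hmin) (fun e he => not_lt.1 fun h =>
      (hno e ((hiso.le_one_iff _).2 he)).not_gt ((hiso.lt_one_iff _).2 h))
  have hci : IsIntegral E c := ⟨p, hp.monic, hc⟩
  have hpmin : minpoly E c = p := by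
    refine (eq_of_monic_of_dvd_of_natDegree_le (minpoly.monic hci) hp.monic (minpoly.dvd E c hc)
      (minpoly_natDegree_ge hmin hcn hci)).symm
  refine ⟨c, c', hci, fun e he => ?_, SameType.of_minpoly_values hiso hci (by rwa [hpmin]) ?_⟩
  · have := hcn.2 e (he ▸ hcn.1)
    simp [he] at this
  · rw [hpmin]
    exact exists_value_of_resNew hiso hmin hcn hcn'

end Residual

section Ramified

open Polynomial

variable {E B M : Type*} [Field E] [Field B] [Field M] [Algebra E B] [Algebra E M]
  {Γ Γ' : Type*} [LinearOrderedCommGroupWithZero Γ] [LinearOrderedCommGroupWithZero Γ']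

/-- The powers `c ^ k` with `0 < k < n` have values outside the value group of `E`. -/
def ValNew (E : Type*) [Field E] [Algebra E B] (v : Valuation B Γ) (n : ℕ) (c : B) : Prop :=
  c ≠ 0 ∧ ∀ k, 0 < k → k < n → ∀ e : E, v c ^ k ≠ v (algebraMap E B e)

/-- `c` and `c'` have the same position with respect to the value group of `E`. -/
def SameMonomials (E : Type*) [Field E] [Algebra E B] [Algebra E M]
    (v : Valuation B Γ) (w : Valuation M Γ') (n : ℕ) (c : B) (c' : M) : Prop :=
  ∀ (a b : E) (j k : ℕ), j < n → k < n →
    (v (algebraMap E B a * c ^ j) ≤ v (algebraMap E B b * c ^ k) ↔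
      w (algebraMap E M a * c' ^ j) ≤ w (algebraMap E M b * c' ^ k))

variable {v : Valuation B Γ} {w : Valuation M Γ'} {t : B} {t' : M} {c : B} {c' : M} {n : ℕ}

theorem ValNew.of_sameMonomials (h : ValNew E v n c) (hs : SameMonomials E v w n c c')
    (hc' : c' ≠ 0) : ValNew E w n c' := by
  refine ⟨hc', fun k hk hkn e he => h.2 k hk hkn e ?_⟩
  have h1 := hs 1 e k 0 hkn (hk.trans hkn)
  have h2 := hs e 1 0 k (hk.trans hkn) hkn
  simp only [map_one, one_mul, pow_zero, mul_one, map_pow] at h1 h2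
  exact le_antisymm (h1.2 he.le) (h2.2 he.ge)

theorem ValNew.ne (h : ValNew E v n c) {a b : E} (ha : a ≠ 0) {j k : ℕ} (hjk : j < k)
    (hk : k < n) : v (algebraMap E B a * c ^ j) ≠ v (algebraMap E B b * c ^ k) := by
  intro heq
  have hcj : v c ^ j ≠ 0 := pow_ne_zero _ (v.ne_zero_iff.2 h.1)
  have ha' : v (algebraMap E B a) ≠ 0 := by simpa
  obtain ⟨i, rfl⟩ := Nat.exists_eq_add_of_lt hjk
  rw [add_assoc, pow_add, mul_comm (c ^ j), ← mul_assoc, map_mul, map_mul, map_pow] at heq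
  have h1 := mul_right_cancel₀ hcj heq
  have hb : v (algebraMap E B b) ≠ 0 := by
    intro hb
    rw [map_mul, hb, zero_mul] at h1
    exact ha' h1
  refine h.2 (i + 1) (by omega) (by omega) (a / b) ?_
  rw [map_div₀, map_div₀, h1, map_mul, mul_div_cancel_left₀ _ hb, map_pow]

theorem ValNew.val_aeval (h : ValNew E v n c) {q : E[X]} (hq0 : q ≠ 0) (hq : q.natDegree < n) :
    ∃ j ≤ q.natDegree, q.coeff j ≠ 0 ∧ v (aeval c q) = v (algebraMap E B (q.coeff j) * c ^ j) ∧
      ∀ i ≤ q.natDegree, v (algebraMap E B (q.coeff i) * c ^ i) ≤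
        v (algebraMap E B (q.coeff j) * c ^ j) := by
  obtain ⟨j, hj, hjm⟩ := Finset.exists_max_image (Finset.range (q.natDegree + 1))
    (fun i => v (algebraMap E B (q.coeff i) * c ^ i)) ⟨0, by simp⟩
  simp only [Finset.mem_range, Nat.lt_succ_iff] at hj hjm
  have hne : q.coeff j ≠ 0 := by
    intro hz
    have := hjm _ le_rfl
    rw [hz, map_zero, zero_mul, map_zero, le_zero_iff, v.zero_iff] at this
    simp [hq0, h.1] at this
  refine ⟨j, hj, hne, ?_, hjm⟩
  rw [aeval_eq_sum_range]
  simp only [Algebra.smul_def]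
  refine v.map_sum_eq_of_lt (by simpa [Nat.lt_succ_iff] using hj) fun i hi => ?_
  simp only [Finset.mem_sdiff, Finset.mem_range, Nat.lt_succ_iff, Finset.mem_singleton] at hi
  refine lt_of_le_of_ne (hjm i hi.1) fun heq => ?_
  rcases lt_or_gt_of_ne hi.2 with hij | hij
  · by_cases hci : q.coeff i = 0
    · rw [hci, map_zero, zero_mul, map_zero] at heq
      exact v.ne_zero_iff.2 (mul_ne_zero (by simpa) (pow_ne_zero _ h.1)) heq.symm
    · exact h.ne hci hij (by omega) heq
  · exact h.ne hne hij (by omega) heq.symm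

theorem ValNew.exists_monomial (h : ValNew E v n c) (hs : SameMonomials E v w n c c')
    (hc' : c' ≠ 0) {q : E[X]} (hq0 : q ≠ 0) (hq : q.natDegree < n) : ∃ j < n, ∃ a : E, a ≠ 0 ∧
      v (aeval c q) = v (algebraMap E B a * c ^ j) ∧
      w (aeval c' q) = w (algebraMap E M a * c' ^ j) := by
  obtain ⟨j, hj, hj0, hj1, hj2⟩ := h.val_aeval hq0 hq
  obtain ⟨i, hi, -, hi1, hi2⟩ := (h.of_sameMonomials hs hc').val_aeval hq0 hq
  exact ⟨j, by omega, _, hj0, hj1, hi1.trans (le_antisymm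
    ((hs _ _ _ _ (by omega) (by omega)).1 (hj2 i hi)) (hi2 j hj))⟩

theorem ValNew.sameType_lt (h : ValNew E v n c) (hs : SameMonomials E v w n c c')
    (hc' : c' ≠ 0) (q r : E[X]) (hq : q.natDegree < n) (hr : r.natDegree < n) :
    v (aeval c q) ≤ v (aeval c r) ↔ w (aeval c' q) ≤ w (aeval c' r) := by
  have key : ∀ q : E[X], q.natDegree < n → ∃ j < n, ∃ a : E,
      v (aeval c q) = v (algebraMap E B a * c ^ j) ∧
      w (aeval c' q) = w (algebraMap E M a * c' ^ j) := by
    intro q hq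
    by_cases hq0 : q = 0
    · exact ⟨0, by omega, 0, by simp [hq0], by simp [hq0]⟩
    obtain ⟨j, hj, a, -, ha⟩ := h.exists_monomial hs hc' hq0 hq
    exact ⟨j, hj, a, ha⟩
  obtain ⟨j, hj, a, h1, h2⟩ := key q hq
  obtain ⟨k, hk, b, h3, h4⟩ := key r hr
  rw [h1, h2, h3, h4]
  exact hs a b j k hj hk

theorem exists_pow_val_of_isIntegral (hc : IsIntegral E c) (h0 : c ≠ 0) :
    ∃ k, 0 < k ∧ ∃ e : E, v c ^ k = v (algebraMap E B e) := by
  by_contra! h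
  have hn : ValNew E v ((minpoly E c).natDegree + 1) c := ⟨h0, fun k hk _ e => h k hk e⟩
  obtain ⟨j, -, hj0, hj, -⟩ := hn.val_aeval (minpoly.ne_zero hc) (Nat.lt_succ_self _)
  rw [minpoly.aeval, map_zero, eq_comm, v.zero_iff] at hj
  simp [hj0, h0] at hj

/-- Elements of `E` whose value is an `n`-th power in `B` have this property in `M`. -/
def PowCond (E : Type*) [Field E] [Algebra E B] [Algebra E M]
    (v : Valuation B Γ) (w : Valuation M Γ') : Prop :=
  ∀ (e : E) (n : ℕ), 0 < n → (∃ y : B, v (algebraMap E B e) = v y ^ n) →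
    ∃ y' : M, w (algebraMap E M e) = w y' ^ n

/-- The value group of `E` is pure in that of `B`. -/
def ValClosed (E : Type*) [Field E] [Algebra E B] (v : Valuation B Γ) : Prop :=
  ∀ (y : B) (n : ℕ) (e : E), 0 < n → v y ^ n = v (algebraMap E B e) →
    ∃ e' : E, v y = v (algebraMap E B e')

theorem exists_sameType_of_not_valClosed (hB : IsT v t) (hM : IsT w t') (hiso : IsoOn E v w)
    (hG : PowCond E v w) (hE : ¬ ValClosed E v) : ∃ (c : B) (c' : M), IsIntegral E c ∧
      (∀ e, algebraMap E B e ≠ c) ∧ SameType E v w c c' := by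
  classical
  simp only [ValClosed, not_forall, not_exists] at hE
  obtain ⟨y, n₀, e₀, hn₀, hy₀, hy⟩ := hE
  have hex : ∃ n, 0 < n ∧ ∃ e : E, v y ^ n = v (algebraMap E B e) := ⟨n₀, hn₀, e₀, hy₀⟩
  set n := Nat.find hex with hndef
  obtain ⟨hn, e, he⟩ : 0 < n ∧ ∃ e : E, v y ^ n = v (algebraMap E B e) := Nat.find_spec hex
  have hyz : y ≠ 0 := by
    rintro rfl
    exact hy 0 (by simp)
  have hez : algebraMap E B e ≠ 0 := by
    intro h
    rw [h, map_zero] at he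
    exact v.ne_zero_iff.2 hyz (eq_zero_of_pow_eq_zero he)
  have hez' : algebraMap E M e ≠ 0 := by
    have : e ≠ 0 := by rintro rfl; simp at hez
    simpa
  have hn1 : 1 < n := by
    rcases Nat.lt_or_ge 1 n with h | h
    · exact h
    · have h1 : n = 1 := le_antisymm h hn
      rw [h1, pow_one] at he
      exact absurd he (hy e)
  obtain ⟨c, hc⟩ := hB.exists_eq_mul_pow hn hez (z := 1) (y := y)
    (by rw [one_mul, map_pow, ← he])
  obtain ⟨y', hy'⟩ := hG e n hn ⟨y, he.symm⟩
  obtain ⟨c', hc'⟩ := hM.exists_eq_mul_pow hn hez' (z := 1) (y := y')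
    (by rw [one_mul, map_pow, hy'])
  rw [one_mul] at hc hc'
  have hvc : v c = v y := by
    refine (pow_left_inj₀ zero_le zero_le hn.ne').1 ?_
    rw [← map_pow, ← hc]
    exact he.symm
  have hc0 : c ≠ 0 := by rintro rfl; rw [zero_pow hn.ne'] at hc; exact hez hc
  have hc0' : c' ≠ 0 := by rintro rfl; rw [zero_pow hn.ne'] at hc'; exact hez' hc'
  have hnew : ValNew E v n c := ⟨hc0, fun k hk hkn e' h =>
    Nat.find_min hex hkn ⟨hk, e', by rw [← hvc, h]⟩⟩
  have hmon : (X ^ n - C e : E[X]).Monic := monic_X_pow_sub_C _ hn.ne'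
  have hroot : aeval c (X ^ n - C e) = 0 := by simp [hc]
  have hci : IsIntegral E c := ⟨_, hmon, hroot⟩
  have hmin : minpoly E c = X ^ n - C e := by
    refine (eq_of_monic_of_dvd_of_natDegree_le (minpoly.monic hci) hmon
      (minpoly.dvd E c hroot) ?_).symm
    rw [natDegree_X_pow_sub_C]
    by_contra! hlt
    obtain ⟨j, -, hj0, hj, -⟩ := hnew.val_aeval (minpoly.ne_zero hci) hlt
    rw [minpoly.aeval, map_zero, eq_comm, v.zero_iff] at hj
    simp [hj0, hc0] at hj
  have hsm : SameMonomials E v w n c c' := by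
    intro a b j k _ _
    have h1 : ∀ (a : E) (j : ℕ), v (algebraMap E B a * c ^ j) ^ n =
        v (algebraMap E B (a ^ n * e ^ j)) := fun a j => by
      rw [← map_pow, mul_pow, ← pow_mul, mul_comm j, pow_mul, ← hc]; simp
    have h2 : ∀ (a : E) (j : ℕ), w (algebraMap E M a * c' ^ j) ^ n =
        w (algebraMap E M (a ^ n * e ^ j)) := fun a j => by
      rw [← map_pow, mul_pow, ← pow_mul, mul_comm j, pow_mul, ← hc']; simp
    rw [← pow_le_pow_iff_left₀ zero_le zero_le hn.ne', h1, h1, hiso, ← h2, ← h2,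
      pow_le_pow_iff_left₀ zero_le zero_le hn.ne']
  refine ⟨c, c', hci, fun e' h => hy e' (by rw [← hvc, h]), SameType.of_minpoly hci ?_ ?_⟩
  · rw [hmin]; simp [hc']
  · rw [hmin, natDegree_X_pow_sub_C]
    exact hnew.sameType_lt hsm hc0'

theorem isLimitOver_of_closed (hres : ∀ n, ResClosed E v n) (hval : ValClosed E v)
    (hc : IsIntegral E c) (hcE : ∀ e, algebraMap E B e ≠ c) : IsLimitOver E v c := by
  intro e
  have hce : c - algebraMap E B e ≠ 0 := sub_ne_zero.2 (hcE e).symm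
  obtain ⟨k, hk, x, hx⟩ := exists_pow_val_of_isIntegral (v := v) (hc.sub isIntegral_algebraMap) hce
  obtain ⟨d, hd⟩ := hval _ k x hk hx
  have hd0 : algebraMap E B d ≠ 0 := by rw [← v.ne_zero_iff, ← hd]; exact v.ne_zero_iff.2 hce
  have hui : IsIntegral E ((c - algebraMap E B e) * algebraMap E B d⁻¹) :=
    (hc.sub isIntegral_algebraMap).mul isIntegral_algebraMap
  have hu : ¬ ResNew E v ((c - algebraMap E B e) * algebraMap E B d⁻¹) := fun h =>
    (minpoly_natDegree_ge (hres _) h hui).not_gt (Nat.lt_succ_self _)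
  have hu1 : v ((c - algebraMap E B e) * algebraMap E B d⁻¹) ≤ 1 := by
    rw [map_mul, hd, map_inv₀, map_inv₀, mul_inv_cancel₀ (v.ne_zero_iff.2 hd0)]
  simp only [ResNew, hu1, true_and, not_forall, not_le] at hu
  obtain ⟨e₁, -, he₁⟩ := hu
  refine ⟨e + d * e₁, ?_⟩
  have : c - algebraMap E B (e + d * e₁) = algebraMap E B d *
      ((c - algebraMap E B e) * algebraMap E B d⁻¹ - algebraMap E B e₁) := by
    rw [map_inv₀, map_add, map_mul]
    field_simp
    ring
  rw [this, map_mul, hd]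
  exact mul_lt_of_lt_one_right (v.pos_iff.2 hd0) he₁

theorem exists_sameType_of_isIntegral (hB : IsT v t) (hM : IsT w t') (hiso : IsoOn E v w)
    (hG : PowCond E v w) (hex : ∃ x : B, IsIntegral E x ∧ ∀ e, algebraMap E B e ≠ x) :
    ∃ (c : B) (c' : M), IsIntegral E c ∧ (∀ e, algebraMap E B e ≠ c) ∧ SameType E v w c c' := by
  classical
  by_cases hres : ∀ n, ResClosed E v n
  swap
  · push Not at hres
    obtain ⟨n, hn⟩ := hres
    exact exists_sameType_of_not_resClosed hB hM hiso hn
  by_cases hval : ValClosed E v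
  swap
  · exact exists_sameType_of_not_valClosed hB hM hiso hG hval
  have hex' : ∃ n, ∃ x : B, (minpoly E x).natDegree = n ∧ IsIntegral E x ∧
      ∀ e, algebraMap E B e ≠ x := by
    obtain ⟨x, hx⟩ := hex
    exact ⟨_, x, rfl, hx⟩
  obtain ⟨c, hcn, hc, hcE⟩ := Nat.find_spec hex'
  obtain ⟨c', h⟩ := exists_sameType_of_limit_algebraic hB hM hiso
    (isLimitOver_of_closed hres hval hc hcE) hc (fun x hx hlt => by
      by_contra! h
      exact Nat.find_min hex' (hcn ▸ hlt) ⟨x, rfl, hx, h⟩)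
  exact ⟨c, c', hc, hcE, h⟩

end Ramified

section Extend

open Polynomial IntermediateField

variable {F B M : Type*} [Field F] [Field B] [Field M] [Algebra F B] [Algebra F M]
  {Γ Γ' : Type*} [LinearOrderedCommGroupWithZero Γ] [LinearOrderedCommGroupWithZero Γ']
  {v : Valuation B Γ} {w : Valuation M Γ'} {t : B} {t' : M}

/-- Lifts with algebraic domain that respect the valuations. -/
def goodLifts (v : Valuation B Γ) (w : Valuation M Γ') : Set (Lifts F B M) :=
  {l | (∀ x ∈ l.carrier, IsIntegral F x) ∧ ∀ x y : l.carrier, v x ≤ v y ↔ w (l.emb x) ≤ w (l.emb y)}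

theorem exists_maximal_goodLift (hiso : IsoOn F v w) :
    ∃ l : Lifts F B M, Maximal (· ∈ goodLifts v w) l := by
  have h := zorn_le_nonempty₀ (goodLifts (F := F) v w) (fun c hcs hc l₀ hl₀ => ?_) ⊥ ?_
  · exact h.imp fun _ h => h.2
  · refine ⟨Lifts.union c hc, ?_, Lifts.le_union c hc⟩
    have : Nonempty c := ⟨⟨l₀, hl₀⟩⟩
    have hdir : Directed (· ≤ ·) fun i : c => i.1.carrier :=
      hc.directedOn.directed_val.mono_comp _ fun _ _ h => h.1
    have hmem : ∀ x ∈ (Lifts.union c hc).carrier, ∃ i : c, x ∈ i.1.carrier := by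
      intro x hx
      rw [Lifts.carrier_union, ← SetLike.mem_coe, coe_iSup_of_directed hdir, Set.mem_iUnion] at hx
      exact hx
    refine ⟨fun x hx => ?_, fun x y => ?_⟩
    · obtain ⟨i, hi⟩ := hmem x hx
      exact (hcs i.2).1 x hi
    · obtain ⟨i, hi⟩ := hmem x x.2
      obtain ⟨j, hj⟩ := hmem y y.2
      obtain ⟨k, hik, hjk⟩ := hdir i j
      have h1 := (hcs k.2).2 ⟨x, hik hi⟩ ⟨y, hjk hj⟩
      rw [← (Lifts.le_union c hc k.2).2, ← (Lifts.le_union c hc k.2).2] at h1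
      exact h1
  · refine ⟨fun x hx => ?_, fun x y => ?_⟩
    · obtain ⟨a, rfl⟩ := IntermediateField.mem_bot.1 hx
      exact isIntegral_algebraMap
    · obtain ⟨x, hx⟩ := x
      obtain ⟨y, hy⟩ := y
      obtain ⟨a, rfl⟩ := IntermediateField.mem_bot.1 hx
      obtain ⟨b, rfl⟩ := IntermediateField.mem_bot.1 hy
      have h1 := (⊥ : Lifts F B M).emb.commutes a
      have h2 := (⊥ : Lifts F B M).emb.commutes b
      refine (hiso a b).trans ?_
      rw [← h1, ← h2]
      exact Iff.rfl

theorem exists_algHom_algebraicClosure (hB : IsT v t) (hM : IsT w t') (hiso : IsoOn F v w)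
    (hG : PowCond F v w) : ∃ σ : algebraicClosure F B →ₐ[F] M,
      ∀ x y : algebraicClosure F B, v x ≤ v y ↔ w (σ x) ≤ w (σ y) := by
  obtain ⟨l, ⟨hla, hlv⟩, hmax⟩ := exists_maximal_goodLift hiso
  let _ : Algebra l.carrier M := l.emb.toRingHom.toAlgebra
  have : IsScalarTower F l.carrier M := IsScalarTower.of_algebraMap_eq fun x =>
    (l.emb.commutes x).symm
  have hmapM : ∀ x : l.carrier, algebraMap l.carrier M x = l.emb x := fun _ => rfl
  have hisoE : IsoOn l.carrier v w := hlv
  have hGE : PowCond l.carrier v w := by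
    rintro e n hn ⟨y, hy⟩
    by_cases he0 : e = 0
    · exact ⟨0, by simp [he0, zero_pow hn.ne']⟩
    obtain ⟨k, hk, f, hf⟩ := exists_pow_val_of_isIntegral (v := v) (hla e e.2) (by simpa using he0)
    obtain ⟨y', hy'⟩ := hG f (n * k) (Nat.mul_pos hn hk) ⟨y, by
      rw [← hf, pow_mul, ← hy]; rfl⟩
    refine ⟨y', (pow_left_inj₀ zero_le zero_le hk.ne').1 ?_⟩
    rw [← pow_mul, ← hy', IsScalarTower.algebraMap_apply F l.carrier M, ← map_pow, ← map_pow,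
      ← hisoE.eq_iff, map_pow, map_pow, ← IsScalarTower.algebraMap_apply F l.carrier B]
    exact hf
  have hcl : algebraicClosure F B ≤ l.carrier := by
    by_contra hnot
    obtain ⟨x, hx, hxl⟩ := Set.not_subset.1 hnot
    obtain ⟨c, c', hc, hcE, hs⟩ := exists_sameType_of_isIntegral hB hM hisoE hGE
      ⟨x, (mem_algebraicClosure_iff'.1 hx).tower_top, fun e he => hxl (he ▸ e.2)⟩
    obtain ⟨σ, -, hσ⟩ := hs.exists_algHom
    have hle : l.carrier ≤ (l.carrier⟮c⟯).restrictScalars F := fun z hz =>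
      (l.carrier⟮c⟯).algebraMap_mem ⟨z, hz⟩
    let l' : Lifts F B M := ⟨(l.carrier⟮c⟯).restrictScalars F, σ.restrictScalars F⟩
    have hl' : l' ∈ goodLifts v w := by
      refine ⟨fun z hz => ?_, hσ⟩
      have : Algebra.IsAlgebraic l.carrier l.carrier⟮c⟯ := isAlgebraic_adjoin_simple hc
      have : Algebra.IsIntegral F l.carrier := ⟨fun a =>
        (isIntegral_algHom_iff l.carrier.val Subtype.val_injective).1 (hla a a.2)⟩
      have : IsIntegral l.carrier (⟨z, hz⟩ : l.carrier⟮c⟯) :=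
        (Algebra.IsAlgebraic.isAlgebraic _).isIntegral
      exact isIntegral_trans z (this.map (l.carrier⟮c⟯).val)
    have hll' : l ≤ l' := ⟨hle, fun z => σ.commutes z⟩
    exact hcE ⟨c, (hmax hl' hll').1 (mem_adjoin_simple_self l.carrier c)⟩ rfl
  exact ⟨l.emb.comp (inclusion hcl), fun x y => hlv (inclusion hcl x) (inclusion hcl y)⟩

end Extend

section Models

open Polynomial IntermediateField

variable {A B M : Type*} [Field A] [Field B] [Field M] [Algebra A B] [Algebra A M]
  {Γ Γ' : Type*} [LinearOrderedCommGroupWithZero Γ] [LinearOrderedCommGroupWithZero Γ']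
  {v : Valuation B Γ} {w : Valuation M Γ'} {t : A}

/-- Intermediate notion comparing the values of `x` and `x'` modulo `n`. -/
def SamePow (v : Valuation B Γ) (w : Valuation M Γ') (t : A) (n : ℕ) (x : B) (x' : M) : Prop :=
  ∃ i : ℤ, (∃ z : B, z ≠ 0 ∧ v x = v (algebraMap A B t ^ i * z ^ n)) ∧
    ∃ z : M, z ≠ 0 ∧ w x' = w (algebraMap A M t ^ i * z ^ n)

theorem SamePow.div {n : ℕ} {x y : B} {x' y' : M} (hB : IsT v (algebraMap A B t))
    (hM : IsT w (algebraMap A M t)) (h : SamePow v w t n x x')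
    (h' : SamePow v w t n y y') : SamePow v w t n (x / y) (x' / y') := by
  obtain ⟨i, ⟨z, hz, hx⟩, ⟨z', hz', hx'⟩⟩ := h
  obtain ⟨j, ⟨u, hu, hy⟩, ⟨u', hu', hy'⟩⟩ := h'
  refine ⟨i - j, ⟨z / u, div_ne_zero hz hu, ?_⟩, ⟨z' / u', div_ne_zero hz' hu', ?_⟩⟩
  · rw [map_div₀, hx, hy, ← map_div₀, zpow_sub₀ hB.ne_zero, div_pow, div_mul_div_comm]
  · rw [map_div₀, hx', hy', ← map_div₀, zpow_sub₀ hM.ne_zero, div_pow, div_mul_div_comm]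

theorem SamePow.mul_npow {n : ℕ} {x y : B} {x' y' : M} (hB : IsT v (algebraMap A B t))
    (hM : IsT w (algebraMap A M t)) (h : SamePow v w t n x x')
    (h' : SamePow v w t n y y') (k : ℕ) : SamePow v w t n (x * y ^ k) (x' * y' ^ k) := by
  obtain ⟨i, ⟨z, hz, hx⟩, ⟨z', hz', hx'⟩⟩ := h
  obtain ⟨j, ⟨u, hu, hy⟩, ⟨u', hu', hy'⟩⟩ := h'
  refine ⟨i + j * k, ⟨z * u ^ k, mul_ne_zero hz (pow_ne_zero _ hu), ?_⟩,
    ⟨z' * u' ^ k, mul_ne_zero hz' (pow_ne_zero _ hu'), ?_⟩⟩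
  · rw [map_mul, hx, map_pow, hy, ← map_pow, ← map_mul, zpow_add₀ hB.ne_zero, zpow_mul,
      zpow_natCast]
    congr 1
    ring
  · rw [map_mul, hx', map_pow, hy', ← map_pow, ← map_mul, zpow_add₀ hM.ne_zero, zpow_mul,
      zpow_natCast]
    congr 1
    ring

theorem SamePow.exists_pow {n : ℕ} (hn : 0 < n) {x : B} {x' : M} (hB : IsT v (algebraMap A B t))
    (h : SamePow v w t n x x') {y : B} (hy : v x = v y ^ n) : ∃ y' : M, w x' = w y' ^ n := by
  obtain ⟨i, ⟨z, hz, hx⟩, ⟨z', -, hx'⟩⟩ := h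
  obtain ⟨k, rfl⟩ := hB.zpow_dvd (n := n) (k := i) (y := y / z) (by
    rw [map_pow, map_div₀, div_pow, ← hy, hx, map_mul, map_pow,
      mul_div_cancel_right₀ _ (pow_ne_zero _ (v.ne_zero_iff.2 hz))]) hn.ne'
  refine ⟨algebraMap A M t ^ k * z', ?_⟩
  rw [hx', ← map_pow, mul_pow, mul_comm (n : ℤ), zpow_mul, zpow_natCast]

theorem IsT.exists_ne_zero {K : Type*} [Field K] {Γ : Type*} [LinearOrderedCommGroupWithZero Γ]
    {v : Valuation K Γ} {t : K} (h : IsT v t) {n : ℕ} (hn : 0 < n) {x : K} (hx : x ≠ 0) :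
    ∃ i < n, ∃ y ≠ 0, v x = v (t ^ i * y ^ n) := by
  obtain ⟨i, hi, y, hy⟩ := h.div n hn x hx
  refine ⟨i, hi, y, ?_, hy⟩
  rintro rfl
  rw [zero_pow hn.ne', mul_zero, map_zero, v.zero_iff] at hy
  exact hx hy

theorem samePow_algebraMap (hA : IsT (v.comap (algebraMap A B)) t) (hiso : IsoOn A v w)
    {n : ℕ} (hn : 0 < n) {x : A} (hx : x ≠ 0) :
    SamePow v w t n (algebraMap A B x) (algebraMap A M x) := by
  obtain ⟨i, -, y, hy, hxy⟩ := hA.exists_ne_zero hn hx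
  refine ⟨i, ⟨algebraMap A B y, by simpa, ?_⟩, ⟨algebraMap A M y, by simpa, ?_⟩⟩
  · simpa using hxy
  · have := (hiso.eq_iff _ _).1 hxy
    simpa using this

theorem IsT.valClosed (hA : IsT (v.comap (algebraMap A B)) t) (hB : IsT v (algebraMap A B t)) :
    ValClosed A v := by
  intro y n e hn hy
  by_cases he : e = 0
  · rw [he, map_zero, map_zero] at hy
    exact ⟨0, by rw [eq_zero_of_pow_eq_zero hy]; simp⟩
  obtain ⟨y', hy'⟩ := (samePow_algebraMap hA (w := v.comap (algebraMap A B)) (M := A)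
    (fun _ _ => Iff.rfl) hn he).exists_pow hn hB hy.symm
  refine ⟨y', (pow_left_inj₀ zero_le zero_le hn.ne').1 ?_⟩
  exact hy.trans hy'

theorem IsT.resClosed (hA : IsT (v.comap (algebraMap A B)) t) (n : ℕ) : ResClosed A v n :=
  fun p hp h0 _ => hA.residue p hp.monic h0 hp.coeff_le

theorem IsT.mem_of_isIntegral (hA : IsT (v.comap (algebraMap A B)) t)
    (hB : IsT v (algebraMap A B t)) {x : B} (hx : IsIntegral A x) : ∃ a, algebraMap A B a = x := by
  obtain ⟨σ, -⟩ := exists_algHom_algebraicClosure (F := A) hB hA (fun _ _ => Iff.rfl)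
    (fun e n hn ⟨y, hy⟩ => by
      by_cases he : e = 0
      · exact ⟨0, by simp [he, zero_pow hn.ne']⟩
      · exact (samePow_algebraMap hA (w := v.comap (algebraMap A B)) (M := A)
          (fun _ _ => Iff.rfl) hn he).exists_pow hn hB hy)
  refine ⟨σ ⟨x, mem_algebraicClosure_iff'.2 hx⟩, ?_⟩
  have h : algebraMap A (algebraicClosure A B) (σ ⟨x, mem_algebraicClosure_iff'.2 hx⟩) =
      ⟨x, mem_algebraicClosure_iff'.2 hx⟩ := σ.injective (σ.commutes _)
  exact congrArg Subtype.val h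

theorem IsT.of_algebraicallyClosed {C : Type*} [Field C] [Algebra C B] {t : C}
    (hB : IsT v (algebraMap C B t))
    (hC : ∀ x : B, IsIntegral C x → ∃ c, algebraMap C B c = x) :
    IsT (v.comap (algebraMap C B)) t where
  ne_zero := by
    have := hB.ne_zero
    contrapose! this
    rw [this, map_zero]
  lt_one := hB.lt_one
  le_of_lt_one x hx := hB.le_of_lt_one _ hx
  natCast n hn := by rw [Valuation.comap_apply, map_natCast]; exact hB.natCast n hn
  hensel g hg a ha := by
    obtain ⟨y, hy, hy'⟩ := hB.hensel (g.map (algebraMap C B))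
      (fun i => by rw [coeff_map]; exact hg i) (algebraMap C B a) ha
    rw [eval_map_algebraMap] at hy'
    obtain ⟨c, rfl⟩ := hC y (by
      refine isAlgebraic_iff_isIntegral.1 ⟨Polynomial.C a + X + X ^ 2 * g, fun h => ?_,
        by simpa using hy'⟩
      have := congrArg (fun p => coeff p 1) h
      simp [coeff_X_pow_mul'] at this)
    refine ⟨c, hy, (algebraMap C B).injective ?_⟩
    rw [map_zero, ← hy', ← algebraMap_eval]
    simp
  residue p hp h0 hpi := by
    by_contra! h
    obtain ⟨c, -, hc, hcC, -⟩ := exists_sameType_of_not_resClosed (E := C) hB hB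
      (fun _ _ => Iff.rfl) (n := p.natDegree + 1) fun hcl => by
        obtain ⟨e, he, he'⟩ := hcl p ⟨hp, hpi⟩ h0 (Nat.lt_succ_self _)
        exact (h e he).not_gt he'
    obtain ⟨e, he⟩ := hC c hc
    exact hcC e he
  div n hn x hx := by
    have hx' : algebraMap C B x ≠ 0 := by simpa
    obtain ⟨i, hi, y, hy⟩ := hB.div n hn _ hx'
    obtain ⟨y', hy'⟩ := hB.exists_eq_mul_pow hn hx' hy
    obtain ⟨c, rfl⟩ := hC y' (by
      refine IsIntegral.of_pow hn ?_
      have : y' ^ n = algebraMap C B (x / t ^ i) := by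
        rw [map_div₀, hy', map_pow, mul_div_cancel_left₀ _ (pow_ne_zero _ hB.ne_zero)]
      rw [this]
      exact isIntegral_algebraMap)
    refine ⟨i, hi, c, ?_⟩
    rw [← map_pow, ← map_pow, ← map_mul] at hy'
    rw [Valuation.comap_apply, Valuation.comap_apply, hy']

theorem exists_embedding_of_sameType {β : B} {β' : M} (hB : IsT v (algebraMap A B t))
    (hM : IsT w (algebraMap A M t)) (hs : SameType A v w β β')
    (hpow : ∀ q : A[X], q ≠ 0 → ∀ n : ℕ, 0 < n → SamePow v w t n (aeval β q) (aeval β' q)) :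
    ∃ C : IntermediateField A B, β ∈ C ∧ (∀ x : B, IsIntegral C x → x ∈ C) ∧
      ∃ σ : C →ₐ[A] M, ∀ x y : C, v x ≤ v y ↔ w (σ x) ≤ w (σ y) := by
  obtain ⟨σ, hσβ, hσ⟩ := hs.exists_algHom
  let _ : Algebra A⟮β⟯ M := σ.toRingHom.toAlgebra
  have hG : PowCond A⟮β⟯ v w := by
    rintro e n hn ⟨y, hy⟩
    by_cases he : e = 0
    · exact ⟨0, by simp [he, zero_pow hn.ne']⟩
    obtain ⟨r, s, hrs⟩ := (mem_adjoin_simple_iff A (e : B)).1 e.2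
    have hr : r ≠ 0 := by rintro rfl; simp at hrs; exact he hrs
    have hs0 : s ≠ 0 := by rintro rfl; simp at hrs; exact he hrs
    have hσe : σ e = aeval β' r / aeval β' s := by
      have h1 : e = aeval (AdjoinSimple.gen A β) r / aeval (AdjoinSimple.gen A β) s := by
        apply Subtype.val_injective
        rw [hrs, IntermediateField.coe_div]
        congr 1
        · exact aeval_algHom_apply A⟮β⟯.val (AdjoinSimple.gen A β) _
        · exact aeval_algHom_apply A⟮β⟯.val (AdjoinSimple.gen A β) _
      conv_lhs => rw [h1]
      rw [map_div₀, ← aeval_algHom_apply, ← aeval_algHom_apply, hσβ]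
    have h := (hpow r hr n hn).div hB hM (hpow s hs0 n hn)
    rw [← hrs, ← hσe] at h
    exact h.exists_pow hn hB hy
  obtain ⟨τ, hτ⟩ := exists_algHom_algebraicClosure (F := A⟮β⟯) hB hM hσ hG
  refine ⟨(algebraicClosure A⟮β⟯ B).restrictScalars A,
    (algebraicClosure A⟮β⟯ B).algebraMap_mem (AdjoinSimple.gen A β), fun x hx => ?_,
    { τ with commutes' := fun a => ?_ }, hτ⟩
  · exact mem_algebraicClosure_iff'.2 (isIntegral_trans (R := A⟮β⟯)
      (A := algebraicClosure A⟮β⟯ B) x hx)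
  · exact (τ.commutes (algebraMap A A⟮β⟯ a)).trans (σ.commutes a)

end Models

section Realize

open Polynomial Filter

variable {A B M : Type*} [Field A] [Field B] [Field M] [Algebra A B] [Algebra A M]
  {Γ Γ' : Type*} [LinearOrderedCommGroupWithZero Γ] [LinearOrderedCommGroupWithZero Γ']

/-- A presentation of a valued field `M` as a power of `A` modulo a filter. -/
structure PowerMap (v : Valuation A Γ) (w : Valuation M Γ') where
  /-- The filter. -/
  U : Filter (Finset (Set A))
  neBot : U.NeBot
  le : U ≤ atTop
  /-- The projection. -/
  proj : (Finset (Set A) → A) →+* M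
  proj_const : ∀ a, proj (fun _ => a) = algebraMap A M a
  le_iff : ∀ f g, w (proj f) ≤ w (proj g) ↔ ∀ᶠ J in U, v (f J) ≤ v (g J)

theorem exists_eventually_mem {α ι : Type*} (S : ι → Set α)
    (h : ∀ F : Finset ι, ∃ a, ∀ i ∈ F, a ∈ S i) :
    ∃ f : Finset (Set α) → α, ∀ i, ∀ᶠ J in atTop, f J ∈ S i := by
  classical
  have key : ∀ J : Finset (Set α), ∃ F : Finset ι, ∀ i, S i ∈ J → ∃ k ∈ F, S k = S i := by
    intro J
    induction J using Finset.induction_on with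
    | empty => exact ⟨∅, by simp⟩
    | insert s J _ ih =>
      obtain ⟨F, hF⟩ := ih
      by_cases hs : ∃ i, S i = s
      · obtain ⟨i, rfl⟩ := hs
        refine ⟨insert i F, fun j hj => ?_⟩
        rcases Finset.mem_insert.1 hj with hj | hj
        · exact ⟨i, Finset.mem_insert_self _ _, hj.symm⟩
        · obtain ⟨k, hk, hkj⟩ := hF j hj
          exact ⟨k, Finset.mem_insert_of_mem hk, hkj⟩
      · refine ⟨F, fun j hj => ?_⟩
        rcases Finset.mem_insert.1 hj with hj | hj
        · exact absurd ⟨j, hj⟩ hs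
        · exact hF j hj
  have key' : ∀ J : Finset (Set α), ∃ a, ∀ i, S i ∈ J → a ∈ S i := by
    intro J
    obtain ⟨F, hF⟩ := key J
    obtain ⟨a, ha⟩ := h F
    refine ⟨a, fun i hi => ?_⟩
    obtain ⟨k, hk, hki⟩ := hF i hi
    exact hki ▸ ha k hk
  choose f hf using key'
  refine ⟨f, fun i => ?_⟩
  filter_upwards [eventually_ge_atTop {S i}] with J hJ
  exact hf J i (Finset.singleton_subset_iff.1 hJ)

variable {v : Valuation B Γ} {w : Valuation M Γ'} {t : A} {b : B}

namespace PowerMap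

variable (P : PowerMap (v.comap (algebraMap A B)) w)
include P

theorem isoOn : IsoOn A v w := by
  intro x y
  have := P.neBot
  rw [← P.proj_const, ← P.proj_const, P.le_iff]
  simp

theorem eq_iff (f g : Finset (Set A) → A) : w (P.proj f) = w (P.proj g) ↔
    ∀ᶠ J in P.U, v (algebraMap A B (f J)) = v (algebraMap A B (g J)) := by
  simp only [le_antisymm_iff, P.le_iff, eventually_and, Valuation.comap_apply]

theorem exists_of_finite {ι : Type*} (S : ι → Set A) (h : ∀ F : Finset ι, ∃ a, ∀ i ∈ F, a ∈ S i) :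
    ∃ f : Finset (Set A) → A, ∀ i, ∀ᶠ J in P.U, f J ∈ S i := by
  obtain ⟨f, hf⟩ := exists_eventually_mem S h
  exact ⟨f, fun i => P.le (hf i)⟩

theorem exists_sameApprox (hlim : IsLimitOver A v b) : ∃ b' : M, SameApprox A v w b b' := by
  obtain ⟨f, hf⟩ := P.exists_of_finite
    (fun e : A => {a | v (algebraMap A B a - algebraMap A B e) = v (b - algebraMap A B e)})
    (fun F => by
      have h : ∀ᶠ a in approx A v b, ∀ e ∈ F,
          v (b - algebraMap A B a) < v (b - algebraMap A B e) :=
        (Finset.eventually_all F).2 fun e _ => hlim.eventually_lt e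
      obtain ⟨a, ha⟩ := h.exists
      exact ⟨a, fun e he => val_sub_of_lt (ha e he)⟩)
  refine ⟨P.proj f, Eventually.of_forall fun e e' he => ?_⟩
  rw [← map_sub, ← P.proj_const, ← P.proj_const, ← map_sub, P.eq_iff]
  filter_upwards [hf e] with J hJ
  simp only [Pi.sub_apply, map_sub]
  rw [val_sub_of_lt he]
  exact hJ

theorem exists_resNew (hA : IsT (v.comap (algebraMap A B)) t) : ∃ b' : M, ResNew A w b' := by
  classical
  obtain ⟨f, hf⟩ := P.exists_of_finite
    (fun e : A => {a | v (algebraMap A B a) ≤ 1 ∧ (v (algebraMap A B e) ≤ 1 →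
      1 ≤ v (algebraMap A B a - algebraMap A B e))})
    (fun F => by
      set u := v.comap (algebraMap A B) with hu
      let p : u.integer[X] := X * ∏ e ∈ F, (X - C (if h : e ∈ u.integer then ⟨e, h⟩ else 0))
      have hp : p.Monic := monic_X.mul (monic_prod_of_monic _ _ fun e _ => monic_X_sub_C _)
      have hp0 : 0 < p.natDegree := by
        rw [(monic_X).natDegree_mul (monic_prod_of_monic _ _ fun e _ => monic_X_sub_C _),
          natDegree_X]
        omega
      have hp1 : (p + 1).Monic := hp.add_of_left (by
        rw [degree_one]; exact natDegree_pos_iff_degree_pos.1 hp0)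
      obtain ⟨a, ha, hpa⟩ := hA.residue ((p + 1).map u.integer.subtype) (hp1.map _)
        (by rwa [hp1.natDegree_map, ← C_1, natDegree_add_C]) (fun i => by
          rw [coeff_map]; exact ((p + 1).coeff i).2)
      have hva : u ((p.map u.integer.subtype).eval a) = 1 := by
        have h1 : (p.map u.integer.subtype).eval a =
            ((p + 1).map u.integer.subtype).eval a - 1 := by simp
        rw [h1, u.map_sub_eq_of_lt_right (by rwa [map_one]), map_one]
      refine ⟨a, fun e he => ⟨ha, fun he1 => ?_⟩⟩
      rw [Polynomial.map_mul, eval_mul, Polynomial.map_prod, eval_prod, map_mul, map_prod,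
        ← Finset.mul_prod_erase _ _ he] at hva
      simp only [map_X, eval_X, Polynomial.map_sub, map_C, eval_sub, eval_C] at hva
      replace he1 : e ∈ u.integer := he1
      rw [dif_pos he1] at hva
      by_contra! hlt
      have hle : ∀ e : A, u (a - u.integer.subtype (if h : e ∈ u.integer then ⟨e, h⟩ else 0)) ≤ 1 :=
        fun e => u.map_sub_le ha (if h : e ∈ u.integer then (⟨e, h⟩ : u.integer) else 0).2
      have h2 : u a * (u (a - e) * ∏ x ∈ F.erase e,
          u (a - u.integer.subtype (if h : x ∈ u.integer then ⟨x, h⟩ else 0))) < 1 := by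
        refine (mul_le_of_le_one_left' ha).trans_lt
          ((mul_le_of_le_one_right' (Finset.prod_le_one' fun x _ => hle x)).trans_lt ?_)
        rw [hu, Valuation.comap_apply, map_sub]
        exact hlt
      exact h2.ne hva)
  refine ⟨P.proj f, ?_, fun e he => ?_⟩
  · have := P.le_iff f 1
    rw [map_one, map_one] at this
    refine this.2 ?_
    filter_upwards [hf 0] with J hJ
    simpa using hJ.1
  · have := P.le_iff 1 (f - fun _ => e)
    rw [map_one, map_one, map_sub, P.proj_const] at this
    refine this.2 ?_
    filter_upwards [hf e] with J hJ
    simpa using hJ.2 ((P.isoOn.le_one_iff e).2 he)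

end PowerMap

end Realize

section Cut

open Polynomial Filter

variable {A B M : Type*} [Field A] [Field B] [Field M] [Algebra A B] [Algebra A M]
  {Γ Γ' : Type*} [LinearOrderedCommGroupWithZero Γ] [LinearOrderedCommGroupWithZero Γ']
  {v : Valuation B Γ} {w : Valuation M Γ'} {t : A} {c : B} {c' : M}

theorem IsT.lt_of_lt_mul (hB : IsT v (algebraMap A B t))
    (hc : ∀ e : A, v c ≠ v (algebraMap A B e)) {d : A} (h : v c < v (algebraMap A B d)) :
    v c < v (algebraMap A B (t * d)) := by
  have hd : 0 < v (algebraMap A B d) := zero_le.trans_lt h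
  refine lt_of_le_of_ne ?_ (hc _)
  have := hB.le_of_lt_one (c / algebraMap A B d) (by rwa [map_div₀, div_lt_one₀ hd])
  rwa [map_div₀, div_le_iff₀ hd, ← map_mul, ← map_mul] at this

theorem IsT.lt_of_mul_lt (hB : IsT v (algebraMap A B t))
    (hc : ∀ e : A, v c ≠ v (algebraMap A B e)) {d : A} (h : v (algebraMap A B (t * d)) < v c) :
    v (algebraMap A B d) < v c := by
  refine lt_of_not_ge fun h' => ?_
  exact (hB.lt_of_lt_mul hc (lt_of_le_of_ne h' (hc d))).not_gt h

theorem IsT.lt_of_lt_zpow_mul (hB : IsT v (algebraMap A B t))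
    (hc : ∀ e : A, v c ≠ v (algebraMap A B e)) {d : A} (h : v (algebraMap A B d) < v c) (k : ℤ) :
    v (algebraMap A B (t ^ k * d)) < v c := by
  have ht : t ≠ 0 := by
    have := hB.ne_zero
    contrapose! this
    rw [this, map_zero]
  induction k with
  | zero => simpa
  | succ k ih =>
    rw [zpow_add_one₀ ht, mul_right_comm, map_mul, map_mul]
    exact (mul_le_of_le_one_right' hB.lt_one.le).trans_lt ih
  | pred k ih =>
    refine hB.lt_of_mul_lt hc ?_
    rwa [← mul_assoc, ← zpow_one_add₀ ht, add_sub_cancel]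

theorem IsT.lt_zpow (h : IsT v (algebraMap A B t)) {k l : ℤ} (hkl : k < l) :
    v (algebraMap A B t) ^ l < v (algebraMap A B t) ^ k :=
  (zpow_lt_zpow_iff_right_of_lt_one₀ h.t_pos h.lt_one).2 hkl

theorem exists_interpolation (hA : IsT (v.comap (algebraMap A B)) t)
    (hB : IsT v (algebraMap A B t)) (hc : ∀ e : A, v c ≠ v (algebraMap A B e))
    {N : ℕ} (hN : 0 < N) (i : ℕ) (D : Finset A) :
    ∃ y : A, y ≠ 0 ∧ ∀ d ∈ D, v (algebraMap A B (t ^ i * y ^ N)) ≤ v (algebraMap A B d) ↔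
      v c ≤ v (algebraMap A B d) := by
  classical
  have hexp : ∀ (z : A) (j k : ℤ),
      v (algebraMap A B (t ^ j * (t ^ k * z) ^ N)) =
        v (algebraMap A B t) ^ (j + k * N) * v (algebraMap A B z) ^ N := by
    intro z j k
    simp only [map_mul, map_pow, map_zpow₀]
    rw [mul_pow, zpow_add₀ hB.t_pos.ne', zpow_mul, zpow_natCast, mul_assoc]
  let D' := (insert 1 D).filter (· ≠ 0)
  by_cases h : ∃ d ∈ D', v (algebraMap A B d) < v c
  · obtain ⟨d₁, hd₁, hmax⟩ := Finset.exists_max_image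
      (D'.filter fun d => v (algebraMap A B d) < v c)
      (fun d => v (algebraMap A B d)) (by
        obtain ⟨d, hd, hdc⟩ := h
        exact ⟨d, Finset.mem_filter.2 ⟨hd, hdc⟩⟩)
    simp only [D', Finset.mem_filter] at hd₁ hmax
    obtain ⟨j, hj, z, hz, hd₁z⟩ := hA.exists_ne_zero hN hd₁.1.2
    simp only [Valuation.comap_apply] at hd₁z
    have hz' : 0 < v (algebraMap A B z) ^ N := pow_pos (v.pos_iff.2 (by simpa)) _
    have hd₁' := hexp z j 0
    rw [zpow_zero, one_mul, zero_mul, add_zero, zpow_natCast, ← hd₁z] at hd₁'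
    have ha := hexp z i (-(i + 1))
    rw [zpow_natCast] at ha
    set a := t ^ i * (t ^ (-((i : ℤ) + 1)) * z) ^ N
    have hlt : v (algebraMap A B d₁) < v (algebraMap A B a) := by
      rw [hd₁', ha]
      refine mul_lt_mul_of_pos_right (hB.lt_zpow ?_) hz'
      nlinarith [Int.ofNat_lt.2 hN]
    have hac : v (algebraMap A B a) < v c := by
      have := hB.lt_of_lt_zpow_mul hc hd₁.2 (i + -(i + 1) * N - j)
      convert this using 1
      rw [ha, map_mul, map_mul, map_zpow₀, map_zpow₀, hd₁', ← mul_assoc,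
        ← zpow_add₀ hB.t_pos.ne', sub_add_cancel]
    refine ⟨t ^ (-((i : ℤ) + 1)) * z, mul_ne_zero (zpow_ne_zero _ hA.ne_zero) hz, fun d hd =>
      ⟨fun hle => ?_, fun hle => hac.le.trans hle⟩⟩
    by_contra! hlt'
    refine (hlt.trans_le hle).not_ge (hmax d ⟨⟨Finset.mem_insert_of_mem hd, ?_⟩, hlt'⟩)
    rintro rfl
    rw [map_zero, map_zero] at hle
    exact (zero_le.trans_lt hlt).not_ge hle
  · push Not at h
    obtain ⟨d₁, hd₁, hmin⟩ := Finset.exists_min_image D' (fun d => v (algebraMap A B d))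
      ⟨1, by simp [D']⟩
    have hd₁0 := (Finset.mem_filter.1 hd₁).2
    obtain ⟨j, hj, z, hz, hd₁z⟩ := hA.exists_ne_zero hN hd₁0
    simp only [Valuation.comap_apply] at hd₁z
    have hz' : 0 < v (algebraMap A B z) ^ N := pow_pos (v.pos_iff.2 (by simpa)) _
    have hd₁' := hexp z j 0
    rw [zpow_zero, one_mul, zero_mul, add_zero, zpow_natCast, ← hd₁z] at hd₁'
    have ha := hexp z i (j + 1)
    rw [zpow_natCast] at ha
    set a := t ^ i * (t ^ ((j : ℤ) + 1) * z) ^ N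
    have hlt : v (algebraMap A B a) < v (algebraMap A B d₁) := by
      rw [hd₁', ha]
      refine mul_lt_mul_of_pos_right (hB.lt_zpow ?_) hz'
      nlinarith [Int.ofNat_lt.2 hN]
    have hy : t ^ ((j : ℤ) + 1) * z ≠ 0 := mul_ne_zero (zpow_ne_zero _ hA.ne_zero) hz
    refine ⟨t ^ ((j : ℤ) + 1) * z, hy, fun d hd => ?_⟩
    by_cases hd0 : d = 0
    · rw [hd0, map_zero, map_zero]
      refine iff_of_false (fun hle => ?_) fun hle => hc 0 (by simpa using hle)
      rw [le_zero_iff, v.zero_iff, _root_.map_eq_zero] at hle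
      exact mul_ne_zero (pow_ne_zero _ hA.ne_zero) (pow_ne_zero _ hy) hle
    · have hd' : d ∈ D' := Finset.mem_filter.2 ⟨Finset.mem_insert_of_mem hd, hd0⟩
      exact iff_of_true (hlt.le.trans (hmin d hd')) (h d hd')

theorem PowerMap.exists_cut (P : PowerMap (v.comap (algebraMap A B)) w)
    (hA : IsT (v.comap (algebraMap A B)) t) (hB : IsT v (algebraMap A B t))
    (hc : ∀ e : A, v c ≠ v (algebraMap A B e)) : ∃ c' : M,
      (∀ d : A, w c' ≤ w (algebraMap A M d) ↔ v c ≤ v (algebraMap A B d)) ∧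
      ∀ n, 0 < n → SamePow v w t n c c' := by
  classical
  have hne := P.neBot
  have hc0 : c ≠ 0 := by
    have := hc 0
    contrapose! this
    rw [this, map_zero, map_zero, map_zero]
  choose i _ y hy0 hy using fun n : ℕ => hB.exists_ne_zero n.succ_pos hc0
  obtain ⟨f, hf⟩ := P.exists_of_finite (ι := A ⊕ ℕ) (Sum.elim
    (fun d => {a | v (algebraMap A B a) ≤ v (algebraMap A B d) ↔ v c ≤ v (algebraMap A B d)})
    (fun n => {a | ∃ z : A, v (algebraMap A B a) = v (algebraMap A B (t ^ i n * z ^ (n + 1)))}))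
    (fun F => by
      obtain ⟨N, hN⟩ : ∃ N, N + 1 = ∏ n ∈ F.toRight, (n + 1) :=
        Nat.exists_eq_succ_of_ne_zero (Finset.prod_ne_zero_iff.2 fun n _ => n.succ_ne_zero) |>.imp
          fun _ h => h.symm
      obtain ⟨z, hz, hzF⟩ := exists_interpolation hA hB hc N.succ_pos (i N) F.toLeft
      refine ⟨t ^ i N * z ^ (N + 1), ?_⟩
      rintro (d | n) hF
      · exact hzF d (Finset.mem_toLeft.2 hF)
      · obtain ⟨m, hm⟩ : n + 1 ∣ N + 1 := hN ▸ Finset.dvd_prod_of_mem _ (Finset.mem_toRight.2 hF)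
        have ht := hB.ne_zero
        have hvt := v.ne_zero_iff.2 ht
        have hvy := v.ne_zero_iff.2 (hy0 N)
        have hvy' := v.ne_zero_iff.2 (hy0 n)
        have h := (hy n).symm.trans (hy N)
        obtain ⟨k, hk⟩ := hB.zpow_dvd (n := n + 1) (k := (i N : ℤ) - i n) (y := y n / y N ^ m) (by
          simp only [map_mul, map_pow, map_zpow₀, map_div₀] at h ⊢
          rw [zpow_sub₀ hvt, zpow_natCast, zpow_natCast, div_pow, ← pow_mul, mul_comm m, ← hm,
            div_eq_div_iff (pow_ne_zero _ hvt) (pow_ne_zero _ hvy), mul_comm (v (y n) ^ _), ← h])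
          n.succ_ne_zero
        refine ⟨t ^ k * z ^ m, ?_⟩
        congr 2
        rw [hm, mul_pow, ← pow_mul, mul_comm m, ← mul_assoc, ← zpow_natCast _ (n + 1), ← zpow_mul,
          ← zpow_natCast _ (i n), ← zpow_add₀ hA.ne_zero, mul_comm k, ← hk, add_sub_cancel,
          zpow_natCast])
  have hle : ∀ d : A, w (P.proj f) ≤ w (algebraMap A M d) ↔ v c ≤ v (algebraMap A B d) := by
    intro d
    rw [← P.proj_const, P.le_iff]
    constructor
    · intro h
      obtain ⟨J, hJ, hJ'⟩ := (h.and (hf (Sum.inl d))).exists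
      exact hJ'.1 hJ
    · intro h
      filter_upwards [hf (Sum.inl d)] with J hJ
      exact hJ.2 h
  refine ⟨P.proj f, hle, fun n hn => ?_⟩
  obtain ⟨n, rfl⟩ := Nat.exists_eq_succ_of_ne_zero hn.ne'
  have hfn := hf (Sum.inr n)
  simp only [Sum.elim_inr, Set.mem_ofPred_eq] at hfn
  obtain ⟨g, hg⟩ := hfn.choice
  have hval : w (P.proj f) = w (algebraMap A M t ^ i n * P.proj g ^ (n + 1)) := by
    rw [← P.proj_const, ← map_pow, ← map_pow, ← map_mul, P.eq_iff]
    exact hg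
  refine ⟨i n, ⟨y n, hy0 n, by rw [zpow_natCast]; exact hy n⟩, P.proj g, fun h0 => ?_,
    by rw [zpow_natCast]; exact hval⟩
  have := hle 0
  rw [hval, h0] at this
  simp [hc0] at this

theorem IsT.zpow_mul_pow_lt (hB : IsT v (algebraMap A B t)) {z : A}
    (h : v (algebraMap A B z) < v c) (i : ℕ) {m : ℕ} (hm : m ≠ 0) :
    v (algebraMap A B (t ^ i * z ^ m)) < v c ^ m := by
  rw [map_mul, map_pow, map_pow, map_mul, map_pow, map_pow]
  exact (mul_le_of_le_one_left' (pow_le_one' hB.lt_one.le i)).trans_lt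
    (pow_lt_pow_left₀ h zero_le hm)

theorem IsT.lt_zpow_mul_pow (hB : IsT v (algebraMap A B t))
    (hc : ∀ e : A, v c ≠ v (algebraMap A B e)) {z : A}
    (h : v c < v (algebraMap A B z)) {i m : ℕ} (hi : i < m) :
    v c ^ m < v (algebraMap A B (t ^ i * z ^ m)) := by
  refine (pow_lt_pow_left₀ (hB.lt_of_lt_mul hc h) zero_le (by omega)).trans_le ?_
  rw [← map_pow, ← map_pow, mul_pow, map_mul, map_mul, map_mul, map_mul]
  refine mul_le_mul_left ?_ _
  rw [map_pow, map_pow, map_pow, map_pow]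
  exact pow_le_pow_right_of_le_one' hB.lt_one.le hi.le

theorem pow_lt_iff_of_cut (hA : IsT (v.comap (algebraMap A B)) t) (hB : IsT v (algebraMap A B t))
    (hM : IsT w (algebraMap A M t)) (hiso : IsoOn A v w)
    (hc : ∀ e : A, v c ≠ v (algebraMap A B e)) (hc' : ∀ e : A, w c' ≠ w (algebraMap A M e))
    (hcut : ∀ d : A, w c' ≤ w (algebraMap A M d) ↔ v c ≤ v (algebraMap A B d))
    {m : ℕ} (hm : m ≠ 0) (a : A) :
    (v c ^ m < v (algebraMap A B a) ∧ w c' ^ m < w (algebraMap A M a)) ∨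
    (v (algebraMap A B a) < v c ^ m ∧ w (algebraMap A M a) < w c' ^ m) := by
  by_cases ha : a = 0
  · have h1 := hc 0
    have h2 := hc' 0
    rw [map_zero, map_zero] at h1 h2
    rw [ha, map_zero, map_zero, map_zero, map_zero]
    exact Or.inr ⟨pow_pos (zero_lt_iff.2 h1) _, pow_pos (zero_lt_iff.2 h2) _⟩
  obtain ⟨i, hi, z, hz, haz⟩ := hA.exists_ne_zero (Nat.pos_of_ne_zero hm) ha
  have haz' := (hiso.eq_iff _ _).1 haz
  rw [Valuation.comap_apply, Valuation.comap_apply] at haz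
  rw [haz, haz']
  rcases lt_or_gt_of_ne (hc z) with h | h
  · exact Or.inl ⟨hB.lt_zpow_mul_pow hc h hi,
      hM.lt_zpow_mul_pow hc' (lt_of_le_of_ne ((hcut z).2 h.le) (hc' z)) hi⟩
  · refine Or.inr ⟨hB.zpow_mul_pow_lt h i hm, hM.zpow_mul_pow_lt ?_ i hm⟩
    exact lt_of_not_ge fun h' => ((hcut z).1 h').not_gt h

theorem sameMonomials_of_cut (hA : IsT (v.comap (algebraMap A B)) t)
    (hB : IsT v (algebraMap A B t))
    (hM : IsT w (algebraMap A M t)) (hiso : IsoOn A v w)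
    (hc : ∀ e : A, v c ≠ v (algebraMap A B e)) (hc' : ∀ e : A, w c' ≠ w (algebraMap A M e))
    (hcut : ∀ d : A, w c' ≤ w (algebraMap A M d) ↔ v c ≤ v (algebraMap A B d)) (n : ℕ) :
    SameMonomials A v w n c c' := by
  have h1 : 0 < v c := zero_lt_iff.2 (by simpa using hc 0)
  have h2 : 0 < w c' := zero_lt_iff.2 (by simpa using hc' 0)
  intro a b j k _ _
  simp only [map_mul, map_pow]
  by_cases ha : a = 0
  · simp [ha]
  by_cases hb : b = 0
  · simp [hb, ha, h1.ne', h2.ne']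
  have ha1 : 0 < v (algebraMap A B a) := v.pos_iff.2 (by simpa)
  have ha2 : 0 < w (algebraMap A M a) := w.pos_iff.2 (by simpa)
  have hb1 : 0 < v (algebraMap A B b) := v.pos_iff.2 (by simpa)
  have hb2 : 0 < w (algebraMap A M b) := w.pos_iff.2 (by simpa)
  obtain h | ⟨m, hm, h⟩ | ⟨m, hm, h⟩ : j = k ∨ (∃ m, m ≠ 0 ∧ k = j + m) ∨
      ∃ m, m ≠ 0 ∧ j = k + m := by
    rcases lt_trichotomy j k with h | h | h
    · exact Or.inr (Or.inl ⟨k - j, by omega, by omega⟩)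
    · exact Or.inl h
    · exact Or.inr (Or.inr ⟨j - k, by omega, by omega⟩)
  · rw [h, mul_le_mul_iff_left₀ (pow_pos h1 _), mul_le_mul_iff_left₀ (pow_pos h2 _)]
    exact hiso a b
  · have key := pow_lt_iff_of_cut hA hB hM hiso hc hc' hcut hm (a / b)
    rw [map_div₀, map_div₀, map_div₀, map_div₀, lt_div_iff₀ hb1, lt_div_iff₀ hb2,
      div_lt_iff₀ hb1, div_lt_iff₀ hb2] at key
    rw [h, add_comm, pow_add, pow_add, ← mul_assoc, ← mul_assoc,
      mul_le_mul_iff_left₀ (pow_pos h1 _), mul_le_mul_iff_left₀ (pow_pos h2 _),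
      mul_comm _ (v c ^ m),
      mul_comm _ (w c' ^ m)]
    rcases key with ⟨h, h'⟩ | ⟨h, h'⟩
    · exact iff_of_false h.not_ge h'.not_ge
    · exact iff_of_true h.le h'.le
  · have key := pow_lt_iff_of_cut hA hB hM hiso hc hc' hcut hm (b / a)
    rw [map_div₀, map_div₀, map_div₀, map_div₀, lt_div_iff₀ ha1, lt_div_iff₀ ha2,
      div_lt_iff₀ ha1, div_lt_iff₀ ha2] at key
    rw [h, add_comm, pow_add, pow_add, ← mul_assoc, ← mul_assoc,
      mul_le_mul_iff_left₀ (pow_pos h1 _), mul_le_mul_iff_left₀ (pow_pos h2 _),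
      mul_comm _ (v c ^ m),
      mul_comm _ (w c' ^ m)]
    rcases key with ⟨h, h'⟩ | ⟨h, h'⟩
    · exact iff_of_true h.le h'.le
    · exact iff_of_false h.not_ge h'.not_ge

/-- Every element of `B` lies in a relatively algebraically closed subfield that embeds in a
large enough power of `A`. -/
theorem PowerMap.exists_embedding (P : PowerMap (v.comap (algebraMap A B)) w)
    (hA : IsT (v.comap (algebraMap A B)) t) (hB : IsT v (algebraMap A B t))
    (hM : IsT w (algebraMap A M t)) (b : B) :
    ∃ C : IntermediateField A B, b ∈ C ∧ (∀ x : B, IsIntegral C x → x ∈ C) ∧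
      ∃ σ : C →ₐ[A] M, ∀ x y : C, v x ≤ v y ↔ w (σ x) ≤ w (σ y) := by
  have hiso := P.isoOn
  have halg : ∀ x : B, IsAlgebraic A x → ∃ e, algebraMap A B e = x :=
    fun x hx => hA.mem_of_isIntegral hB hx.isIntegral
  have hvalues : ∀ (β : B) (β' : M), b ∈ IntermediateField.adjoin A {β} →
      (∀ q : A[X], ∃ x : A, v (aeval β q) = v (algebraMap A B x) ∧
        w (aeval β' q) = w (algebraMap A M x)) → (∀ e : A, algebraMap A B e ≠ β) →
      ∃ C : IntermediateField A B, b ∈ C ∧ (∀ x : B, IsIntegral C x → x ∈ C) ∧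
        ∃ σ : C →ₐ[A] M, ∀ x y : C, v x ≤ v y ↔ w (σ x) ≤ w (σ y) := by
    intro β β' hb hβ hβA
    obtain ⟨C, hC, h⟩ := exists_embedding_of_sameType hB hM (SameType.of_values hiso hβ)
      (fun q hq n hn => by
        obtain ⟨x, h1, h2⟩ := hβ q
        have hx : x ≠ 0 := by
          rintro rfl
          rw [map_zero, map_zero, v.zero_iff] at h1
          obtain ⟨e, he⟩ := halg β ⟨q, hq, h1⟩
          exact hβA e he
        obtain ⟨i, ⟨z, hz, hxz⟩, ⟨z', hz', hxz'⟩⟩ := samePow_algebraMap hA hiso hn hx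
        exact ⟨i, ⟨z, hz, h1.trans hxz⟩, ⟨z', hz', h2.trans hxz'⟩⟩)
    exact ⟨C, IntermediateField.adjoin_simple_le_iff.2 hC hb, h⟩
  by_cases hbA : ∃ e, algebraMap A B e = b
  · obtain ⟨e, rfl⟩ := hbA
    refine ⟨⊥, (⊥ : IntermediateField A B).algebraMap_mem e, fun x hx => ?_,
      (Algebra.ofId A M).comp (IntermediateField.botEquiv A B).toAlgHom, ?_⟩
    · obtain ⟨a, rfl⟩ := hA.mem_of_isIntegral hB
        (isIntegral_trans (R := A) (A := (⊥ : IntermediateField A B)) x hx)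
      exact IntermediateField.algebraMap_mem _ a
    · rintro ⟨x, hx⟩ ⟨y, hy⟩
      obtain ⟨x, rfl⟩ := IntermediateField.mem_bot.1 hx
      obtain ⟨y, rfl⟩ := IntermediateField.mem_bot.1 hy
      have h : ∀ z hz, (IntermediateField.botEquiv A B) ⟨algebraMap A B z, hz⟩ = z :=
        fun z hz => IntermediateField.botEquiv_def z
      change v (algebraMap A B x) ≤ v (algebraMap A B y) ↔
        w (algebraMap A M (IntermediateField.botEquiv A B ⟨algebraMap A B x, hx⟩)) ≤
          w (algebraMap A M (IntermediateField.botEquiv A B ⟨algebraMap A B y, hy⟩))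
      rw [h, h]
      exact hiso x y
  have hbA' : ∀ e, algebraMap A B e ≠ b := not_exists.1 hbA
  by_cases hlim : IsLimitOver A v b
  · obtain ⟨b', hb'⟩ := P.exists_sameApprox hlim
    exact hvalues b b' (IntermediateField.mem_adjoin_simple_self A b)
      (exists_value_of_limit_transcendental hB hiso hlim hb' halg) hbA'
  simp only [IsLimitOver, not_forall, not_exists, not_lt] at hlim
  obtain ⟨e₀, he₀⟩ := hlim
  set β := b - algebraMap A B e₀ with hβ
  have hbβ : ∀ C : IntermediateField A B, β ∈ C → b ∈ C := fun C h => by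
    rw [← sub_add_cancel b (algebraMap A B e₀)]
    exact C.add_mem h (C.algebraMap_mem e₀)
  have hβA : ∀ e, algebraMap A B e ≠ β := fun e he =>
    hbA' (e + e₀) (by rw [map_add, he, hβ, sub_add_cancel])
  by_cases hval : ∃ d, v β = v (algebraMap A B d)
  · obtain ⟨d, hd⟩ := hval
    have hd0 : algebraMap A B d ≠ 0 := by
      rw [← v.ne_zero_iff, ← hd, v.ne_zero_iff]
      exact fun h => hβA 0 (by rw [h, map_zero])
    have hγ : ResNew A v (β / algebraMap A B d) := by
      refine ⟨by rw [map_div₀, hd, div_self (v.ne_zero_iff.2 hd0)], fun e _ => ?_⟩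
      have h := he₀ (e₀ + d * e)
      rw [map_add, ← sub_sub, ← hβ, hd, map_mul] at h
      have h1 : β / algebraMap A B d - algebraMap A B e =
          (β - algebraMap A B d * algebraMap A B e) / algebraMap A B d := by
        rw [sub_div _ (_ * _), mul_div_cancel_left₀ _ hd0]
      rwa [h1, map_div₀, one_le_div₀ (v.pos_iff.2 hd0)]
    obtain ⟨γ', hγ'⟩ := P.exists_resNew hA
    refine hvalues _ γ' (hbβ _ ?_) (fun q => exists_value_of_resNew hiso
      (hA.resClosed (q.natDegree + 1)) hγ hγ' q (Nat.lt_succ_self _)) fun e he => ?_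
    · have := mul_mem (IntermediateField.mem_adjoin_simple_self A (β / algebraMap A B d))
        (IntermediateField.algebraMap_mem _ d)
      rwa [div_mul_cancel₀ _ hd0] at this
    · exact hβA (e * d) (by rw [map_mul, he, div_mul_cancel₀ _ hd0])
  · push Not at hval
    obtain ⟨β', hcut, hpow⟩ := P.exists_cut hA hB hval
    have hβ0 : β ≠ 0 := fun h => hβA 0 (by rw [h, map_zero])
    have hval' : ∀ e : A, w β' ≠ w (algebraMap A M e) := by
      intro e he
      have h1 := hB.lt_of_lt_mul hval (lt_of_le_of_ne ((hcut e).1 he.le) (hval e))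
      have h2 := (hcut _).2 h1.le
      have he0 : 0 < w (algebraMap A M e) := by
        refine zero_lt_iff.2 fun h => ?_
        rw [w.zero_iff, _root_.map_eq_zero] at h
        have := (hcut e).1 he.le
        rw [h, map_zero, map_zero, le_zero_iff, v.zero_iff] at this
        exact hβ0 this
      rw [he, map_mul, map_mul] at h2
      exact h2.not_gt (mul_lt_of_lt_one_left he0 hM.lt_one)
    have hβ'0 : β' ≠ 0 := fun h => hval' 0 (by rw [h, map_zero, map_zero, map_zero])
    have hmon := sameMonomials_of_cut hA hB hM hiso hval hval' hcut
    have hnew : ∀ n, ValNew A v n β := fun n => ⟨hβ0, fun k hk _ e he => by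
      obtain ⟨e', he'⟩ := hA.valClosed hB β k e hk he
      exact hval e' he'⟩
    obtain ⟨C, hC, h⟩ := exists_embedding_of_sameType hB hM (β := β) (β' := β')
      (fun q r => (hnew _).sameType_lt (hmon (max q.natDegree r.natDegree + 1)) hβ'0 q r
        (by omega) (by omega))
      (fun q hq n hn => by
        obtain ⟨j, -, a, ha, h1, h2⟩ := (hnew _).exists_monomial (hmon (q.natDegree + 1)) hβ'0 hq
          (Nat.lt_succ_self _)
        obtain ⟨i, ⟨z, hz, hxz⟩, ⟨z', hz', hxz'⟩⟩ := (samePow_algebraMap hA hiso hn ha).mul_npow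
          hB hM (hpow n hn) j
        exact ⟨i, ⟨z, hz, h1.trans hxz⟩, ⟨z', hz', h2.trans hxz'⟩⟩)
    exact ⟨C, hbβ C hC, h⟩

end Cut

section Axioms

open Language Polynomial

/-- The structure on `K` is the one given by the valuation `v` and the value `γ`. -/
def IsValuedStructure {K : Type*} [Field K] [S : LVR.Structure K] {Γ : Type*}
    [LinearOrderedCommGroupWithZero Γ] (v : Valuation K Γ) (γ : Γ) : Prop :=
  S = valuedStructure v γ

namespace LVRTerm

variable {α : Type*}

/-- The zero term. -/
def zero : LVR.Term α := Term.func LVRFunc.zero ![]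

/-- The one term. -/
def one : LVR.Term α := Term.func LVRFunc.one ![]

/-- The sum of two terms. -/
def add (s t : LVR.Term α) : LVR.Term α := Term.func LVRFunc.add ![s, t]

/-- The product of two terms. -/
def mul (s t : LVR.Term α) : LVR.Term α := Term.func LVRFunc.mul ![s, t]

/-- The power of a term. -/
def pow (s : LVR.Term α) : ℕ → LVR.Term α
  | 0 => one
  | n + 1 => mul (pow s n) s

/-- A numeral. -/
def natCast : ℕ → LVR.Term α
  | 0 => zero
  | n + 1 => add (natCast n) one

/-- The value of a polynomial with coefficients given by terms. -/
def poly (y : LVR.Term α) : (n : ℕ) → (Fin n → LVR.Term α) → LVR.Term α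
  | 0, _ => zero
  | n + 1, c => add (poly y n (Fin.init c)) (mul (c (Fin.last n)) (pow y n))

end LVRTerm

namespace LVRFormula

variable {α : Type*}

/-- The formula `s ∣ t`. -/
def dvd (s t : LVR.Term α) : LVR.Formula α := Relations.formula₂ (L := LVR) LVRRel.dvd s t

/-- The formula `N s`. -/
def uniformizer (s : LVR.Term α) : LVR.Formula α := Relations.formula₁ (L := LVR) LVRRel.N s

/-- The formula expressing that `s` lies in the valuation ring. -/
def integral (s : LVR.Term α) : LVR.Formula α := dvd LVRTerm.one s

/-- The formula expressing that `s` lies in the maximal ideal. -/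
def small (s : LVR.Term α) : LVR.Formula α := (dvd s LVRTerm.one).not

end LVRFormula

variable {K : Type*} [Field K] {Γ : Type*} [LinearOrderedCommGroupWithZero Γ]
  {v : Valuation K Γ}

theorem IsT.congr {t t' : K} (h : IsT v t) (htt' : v t = v t') : IsT v t' where
  ne_zero := by rw [← v.ne_zero_iff, ← htt', v.ne_zero_iff]; exact h.ne_zero
  lt_one := htt' ▸ h.lt_one
  le_of_lt_one x hx := htt' ▸ h.le_of_lt_one x hx
  natCast := h.natCast
  hensel := h.hensel
  residue := h.residue
  div n hn x hx := by
    obtain ⟨i, hi, y, hy⟩ := h.div n hn x hx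
    exact ⟨i, hi, y, by simp only [hy, map_mul, map_pow, htt']⟩

variable [LVR.Structure K] {γ : Γ} {α : Type*} {x : α → K}

namespace IsValuedStructure

variable (h : IsValuedStructure v γ)
include h

theorem realize_zero : (LVRTerm.zero : LVR.Term α).realize x = 0 := by
  subst h; rfl

theorem realize_one : (LVRTerm.one : LVR.Term α).realize x = 1 := by
  subst h; rfl

theorem realize_add (s t : LVR.Term α) :
    (LVRTerm.add s t).realize x = s.realize x + t.realize x := by
  subst h; rfl

theorem realize_mul (s t : LVR.Term α) :
    (LVRTerm.mul s t).realize x = s.realize x * t.realize x := by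
  subst h; rfl

theorem realize_pow (s : LVR.Term α) (n : ℕ) :
    (LVRTerm.pow s n).realize x = s.realize x ^ n := by
  induction n with
  | zero => rw [pow_zero]; exact h.realize_one
  | succ n ih => rw [pow_succ, ← ih]; exact h.realize_mul _ _

theorem realize_natCast (n : ℕ) : (LVRTerm.natCast n : LVR.Term α).realize x = n := by
  induction n with
  | zero => rw [Nat.cast_zero]; exact h.realize_zero
  | succ n ih =>
    rw [Nat.cast_succ, ← ih, ← h.realize_one (x := x)]
    exact h.realize_add _ _

theorem realize_poly (y : LVR.Term α) (n : ℕ) (c : Fin n → LVR.Term α) :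
    (LVRTerm.poly y n c).realize x = ∑ i, (c i).realize x * y.realize x ^ (i : ℕ) := by
  induction n with
  | zero => rw [Fin.sum_univ_zero]; exact h.realize_zero
  | succ n ih =>
    rw [Fin.sum_univ_castSucc, LVRTerm.poly, h.realize_add, ih, h.realize_mul, h.realize_pow]
    rfl

theorem realize_dvd (s t : LVR.Term α) :
    (LVRFormula.dvd s t).Realize x ↔ v (t.realize x) ≤ v (s.realize x) := by
  refine Formula.realize_rel₂.trans ?_
  subst h
  rfl

theorem realize_uniformizer (s : LVR.Term α) :
    (LVRFormula.uniformizer s).Realize x ↔ v (s.realize x) = γ := by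
  refine Formula.realize_rel₁.trans ?_
  subst h
  rfl

theorem realize_integral (s : LVR.Term α) :
    (LVRFormula.integral s).Realize x ↔ v (s.realize x) ≤ 1 := by
  rw [LVRFormula.integral, h.realize_dvd, h.realize_one, map_one]

theorem realize_small (s : LVR.Term α) :
    (LVRFormula.small s).Realize x ↔ v (s.realize x) < 1 := by
  rw [LVRFormula.small, Formula.realize_not, h.realize_dvd, h.realize_one, map_one, not_le]

end IsValuedStructure

namespace LVRSentence

open LVRTerm LVRFormula

/-- Elements of `N` are uniformizers. -/
noncomputable def uniformizer : LVR.Sentence :=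
  Formula.iAlls (Fin 2) ((LVRFormula.uniformizer (Term.var (Sum.inr 0))).imp
    ((Term.equal (Term.var (Sum.inr 0)) zero).not ⊓ (small (Term.var (Sum.inr 0)) ⊓
      (small (Term.var (Sum.inr 1))).imp (dvd (Term.var (Sum.inr 0)) (Term.var (Sum.inr 1))))))

/-- The natural number `n` is a unit. -/
def unit (n : ℕ) : LVR.Sentence := dvd (natCast n) one

/-- Hensel's lemma for a polynomial with `n` coefficients. -/
noncomputable def hensel (n : ℕ) : LVR.Sentence :=
  Formula.iAlls (Option (Fin n))
    ((Formula.iInf fun i => small (Term.var (Sum.inr (some i)))).imp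
      ((integral (Term.var (Sum.inr none))).imp
        (Formula.iExs Unit (integral (Term.var (Sum.inr ())) ⊓
          Term.equal (add (add (Term.var (Sum.inl (Sum.inr none))) (Term.var (Sum.inr ())))
            (mul (pow (Term.var (Sum.inr ())) 2)
              (poly (Term.var (Sum.inr ())) n fun i =>
                Term.var (Sum.inl (Sum.inr (some i)))))) zero))))

/-- Monic polynomials of degree `n` have a root in the residue field. -/
noncomputable def residue (n : ℕ) : LVR.Sentence :=
  Formula.iAlls (Fin n)
    ((Formula.iInf fun i => integral (Term.var (Sum.inr i))).imp
      (Formula.iExs Unit (integral (Term.var (Sum.inr ())) ⊓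
        small (add (pow (Term.var (Sum.inr ())) n)
          (poly (Term.var (Sum.inr ())) n fun i => Term.var (Sum.inl (Sum.inr i)))))))

/-- The value group is an elementary extension of `ℤ`. -/
noncomputable def div (n : ℕ) : LVR.Sentence :=
  Formula.iAlls (Fin 2) ((LVRFormula.uniformizer (Term.var (Sum.inr 0))).imp
    ((Term.equal (Term.var (Sum.inr 1)) zero).not.imp
      (Formula.iExs Unit (Formula.iSup fun i : Fin n =>
        dvd (Term.var (Sum.inl (Sum.inr 1)))
          (mul (pow (Term.var (Sum.inl (Sum.inr 0))) i) (pow (Term.var (Sum.inr ())) n)) ⊓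
        dvd (mul (pow (Term.var (Sum.inl (Sum.inr 0))) i) (pow (Term.var (Sum.inr ())) n))
          (Term.var (Sum.inl (Sum.inr 1)))))))

end LVRSentence

namespace IsValuedStructure

variable (h : IsValuedStructure v γ)
include h

theorem realize_uniformizer_sentence : K ⊨ LVRSentence.uniformizer ↔
    ∀ t x : K, v t = γ → t ≠ 0 ∧ v t < 1 ∧ (v x < 1 → v x ≤ v t) := by
  rw [Sentence.Realize, LVRSentence.uniformizer, Formula.realize_iAlls]
  simp only [Formula.realize_imp, Formula.realize_inf, Formula.realize_not, h.realize_small,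
    h.realize_uniformizer, h.realize_dvd, Formula.realize_equal, h.realize_zero, Term.realize_var,
    Sum.elim_inr]
  exact ⟨fun H t x => H ![t, x], fun H f => H _ _⟩

theorem realize_unit_sentence (n : ℕ) : K ⊨ LVRSentence.unit n ↔ v (n : K) = 1 := by
  rw [Sentence.Realize, LVRSentence.unit, h.realize_dvd, h.realize_one, h.realize_natCast, map_one]
  exact ⟨fun H => (val_natCast_le_one n).antisymm H, fun H => H.ge⟩

theorem realize_hensel_sentence (n : ℕ) : K ⊨ LVRSentence.hensel n ↔
    ∀ f : Option (Fin n) → K, (∀ i, v (f (some i)) < 1) → v (f none) ≤ 1 →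
      ∃ y, v y ≤ 1 ∧ f none + y + y ^ 2 * ∑ i, f (some i) * y ^ (i : ℕ) = 0 := by
  rw [Sentence.Realize, LVRSentence.hensel, Formula.realize_iAlls]
  simp only [Formula.realize_imp, Formula.realize_inf, h.realize_small, Formula.realize_iInf,
    Formula.realize_iExs, h.realize_integral, Formula.realize_equal, h.realize_zero,
    h.realize_add, h.realize_mul, h.realize_pow, h.realize_poly, Term.realize_var,
    Sum.elim_inr, Sum.elim_inl]
  refine forall_congr' fun f => imp_congr_right fun _ => imp_congr_right fun _ =>
    ⟨fun ⟨y, H⟩ => ⟨y (), H⟩, fun ⟨y, H⟩ => ⟨fun _ => y, H⟩⟩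

theorem realize_residue_sentence (n : ℕ) : K ⊨ LVRSentence.residue n ↔
    ∀ f : Fin n → K, (∀ i, v (f i) ≤ 1) →
      ∃ y, v y ≤ 1 ∧ v (y ^ n + ∑ i, f i * y ^ (i : ℕ)) < 1 := by
  rw [Sentence.Realize, LVRSentence.residue, Formula.realize_iAlls]
  simp only [Formula.realize_imp, Formula.realize_inf, h.realize_small, Formula.realize_iInf,
    Formula.realize_iExs, h.realize_integral,
    h.realize_add, h.realize_pow, h.realize_poly, Term.realize_var,
    Sum.elim_inr, Sum.elim_inl]
  refine forall_congr' fun f => imp_congr_right fun _ =>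
    ⟨fun ⟨y, H⟩ => ⟨y (), H⟩, fun ⟨y, H⟩ => ⟨fun _ => y, H⟩⟩

theorem realize_div_sentence (n : ℕ) : K ⊨ LVRSentence.div n ↔
    ∀ t x : K, v t = γ → x ≠ 0 → ∃ y, ∃ i : Fin n, v x = v (t ^ (i : ℕ) * y ^ n) := by
  rw [Sentence.Realize, LVRSentence.div, Formula.realize_iAlls]
  simp only [Formula.realize_imp, Formula.realize_inf, Formula.realize_not, h.realize_dvd,
    Formula.realize_iSup, h.realize_uniformizer, Formula.realize_equal, h.realize_zero,
    Formula.realize_iExs, h.realize_mul, h.realize_pow, Term.realize_var,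
    Sum.elim_inr, Sum.elim_inl, ← le_antisymm_iff]
  refine ⟨fun H t x h1 h2 => ?_, fun H f h1 h2 => ?_⟩
  · obtain ⟨y, i, hy⟩ := H ![t, x] h1 h2
    exact ⟨y (), i, hy.symm⟩
  · obtain ⟨y, i, hy⟩ := H (f 0) (f 1) h1 h2
    exact ⟨fun _ => y, i, hy.symm⟩

end IsValuedStructure

theorem IsT.of_elementarilyEquivalent {L : Type*} [Field L] [LVR.Structure L] {Γ' : Type*}
    [LinearOrderedCommGroupWithZero Γ'] {w : Valuation L Γ'} {t : K} {s : L}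
    (hv : IsValuedStructure v (v t)) (hw : IsValuedStructure w (w s)) (ht : IsT v t)
    (hKL : K ≅[LVR] L) : IsT w s := by
  have key : ∀ φ : LVR.Sentence, K ⊨ φ ↔ L ⊨ φ := elementarilyEquivalent_iff.1 hKL
  have hunif := (hw.realize_uniformizer_sentence.1 ((key _).1
    (hv.realize_uniformizer_sentence.2 fun t' x ht' =>
      ⟨(ht.congr ht'.symm).ne_zero, (ht.congr ht'.symm).lt_one,
        (ht.congr ht'.symm).le_of_lt_one x⟩))) s
  refine ⟨(hunif 0 rfl).1, (hunif 0 rfl).2.1, fun x => (hunif x rfl).2.2, fun n hn =>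
    (hw.realize_unit_sentence n).1 ((key _).1 ((hv.realize_unit_sentence n).2 (ht.natCast n hn))),
    fun g hg a ha => ?_, fun p hp h0 hpi => ?_, fun n hn x hx => ?_⟩
  · have := (hw.realize_hensel_sentence (g.natDegree + 1)).1 ((key _).1
      ((hv.realize_hensel_sentence _).2 fun f hf hf0 => by
        obtain ⟨y, hy, hy'⟩ := ht.hensel (∑ i, C (f (some i)) * X ^ (i : ℕ)) (fun i => by
          rw [finsetSum_coeff]
          refine v.map_sum_lt one_ne_zero fun j _ => ?_
          rw [coeff_C_mul, coeff_X_pow]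
          split_ifs
          · simpa using hf j
          · simp) (f none) hf0
        exact ⟨y, hy, by simpa [eval_finsetSum] using hy'⟩))
      (fun o => o.elim a fun i => g.coeff i) (fun i => hg i) ha
    obtain ⟨y, hy, hy'⟩ := this
    refine ⟨y, hy, ?_⟩
    rw [eval_eq_sum_range, ← Fin.sum_univ_eq_sum_range (fun i => g.coeff i * y ^ i)]
    exact hy'
  · have := (hw.realize_residue_sentence p.natDegree).1 ((key _).1
      ((hv.realize_residue_sentence _).2 fun f hf => by
        have hdeg : (∑ i, C (f i) * X ^ (i : ℕ) : K[X]).degree < (p.natDegree : WithBot ℕ) :=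
          degree_sum_fin_lt f
        obtain ⟨y, hy, hy'⟩ := ht.residue (X ^ p.natDegree + ∑ i, C (f i) * X ^ (i : ℕ))
          (monic_X_pow_add hdeg)
          (by rw [natDegree_add_eq_left_of_degree_lt (by rwa [degree_X_pow]), natDegree_X_pow]
              exact h0) (fun i => by
          rw [coeff_add, finsetSum_coeff]
          refine v.map_add_le ?_ (v.map_sum_le fun j _ => ?_)
          · rw [coeff_X_pow]
            split_ifs <;> simp
          rw [coeff_C_mul, coeff_X_pow]
          split_ifs
          · simpa using hf j
          · simp)
        exact ⟨y, hy, by simpa [eval_finsetSum] using hy'⟩))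
      (fun i => p.coeff i) (fun i => hpi i)
    obtain ⟨y, hy, hy'⟩ := this
    refine ⟨y, hy, ?_⟩
    rw [eval_eq_sum_range, Finset.sum_range_succ, hp.coeff_natDegree, one_mul, add_comm,
      ← Fin.sum_univ_eq_sum_range (fun i => p.coeff i * y ^ i)]
    exact hy'
  · obtain ⟨y, i, hy⟩ := (hw.realize_div_sentence n).1 ((key _).1
      ((hv.realize_div_sentence n).2 fun t' x ht' hx => by
        obtain ⟨i, hi, y, hy⟩ := (ht.congr ht'.symm).div n hn x hx
        exact ⟨y, ⟨i, hi⟩, hy⟩)) s x rfl hx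
    exact ⟨i, i.2, y, hy⟩

end Axioms

section Ultrapower

open Language Filter

variable {ι : Type*} (U : Ultrafilter ι) {A : Type*} [Field A] {Γ : Type*}
  [LinearOrderedCommGroupWithZero Γ] (v : Valuation A Γ)

/-- The valuation ring of the ultrapower of a valued field. -/
def Ultrapower.valuationSubring : ValuationSubring (Germ (U : Filter ι) A) where
  carrier := {x | x.LiftPred fun a => v a ≤ 1}
  mul_mem' {x y} := by
    induction x, y using Germ.inductionOn₂ with
    | _ f g =>
      intro (hf : ∀ᶠ J in U, v (f J) ≤ 1) (hg : ∀ᶠ J in U, v (g J) ≤ 1)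
      exact hf.mp (hg.mono fun J hg hf => (v.map_mul _ _).trans_le (mul_le_one' hf hg))
  one_mem' := Eventually.of_forall fun _ => v.map_one.le
  add_mem' {x y} := by
    induction x, y using Germ.inductionOn₂ with
    | _ f g =>
      intro (hf : ∀ᶠ J in U, v (f J) ≤ 1) (hg : ∀ᶠ J in U, v (g J) ≤ 1)
      exact hf.mp (hg.mono fun J hg hf =>
        v.map_add_le hf hg)
  zero_mem' := Eventually.of_forall fun _ => v.map_zero.le.trans zero_le_one
  neg_mem' {x} := by
    induction x using Germ.inductionOn with
    | _ f =>
      intro (hf : ∀ᶠ J in U, v (f J) ≤ 1)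
      exact hf.mono fun J hf => (v.map_neg _).le.trans hf
  mem_or_inv_mem' x := by
    induction x using Germ.inductionOn with
    | _ f =>
      refine (Ultrafilter.eventually_or.1 (Eventually.of_forall fun J => ?_) :
        (∀ᶠ J in (U : Filter ι), v (f J) ≤ 1) ∨ ∀ᶠ J in (U : Filter ι), v (f J)⁻¹ ≤ 1)
      exact v.valuationSubring.mem_or_inv_mem (f J)

theorem Ultrapower.mem_valuationSubring {f : ι → A} :
    (f : Germ (U : Filter ι) A) ∈ valuationSubring U v ↔ ∀ᶠ J in U, v (f J) ≤ 1 := Iff.rfl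

theorem Ultrapower.valuation_le_iff (f g : ι → A) :
    (valuationSubring U v).valuation (f : Germ (U : Filter ι) A) ≤
      (valuationSubring U v).valuation (g : Germ (U : Filter ι) A) ↔
      ∀ᶠ J in U, v (f J) ≤ v (g J) := by
  rw [ValuationSubring.valuation_le_iff]
  constructor
  · rintro ⟨⟨a, ha⟩, hfg⟩
    induction a using Germ.inductionOn with
    | _ a =>
      rw [mem_valuationSubring] at ha
      refine ha.mp ((Germ.coe_eq.1 hfg).mono fun J h ha => ?_)
      rw [← h]
      exact (v.map_mul _ _).trans_le (mul_le_of_le_one_left' ha)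
  · intro h
    refine ⟨⟨((f / g : ι → A) : Germ (U : Filter ι) A), ?_⟩, ?_⟩
    · rw [mem_valuationSubring]
      refine h.mono fun J h => ?_
      rw [Pi.div_apply, map_div₀]
      exact div_le_one_of_le₀ h zero_le
    · refine Germ.coe_eq.2 (h.mono fun J h => ?_)
      refine div_mul_cancel_of_imp fun h0 => ?_
      rw [h0, map_zero, le_zero_iff, _root_.map_eq_zero] at h
      exact h

theorem Ultrapower.valuation_eq_iff (f g : ι → A) :
    (valuationSubring U v).valuation (f : Germ (U : Filter ι) A) =
      (valuationSubring U v).valuation (g : Germ (U : Filter ι) A) ↔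
      ∀ᶠ J in U, v (f J) = v (g J) := by
  simp only [le_antisymm_iff, valuation_le_iff, eventually_and]

instance Ultrapower.structure [LVR.Structure A] : LVR.Structure (Germ (U : Filter ι) A) :=
  inferInstanceAs (LVR.Structure ((U : Filter ι).Product fun _ => A))

theorem Ultrapower.realize_const [LVR.Structure A] {β : Type*} {n : ℕ}
    (φ : LVR.BoundedFormula β n) (x : β → A) (y : Fin n → A) :
    φ.Realize (fun i => (↑(x i) : Germ (U : Filter ι) A)) (fun i => ↑(y i)) ↔ φ.Realize x y :=
  (Ultraproduct.boundedFormula_realize_cast (u := U) (M := fun _ => A) φ (fun i _ => x i)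
    fun i _ => y i).trans eventually_const

theorem Ultrapower.isValuedStructure [LVR.Structure A] {t : A} (h : IsValuedStructure v (v t)) :
    IsValuedStructure (valuationSubring U v).valuation
      ((valuationSubring U v).valuation (↑t : Germ (U : Filter ι) A)) := by
  have hfun {n : ℕ} (f : LVRFunc n) (x : Fin n → ι → A) :
      (Structure.funMap (L := LVR) f fun i => (x i : Germ (U : Filter ι) A)) =
        ((fun J => LVRfun A f fun i => x i J : ι → A) : Germ (U : Filter ι) A) := by
    refine (Ultraproduct.funMap_cast (u := U) (M := fun _ => A) (L := LVR) f x).trans ?_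
    subst h; rfl
  have hrel {n : ℕ} (r : LVRRel n) (x : Fin n → ι → A) :
      (Structure.RelMap (L := LVR) r fun i => (x i : Germ (U : Filter ι) A)) ↔
        ∀ᶠ J in U, LVRrel v (v t) r fun i => x i J := by
    subst h
    let _ := valuedStructure v (v t)
    let _ := Ultraproduct.setoidPrestructure (fun _ : ι => A) U (L := LVR)
    exact (relMap_quotient_mk' (s := (U : Filter ι).productSetoid fun _ => A) (L := LVR) r x)
  have hlift {n : ℕ} (x : Fin n → Germ (U : Filter ι) A) : ∃ y : Fin n → ι → A,
      x = fun i => (y i : Germ (U : Filter ι) A) := by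
    choose y hy using fun i => Quotient.exists_rep (x i)
    exact ⟨y, funext fun i => (hy i).symm⟩
  refine Structure.ext ?_ ?_
  · funext n f x
    obtain ⟨x, rfl⟩ := hlift x
    refine (hfun f x).trans ?_
    cases f <;> rfl
  · funext n r x
    obtain ⟨x, rfl⟩ := hlift x
    refine propext ((hrel r x).trans ?_)
    cases r with
    | dvd => exact (valuation_le_iff U v _ _).symm
    | N => exact (valuation_eq_iff U v _ _).symm
    | pow m =>
      change (∀ᶠ J in U, ∃ y, x 0 J = y ^ (m : ℕ)) ↔
        ∃ y : Germ (U : Filter ι) A, (x 0 : Germ (U : Filter ι) A) = y ^ (m : ℕ)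
      constructor
      · intro h
        obtain ⟨y, hy⟩ := h.choice
        exact ⟨(y : Germ (U : Filter ι) A), Germ.coe_eq.2 hy⟩
      · rintro ⟨y, hy⟩
        induction y using Germ.inductionOn with
        | _ y => exact (Germ.coe_eq.1 hy).mono fun J h => ⟨_, h⟩

instance Ultrapower.algebra : Algebra A (Germ (U : Filter ι) A) :=
  ((Germ.coeRingHom (U : Filter ι)).comp (Pi.constRingHom ι A)).toAlgebra

/-- The presentation of an ultrapower as a power modulo an ultrafilter. -/
noncomputable def Ultrapower.powerMap :
    PowerMap v
      (valuationSubring (Ultrafilter.of (atTop : Filter (Finset (Set A)))) v).valuation where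
  U := Ultrafilter.of (atTop : Filter (Finset (Set A)))
  neBot := Ultrafilter.neBot _
  le := Ultrafilter.of_le _
  proj := Germ.coeRingHom _
  proj_const _ := rfl
  le_iff f g := valuation_le_iff _ v f g

end Ultrapower

section Transfer

open Language

theorem IsValuedStructure.of_isEquiv {K : Type*} [Field K] [LVR.Structure K] {Γ Γ' : Type*}
    [LinearOrderedCommGroupWithZero Γ] [LinearOrderedCommGroupWithZero Γ'] {v : Valuation K Γ}
    {w : Valuation K Γ'} {t : K} (h : IsValuedStructure v (v t)) (hvw : v.IsEquiv w) :
    IsValuedStructure w (w t) := by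
  refine Eq.trans h (Structure.ext rfl ?_)
  funext n r x
  cases r with
  | dvd => exact propext (hvw _ _)
  | N => exact propext (hvw.eq_iff)
  | pow m => rfl

theorem IsT.of_isEquiv {K : Type*} [Field K] {Γ Γ' : Type*}
    [LinearOrderedCommGroupWithZero Γ] [LinearOrderedCommGroupWithZero Γ'] {v : Valuation K Γ}
    {w : Valuation K Γ'} {t : K} (h : IsT v t) (hvw : v.IsEquiv w) : IsT w t := by
  let _ := valuedStructure v (v t)
  have hv : IsValuedStructure v (v t) := rfl
  exact IsT.of_elementarilyEquivalent hv (hv.of_isEquiv hvw) h rfl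

section Atomic

variable {A B : Type*} [Field A] [Field B] [Algebra A B] [LVR.Structure A] [LVR.Structure B]
  {Γ : Type*} [LinearOrderedCommGroupWithZero Γ] {v : Valuation B Γ} {γ : Γ}
  (hA : IsValuedStructure (v.comap (algebraMap A B)) γ) (hB : IsValuedStructure v γ)
include hA hB

theorem IsValuedStructure.realize_algebraMap {β : Type*} (x : β → A) (s : LVR.Term β) :
    s.realize (algebraMap A B ∘ x) = algebraMap A B (s.realize x) := by
  subst hA hB
  induction s with
  | var => rfl
  | @func n f s ih =>
    cases f with
    | zero => exact (map_zero _).symm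
    | one => exact (map_one _).symm
    | add => exact (congrArg₂ (· + ·) (ih 0) (ih 1)).trans (map_add _ _ _).symm
    | mul => exact (congrArg₂ (· * ·) (ih 0) (ih 1)).trans (map_mul _ _ _).symm

theorem IsValuedStructure.relMap_algebraMap
    (hpow : ∀ (x : A) (y : B) (n : ℕ+), algebraMap A B x = y ^ (n : ℕ) → ∃ z : A, x = z ^ (n : ℕ))
    {n : ℕ} (r : LVR.Relations n) (x : Fin n → A) :
    Structure.RelMap r (algebraMap A B ∘ x) ↔ Structure.RelMap r x := by
  subst hA hB
  cases r with
  | dvd => exact Iff.rfl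
  | N => exact Iff.rfl
  | pow m =>
    refine ⟨fun ⟨y, hy⟩ => hpow _ _ _ hy, fun ⟨y, hy⟩ => ⟨algebraMap A B y, ?_⟩⟩
    rw [← map_pow, ← hy]
    rfl

end Atomic

/-- Henselian fields of the type considered here are model complete in the language `LVR`. -/
theorem IsT.realize_algebraMap_iff.{u, w} {β : Type w} {n : ℕ} (φ : LVR.BoundedFormula β n) :
    ∀ {A B : Type u} [Field A] [Field B] [Algebra A B] [LVR.Structure A] [LVR.Structure B]
      {Γ : Type u} [LinearOrderedCommGroupWithZero Γ] {v : Valuation B Γ} {t : A}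
      (_ : IsT (v.comap (algebraMap A B)) t) (_ : IsT v (algebraMap A B t))
      (_ : IsValuedStructure (v.comap (algebraMap A B)) (v (algebraMap A B t)))
      (_ : IsValuedStructure v (v (algebraMap A B t))) (x : β → A) (y : Fin n → A),
      φ.Realize (algebraMap A B ∘ x) (algebraMap A B ∘ y) ↔ φ.Realize x y := by
  induction φ with
  | falsum => intros; rfl
  | equal s₁ s₂ =>
    intro A B _ _ _ _ _ Γ _ v t hA hB hA' hB' x y
    simp only [BoundedFormula.Realize, ← Sum.comp_elim, hA'.realize_algebraMap hB']
    exact (algebraMap A B).injective.eq_iff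
  | rel r s =>
    intro A B _ _ _ _ _ Γ _ v t hA hB hA' hB' x y
    simp only [BoundedFormula.Realize, ← Sum.comp_elim, hA'.realize_algebraMap hB']
    refine hA'.relMap_algebraMap hB' (fun a b n hab => ?_) r _
    obtain ⟨c, hc⟩ := IsT.mem_of_isIntegral hA hB (x := b)
      (IsIntegral.of_pow n.pos (hab ▸ isIntegral_algebraMap))
    refine ⟨c, (algebraMap A B).injective ?_⟩
    rw [hab, map_pow, hc]
  | imp _ _ ih₁ ih₂ =>
    intro A B _ _ _ _ _ Γ _ v t hA hB hA' hB' x y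
    exact imp_congr (ih₁ hA hB hA' hB' x y) (ih₂ hA hB hA' hB' x y)
  | all φ ih =>
    intro A B _ _ _ _ _ Γ _ v t hA hB hA' hB' x y
    refine ⟨fun h a => (ih hA hB hA' hB' x _).1 ?_, fun h b => ?_⟩
    · rw [Fin.comp_snoc]
      exact h _
    let U : Ultrafilter (Finset (Set A)) := Ultrafilter.of Filter.atTop
    let w := (Ultrapower.valuationSubring U (v.comap (algebraMap A B))).valuation
    let P : PowerMap (v.comap (algebraMap A B)) w := Ultrapower.powerMap _
    have hM' : IsValuedStructure w (w (algebraMap A _ t)) :=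
      Ultrapower.isValuedStructure U _ hA'
    have hel : A ≅[LVR] Filter.Germ (U : Filter (Finset (Set A))) A := by
      refine elementarilyEquivalent_iff.2 fun φ => ?_
      refine (Ultrapower.realize_const U φ _ _).symm.trans (iff_of_eq ?_)
      congr 1 <;> exact Subsingleton.elim _ _
    have hM : IsT w (algebraMap A _ t) := IsT.of_elementarilyEquivalent hA' hM' hA hel
    obtain ⟨C, hbC, hC, σ, hσ⟩ := P.exists_embedding hA hB hM b
    let _ : Algebra C (Filter.Germ (U : Filter (Finset (Set A))) A) := σ.toRingHom.toAlgebra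
    let tC : C := algebraMap A C t
    let _ : LVR.Structure C := valuedStructure (v.comap (algebraMap C B)) (v (algebraMap C B tC))
    have hσt : algebraMap C (Filter.Germ (U : Filter (Finset (Set A))) A) tC = algebraMap A _ t :=
      σ.commutes t
    have hCT : IsT (v.comap (algebraMap C B)) tC :=
      IsT.of_algebraicallyClosed hB fun z hz => ⟨⟨z, hC z hz⟩, rfl⟩
    have hCS : IsValuedStructure (v.comap (algebraMap C B)) (v (algebraMap C B tC)) := rfl
    have heq : (v.comap (algebraMap C B)).IsEquiv
      (w.comap (algebraMap C (Filter.Germ (U : Filter (Finset (Set A))) A))) := hσ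
    have h1 := (ih hCT hB hCS hB' (algebraMap A C ∘ x)
      (Fin.snoc (algebraMap A C ∘ y) ⟨b, hbC⟩))
    have h2 := (ih (v := w) (t := tC) (hCT.of_isEquiv heq) (hσt.symm ▸ hM)
      (IsValuedStructure.of_isEquiv hCS heq) (hσt.symm ▸ hM') (algebraMap A C ∘ x)
      (Fin.snoc (algebraMap A C ∘ y) ⟨b, hbC⟩))
    rw [Fin.comp_snoc] at h1 h2
    refine h1.2 (h2.1 ?_)
    have h3 := (Ultrapower.realize_const U φ.all x y).2 h (algebraMap C _ ⟨b, hbC⟩)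
    convert h3 using 2
    · exact σ.commutes (x _)
    · exact funext fun i => σ.commutes (y i)

end Transfer

section Laurent

open Polynomial WithZero
open scoped LaurentSeries

variable {F : Type*} [Field F]

theorem PowerSeries.exists_fixedPoint (T : PowerSeries F → PowerSeries F)
    (hT : ∀ n y z, PowerSeries.X ^ n ∣ y - z → PowerSeries.X ^ (n + 1) ∣ T y - T z) :
    ∃ y, T y = y := by
  have hcoeff {n : ℕ} {y z : PowerSeries F} :
      PowerSeries.X ^ n ∣ y - z ↔ ∀ m < n, PowerSeries.coeff m y = PowerSeries.coeff m z := by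
    simp only [PowerSeries.X_pow_dvd_iff, map_sub, sub_eq_zero]
  have hstep (n k : ℕ) : PowerSeries.X ^ n ∣ T^[n + k] 0 - T^[n] 0 := by
    induction n with
    | zero => simp
    | succ n ih =>
      rw [Nat.add_right_comm, Function.iterate_succ_apply', Function.iterate_succ_apply']
      exact hT _ _ _ ih
  let y : PowerSeries F := PowerSeries.mk fun n => PowerSeries.coeff n (T^[n + 1] 0)
  have hy (n : ℕ) : PowerSeries.X ^ n ∣ y - T^[n] 0 := by
    refine hcoeff.2 fun m hm => ?_
    obtain ⟨k, rfl⟩ := Nat.exists_eq_add_of_le (Nat.succ_le_of_lt hm)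
    rw [PowerSeries.coeff_mk]
    exact (hcoeff.1 (hstep (m + 1) k) m m.lt_succ_self).symm
  refine ⟨y, PowerSeries.ext fun n => ?_⟩
  have h1 := hcoeff.1 (hT _ _ _ (hy n)) n n.lt_succ_self
  have h2 := hcoeff.1 (hy (n + 1)) n n.lt_succ_self
  rw [h1, h2, Function.iterate_succ_apply']

namespace LaurentSeries

theorem valuation_coe_lt_one_iff {f : PowerSeries F} :
    Valued.v (f : F⸨X⸩) < (1 : ℤᵐ⁰) ↔ PowerSeries.constantCoeff f = 0 := by
  constructor
  · intro h
    have h1 : Valued.v (f : F⸨X⸩) ≤ exp (-(1 : ℕ) : ℤ) := by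
      by_cases h0 : Valued.v (f : F⸨X⸩) = 0
      · rw [h0]; exact zero_le
      rw [← exp_log h0, ← exp_zero, exp_lt_exp] at h
      rw [← exp_log h0, exp_le_exp]
      push_cast
      omega
    rw [← PowerSeries.coeff_zero_eq_constantCoeff_apply]
    exact (intValuation_le_iff_coeff_lt_eq_zero F f).1 h1 0 one_pos
  · intro h
    refine ((intValuation_le_iff_coeff_lt_eq_zero (d := 1) F f).2 fun n hn => ?_).trans_lt ?_
    · rw [Nat.lt_one_iff.1 hn]; exact (PowerSeries.coeff_zero_eq_constantCoeff_apply f).trans h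
    · rw [← exp_zero, exp_lt_exp]; simp

theorem valuation_le_exp_neg_one {x : F⸨X⸩} (h : Valued.v x < (1 : ℤᵐ⁰)) :
    Valued.v x ≤ exp (-1 : ℤ) := by
  by_cases h0 : Valued.v x = 0
  · rw [h0]; exact zero_le
  rw [← exp_log h0, ← exp_zero, exp_lt_exp] at h
  rw [← exp_log h0, exp_le_exp]
  omega

theorem isT [CharZero F] [IsAlgClosed F] :
    IsT (Valued.v : Valuation F⸨X⸩ ℤᵐ⁰) (HahnSeries.single 1 1) := by
  have hvt : Valued.v (HahnSeries.single 1 1 : F⸨X⸩) = exp (-1 : ℤ) := valuation_single_zpow F 1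
  refine ⟨by simp, ?_, fun x hx => ?_, fun n hn => ?_, fun g hg a ha => ?_,
    fun p hp h0 hpi => ?_, fun n hn x hx => ?_⟩
  · rw [hvt, ← exp_zero, exp_lt_exp]; simp
  · rw [hvt]; exact valuation_le_exp_neg_one hx
  · refine (val_natCast_le_one n).antisymm (not_lt.1 fun h => ?_)
    rw [← map_natCast (HahnSeries.ofPowerSeries ℤ F), valuation_coe_lt_one_iff, map_natCast,
      Nat.cast_eq_zero] at h
    exact hn h
  · have hint (f : PowerSeries F) : Valued.v (f : F⸨X⸩) ≤ (1 : ℤᵐ⁰) :=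
      (val_le_one_iff_eq_coe F _).2 ⟨f, rfl⟩
    have hex (f : PowerSeries F) : ∃ f' : PowerSeries F,
        (f' : F⸨X⸩) = -(a + (f : F⸨X⸩) ^ 2 * g.eval (f : F⸨X⸩)) := by
      rw [← val_le_one_iff_eq_coe, Valuation.map_neg]
      refine Valuation.map_add_le _ ha ?_
      rw [map_mul, map_pow]
      exact mul_le_one' (pow_le_one' (hint f) 2) (val_eval_le_one (fun i => (hg i).le) (hint f))
    choose T hT using hex
    obtain ⟨y, hy⟩ := PowerSeries.exists_fixedPoint T fun n y z hyz => by
      rw [PowerSeries.X_pow_dvd_iff, ← intValuation_le_iff_coeff_lt_eq_zero, PowerSeries.coe_sub]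
        at hyz ⊢
      have h1 : (T y : F⸨X⸩) - T z = (X ^ 2 * g).eval (z : F⸨X⸩) - (X ^ 2 * g).eval (y : F⸨X⸩) := by
        rw [hT, hT, eval_mul, eval_mul, eval_pow, eval_pow, eval_X, eval_X]; ring
      rw [h1, Valuation.map_sub_swap, eval_eq_sum_range, eval_eq_sum_range,
        ← Finset.sum_sub_distrib]
      refine Valuation.map_sum_le _ fun i _ => ?_
      rw [← mul_sub, map_mul, ← geom_sum₂_mul, map_mul, Nat.cast_succ, neg_add, add_comm, exp_add]
      refine mul_le_mul' (valuation_le_exp_neg_one ?_) ?_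
      · rw [coeff_X_pow_mul']
        split_ifs
        · exact hg _
        · simp
      · refine (mul_le_of_le_one_left' (Valuation.map_sum_le _ fun j _ => ?_)).trans hyz
        rw [map_mul, map_pow, map_pow]
        exact mul_le_one' (pow_le_one' (hint _) _) (pow_le_one' (hint _) _)
    refine ⟨y, hint y, ?_⟩
    have := hT y
    rw [hy] at this
    linear_combination this
  · obtain ⟨q, hq, hqd, hqm⟩ := lifts_and_natDegree_eq_and_monic
      (f := HahnSeries.ofPowerSeries ℤ F) (p := p)
      ((lifts_iff_coeff_lifts p).2 fun n => (val_le_one_iff_eq_coe F _).1 (hpi n)) hp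
    obtain ⟨c, hc⟩ := IsAlgClosed.exists_root (q.map PowerSeries.constantCoeff) (by
      rw [hqm.degree_map, degree_eq_natDegree hqm.ne_zero, hqd]
      exact_mod_cast h0.ne')
    refine ⟨(PowerSeries.C c : PowerSeries F), (val_le_one_iff_eq_coe F _).2 ⟨_, rfl⟩, ?_⟩
    rw [← hq, eval_map, eval₂_at_apply, valuation_coe_lt_one_iff, ← eval₂_hom,
      ← eval_map, PowerSeries.constantCoeff_C]
    exact hc
  · have hvx : Valued.v x ≠ (0 : ℤᵐ⁰) := (Valuation.ne_zero_iff _).2 hx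
    set m := log (Valued.v x : ℤᵐ⁰) with hm
    have hn' : (0 : ℤ) < n := by exact_mod_cast hn
    refine ⟨((-m) % n).toNat, by have := Int.emod_lt_of_pos (-m) hn'; omega,
      HahnSeries.single ((-m) / n) 1, ?_⟩
    rw [map_mul, map_pow, map_pow, hvt, valuation_single_zpow, ← exp_nsmul, ← exp_nsmul,
      ← exp_add, ← exp_log hvx, ← hm, exp_inj]
    simp only [nsmul_eq_mul, mul_neg, mul_one]
    rw [Int.toNat_of_nonneg (Int.emod_nonneg _ hn'.ne')]
    have := Int.emod_add_mul_ediv (-m) n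
    linarith

end LaurentSeries

end Laurent

section ResidueSubfield

open Polynomial IsLocalRing

variable {K : Type*} [Field K] {Γ : Type*} [LinearOrderedCommGroupWithZero Γ]
  {v : Valuation K Γ} (D : Subfield (ResidueField v.valuationSubring))

/-- The ring of integral elements whose residue lies in `D`. -/
def residuePreimage : Subring K :=
  (D.toSubring.comap (residue v.valuationSubring)).map v.valuationSubring.subtype

theorem mem_residuePreimage {x : K} :
    x ∈ residuePreimage D ↔ ∃ h : x ∈ v.valuationSubring, residue v.valuationSubring ⟨x, h⟩ ∈ D :=
  ⟨by rintro ⟨y, hy, rfl⟩; exact ⟨y.2, hy⟩, fun ⟨h, hx⟩ => ⟨⟨x, h⟩, hx, rfl⟩⟩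

theorem residue_eq_zero_iff_val_lt_one (x : v.valuationSubring) :
    residue v.valuationSubring x = 0 ↔ v (x : K) < 1 := by
  rw [residue_eq_zero_iff, ValuationSubring.valuation_lt_one_iff]
  exact (Valuation.isEquiv_valuation_valuationSubring v).lt_one_iff_lt_one.symm

variable {D}

theorem val_le_one_of_mem_residuePreimage {x : K} (hx : x ∈ residuePreimage D) : v x ≤ 1 :=
  ((mem_residuePreimage D).1 hx).1

theorem mem_residuePreimage_of_sub {x y : K} (hx : x ∈ residuePreimage D) (h : v (x - y) < 1) :
    y ∈ residuePreimage D := by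
  obtain ⟨h1, h2⟩ := (mem_residuePreimage D).1 hx
  have hy : y ∈ v.valuationSubring := by
    have := v.map_sub_le (show v x ≤ 1 from h1) h.le
    rwa [sub_sub_cancel] at this
  refine (mem_residuePreimage D).2 ⟨hy, ?_⟩
  have h3 := (residue_eq_zero_iff_val_lt_one (⟨x, h1⟩ - ⟨y, hy⟩ : v.valuationSubring)).2 h
  rw [map_sub, sub_eq_zero] at h3
  rwa [← h3]

theorem inv_mem_residuePreimage {x : K} (hx : x ∈ residuePreimage D) (h : v x = 1) :
    x⁻¹ ∈ residuePreimage D := by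
  obtain ⟨h1, h2⟩ := (mem_residuePreimage D).1 hx
  have hy : x⁻¹ ∈ v.valuationSubring := by
    change v x⁻¹ ≤ 1
    rw [map_inv₀, h, inv_one]
  have hx0 : x ≠ 0 := by rintro rfl; simp at h
  have h3 : residue v.valuationSubring ⟨x⁻¹, hy⟩ * residue v.valuationSubring ⟨x, h1⟩ = 1 := by
    rw [← map_mul, ← map_one (residue v.valuationSubring)]
    exact congrArg _ (Subtype.ext (inv_mul_cancel₀ hx0))
  refine (mem_residuePreimage D).2 ⟨hy, ?_⟩
  rw [eq_inv_of_mul_eq_one_left h3]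
  exact inv_mem h2

theorem mem_residuePreimage_of_isRoot [IsAlgClosed D] {p : K[X]}
    (hp : ∀ i, p.coeff i ∈ residuePreimage D) {j : ℕ} (hj : v (p.coeff j) = 1) {a : K}
    (ha : v a ≤ 1) (hpa : p.eval a = 0) : a ∈ residuePreimage D := by
  let S : Subring v.valuationSubring := D.toSubring.comap (residue v.valuationSubring)
  let ρ : S →+* D := ((residue v.valuationSubring).comp S.subtype).codRestrict D fun x => x.2
  obtain ⟨P, rfl⟩ := (lifts_iff_coeff_lifts (f := v.valuationSubring.subtype.comp S.subtype) p).2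
    fun i => by
      obtain ⟨y, hy, hyp⟩ := hp i
      exact ⟨⟨y, hy⟩, hyp⟩
  have h1 : eval₂ S.subtype (⟨a, ha⟩ : v.valuationSubring) P = 0 := by
    refine Subtype.ext ?_
    change v.valuationSubring.subtype _ = 0
    rw [hom_eval₂, ← eval_map]
    exact hpa
  have h2 : aeval (residue v.valuationSubring ⟨a, ha⟩) (P.map ρ) = 0 := by
    rw [aeval_def, eval₂_map]
    have := congrArg (residue v.valuationSubring) h1
    rw [hom_eval₂, map_zero] at this
    exact this
  have h3 : P.map ρ ≠ 0 := by
    intro h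
    have h4 : (P.map ρ).coeff j = 0 := by rw [h, coeff_zero]
    rw [coeff_map] at h4
    have h5 := (residue_eq_zero_iff_val_lt_one _).1 (congrArg Subtype.val h4)
    rw [coe_mapRingHom, coeff_map] at hj
    exact h5.ne hj
  have h6 : IsIntegral D (residue v.valuationSubring ⟨a, ha⟩) :=
    isAlgebraic_iff_isIntegral.1 ⟨_, h3, h2⟩
  obtain ⟨d, hd⟩ := minpoly.mem_range_of_degree_eq_one D _
    (IsAlgClosed.degree_eq_one_of_irreducible D (minpoly.irreducible h6))
  exact (mem_residuePreimage D).2 ⟨ha, hd ▸ d.2⟩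

end ResidueSubfield

section ResidueField

open Polynomial IsLocalRing

variable {K : Type*} [Field K] {Γ : Type*} [LinearOrderedCommGroupWithZero Γ]
  {v : Valuation K Γ} {D : Subfield (ResidueField v.valuationSubring)} {t : K}

theorem mem_residuePreimage_of_lt_one {x : K} (hx : v x < 1) : x ∈ residuePreimage D :=
  mem_residuePreimage_of_sub (zero_mem _) (by rwa [zero_sub, v.map_neg])

variable (D) in
/-- The integral elements of the subfield `E` have residue in `D`. -/
def ResiduesIn (E : Subfield K) : Prop := ∀ x ∈ E, v x ≤ 1 → x ∈ residuePreimage D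

theorem IsT.exists_eq_pow_mul_of_mem_closure (ht : IsT v t) {x : K}
    (hx : x ∈ Subring.closure {t}) :
    x = 0 ∨ ∃ i : ℕ, ∃ r ∈ residuePreimage D, v r = 1 ∧ x = t ^ i * r := by
  obtain ⟨p, rfl⟩ : ∃ p : ℤ[X], aeval t p = x := by
    have : x ∈ Algebra.adjoin ℤ {t} := by
      rw [Algebra.mem_adjoin_iff]
      exact Subring.closure_mono Set.subset_union_right hx
    rwa [Algebra.adjoin_singleton_eq_range_aeval] at this
  refine p.recOnHorner (Or.inl (map_zero _)) (fun q a hq ha ih => Or.inr ?_) fun q _ ih => ?_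
  · have hva : v (a : K) = 1 := by
      rcases Int.natAbs_eq a with h | h
      · rw [h, Int.cast_natCast]; exact ht.natCast _ (Int.natAbs_ne_zero.2 ha)
      · rw [h, Int.cast_neg, Int.cast_natCast, v.map_neg]
        exact ht.natCast _ (Int.natAbs_ne_zero.2 ha)
    have hvq : v (aeval t q) < 1 := by
      have h1 : q = q.divX * X := by
        conv_lhs => rw [← q.divX_mul_X_add, hq, map_zero, add_zero]
      rw [h1, map_mul, aeval_X, map_mul]
      refine mul_lt_of_le_one_of_lt ?_ ht.lt_one
      rw [← eval_map_algebraMap]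
      refine val_eval_le_one (fun i => ?_) ht.lt_one.le
      rw [coeff_map, algebraMap_int_eq, eq_intCast]
      rcases Int.natAbs_eq (q.divX.coeff i) with h | h
      · rw [h, Int.cast_natCast]; exact val_natCast_le_one _
      · rw [h, Int.cast_neg, Int.cast_natCast, v.map_neg]
        exact val_natCast_le_one _
    refine ⟨0, aeval t (q + C a), ?_, ?_, by rw [pow_zero, one_mul]⟩
    · refine mem_residuePreimage_of_sub (intCast_mem _ a) ?_
      rw [v.map_sub_swap]
      simpa using hvq
    · rw [map_add, aeval_C, algebraMap_int_eq, eq_intCast, ← hva]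
      refine v.map_add_eq_of_lt_right ?_
      rwa [hva]
  · rcases ih with h | ⟨i, r, hr, hvr, h⟩
    · exact Or.inl (by rw [map_mul, h, zero_mul])
    · exact Or.inr ⟨i + 1, r, hr, hvr, by rw [map_mul, h, aeval_X]; ring⟩

theorem IsT.residuesIn_closure (ht : IsT v t) : ResiduesIn D (Subfield.closure {t}) := by
  intro x hx hvx
  obtain ⟨y, hy, z, hz, rfl⟩ := Subfield.mem_closure_iff.1 hx
  rcases ht.exists_eq_pow_mul_of_mem_closure (D := D) hy with rfl | ⟨i, r, hr, hvr, rfl⟩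
  · rw [zero_div]; exact zero_mem _
  rcases ht.exists_eq_pow_mul_of_mem_closure (D := D) hz with rfl | ⟨j, s, hs, hvs, rfl⟩
  · rw [div_zero]; exact zero_mem _
  have hij : j ≤ i := by
    by_contra! h
    rw [map_div₀, map_mul, map_mul, hvr, hvs, mul_one, mul_one, map_pow, map_pow] at hvx
    have hpos : 0 < v t := v.pos_iff.2 ht.ne_zero
    rw [div_le_one₀ (pow_pos hpos j)] at hvx
    exact hvx.not_gt (pow_lt_pow_right_of_lt_one₀ hpos ht.lt_one h)
  obtain ⟨k, rfl⟩ := Nat.exists_eq_add_of_le hij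
  have : t ^ (j + k) * r / (t ^ j * s) = t ^ k * (r * s⁻¹) := by
    rw [pow_add, mul_assoc, mul_div_mul_left _ _ (pow_ne_zero _ ht.ne_zero), div_eq_mul_inv,
      mul_assoc]
  rw [this]
  exact mul_mem (pow_mem (mem_residuePreimage_of_lt_one ht.lt_one) _)
    (mul_mem hr (inv_mem_residuePreimage hs hvs))

theorem IsT.exists_maximal_residuesIn (ht : IsT v t) :
    ∃ E : Subfield K, t ∈ E ∧ Maximal (ResiduesIn D) E := by
  have hchain : ∀ c ⊆ {E : Subfield K | ResiduesIn D E}, IsChain (· ≤ ·) c → ∀ E ∈ c,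
      ∃ F ∈ {E : Subfield K | ResiduesIn D E}, ∀ E ∈ c, E ≤ F := by
    refine fun c hc hch E hE => ⟨sSup c, fun x hx hvx => ?_, fun F hF => le_sSup hF⟩
    obtain ⟨F, hF, hxF⟩ := (Subfield.mem_sSup_of_directedOn ⟨E, hE⟩ hch.directedOn).1 hx
    exact hc hF x hxF hvx
  obtain ⟨E, hE, hmax⟩ := zorn_le_nonempty₀ _ hchain (Subfield.closure {t}) ht.residuesIn_closure
  exact ⟨E, hE (Subfield.subset_closure rfl), hmax⟩

theorem exists_normalized {E : Type*} [Field E] (w : Valuation E Γ) {q : E[X]} (hq : q ≠ 0) :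
    ∃ c : E, c ≠ 0 ∧ (∀ i, w (c * q.coeff i) ≤ 1) ∧ ∃ j, c * q.coeff j = 1 := by
  obtain ⟨j, hj, hmax⟩ := q.support.exists_max_image (fun i => w (q.coeff i))
    (support_nonempty.2 hq)
  have hj0 : q.coeff j ≠ 0 := mem_support_iff.1 hj
  refine ⟨(q.coeff j)⁻¹, inv_ne_zero hj0, fun i => ?_, j, inv_mul_cancel₀ hj0⟩
  by_cases hi : q.coeff i = 0
  · rw [hi, mul_zero, map_zero]; exact zero_le
  · rw [map_mul, map_inv₀, inv_mul_le_one₀ (w.pos_iff.2 hj0)]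
    exact hmax i (mem_support_iff.2 hi)

theorem ResiduesIn.mem_of_isIntegral [IsAlgClosed D] {E : Subfield K} (hE : ResiduesIn D E)
    {x : K} (hx : IsIntegral E x) (hvx : v x ≤ 1) : x ∈ residuePreimage D := by
  obtain ⟨c, hc, hle, j, hj⟩ := exists_normalized (v.comap (algebraMap E K)) (minpoly.ne_zero hx)
  refine mem_residuePreimage_of_isRoot (p := (C c * minpoly E x).map (algebraMap E K))
    (fun i => ?_) (j := j) ?_ hvx ?_
  · rw [coeff_map, coeff_C_mul]
    exact hE _ (c * (minpoly E x).coeff i).2 (hle i)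
  · rw [coeff_map, coeff_C_mul, hj, map_one, map_one]
  · rw [eval_map_algebraMap, map_mul, minpoly.aeval, mul_zero]

theorem mem_of_maximal_residuesIn {E : Subfield K} (hE : Maximal (ResiduesIn D) E)
    (F : IntermediateField E K) (hF : ∀ x ∈ F, v x ≤ 1 → x ∈ residuePreimage D) {x : K}
    (hx : x ∈ F) : x ∈ E :=
  hE.2 (y := F.toSubfield) hF (fun y hy => F.algebraMap_mem ⟨y, hy⟩) hx

theorem mem_of_maximal_residuesIn_of_isIntegral [IsAlgClosed D] {E : Subfield K}
    (hE : Maximal (ResiduesIn D) E) {x : K} (hx : IsIntegral E x) : x ∈ E :=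
  mem_of_maximal_residuesIn hE (algebraicClosure E K)
    (fun _ hy => hE.1.mem_of_isIntegral (mem_algebraicClosure_iff'.1 hy))
    (mem_algebraicClosure_iff'.2 hx)

theorem exists_sub_lt_one_of_maximal_residuesIn {E : Subfield K} (hE : Maximal (ResiduesIn D) E)
    (hres : ∀ n, ResClosed E v n) {x : K} (hx : x ∈ residuePreimage D) :
    ∃ e ∈ E, v (x - e) < 1 := by
  by_contra! h
  have hnew : ResNew E v x := ⟨val_le_one_of_mem_residuePreimage hx, fun e _ => h e e.2⟩
  have hgauss (q : E[X]) (hq : q ≠ 0) := gauss_val (n := q.natDegree + 1) hnew.1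
    (fun p hp hn hle => hnew.val_aeval (hres _) p ⟨hp, hle⟩ hn) q hq (Nat.lt_succ_self _)
  have hmem (p : E[X]) (hp : ∀ i, v (algebraMap E K (p.coeff i)) ≤ 1) :
      aeval x p ∈ residuePreimage D := by
    rw [aeval_eq_sum_range]
    exact sum_mem fun i _ => by
      rw [Algebra.smul_def]
      exact mul_mem (hE.1 _ (SetLike.coe_mem (B := K) _) (hp i)) (pow_mem hx i)
  refine (h x ?_).not_gt (by simp)
  refine mem_of_maximal_residuesIn hE (IntermediateField.adjoin E {x}) (fun a ha hva => ?_)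
    (IntermediateField.mem_adjoin_simple_self E x)
  obtain ⟨p, q, rfl⟩ := (IntermediateField.mem_adjoin_simple_iff E a).1 ha
  by_cases hp : p = 0
  · rw [hp, map_zero, zero_div]; exact zero_mem _
  by_cases hq : q = 0
  · rw [hq, map_zero, div_zero]; exact zero_mem _
  obtain ⟨c, hc, hle, j, hj⟩ := exists_normalized (v.comap (algebraMap E K)) hq
  have hle' (i) : v (algebraMap E K ((C c * q).coeff i)) ≤ 1 := by
    rw [coeff_C_mul]; exact hle i
  obtain ⟨k, hk, hk'⟩ := hgauss (C c * q) (mul_ne_zero (C_ne_zero.2 hc) hq)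
  have hvq : v (aeval x (C c * q)) = 1 := by
    rw [hk]
    refine (hle' k).antisymm ?_
    have := hk' j
    rwa [coeff_C_mul, hj, map_one, map_one] at this
  obtain ⟨l, hl, hl'⟩ := hgauss (C c * p) (mul_ne_zero (C_ne_zero.2 hc) hp)
  have hc' : algebraMap E K c ≠ 0 := by simpa using hc
  have hpq : aeval x p / aeval x q = aeval x (C c * p) * (aeval x (C c * q))⁻¹ := by
    rw [← div_eq_mul_inv, map_mul, map_mul, aeval_C, mul_div_mul_left _ _ hc']
  rw [hpq] at hva ⊢
  refine mul_mem (hmem _ fun i => (hl' i).trans ?_)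
    (inv_mem_residuePreimage (hmem _ hle') hvq)
  rwa [map_mul, map_inv₀, hvq, inv_one, mul_one, hl] at hva

end ResidueField

section Elementary

open Language

universe u u'

theorem IsT.exists_isElementary {K : Type u} [Field K] [LVR.Structure K] {Γ : Type u'}
    [LinearOrderedCommGroupWithZero Γ] {v : Valuation K Γ} {t : K} (hK : IsT v t)
    (hv : IsValuedStructure v (v t)) (E : Subfield K) (ht : t ∈ E)
    (hE : ∀ x : K, IsIntegral E x → x ∈ E) :
    ∃ S : LVR.Substructure K, S.IsElementary ∧ ∀ x, x ∈ S ↔ x ∈ E := by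
  wlog hw : ∃ (Δ : Type u) (_ : LinearOrderedCommGroupWithZero Δ) (w : Valuation K Δ),
    IsT w t ∧ IsValuedStructure w (w t)
  · have heq := Valuation.isEquiv_valuation_valuationSubring v
    exact absurd ⟨_, _, v.valuationSubring.valuation, hK.of_isEquiv heq, hv.of_isEquiv heq⟩ hw
  obtain ⟨Δ, _, w, hKw, hw⟩ := hw
  let S : LVR.Substructure K :=
    { carrier := E
      fun_mem := by
        intro n f x hx
        rw [hv]
        cases f with
        | zero => exact zero_mem E
        | one => exact one_mem E
        | add => exact add_mem (hx 0) (hx 1)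
        | mul => exact mul_mem (hx 0) (hx 1) }
  refine ⟨S, ?_, fun x => Iff.rfl⟩
  let instE : LVR.Structure E := S.inducedStructure
  have hC : IsT (w.comap (algebraMap E K)) (⟨t, ht⟩ : E) :=
    IsT.of_algebraicallyClosed hKw fun x hx => ⟨⟨x, hE x hx⟩, rfl⟩
  have hS : IsValuedStructure (w.comap (algebraMap E K)) (w t) := by
    refine Structure.ext ?_ ?_
    · ext n f x
      change Structure.funMap f (fun i => (x i : K)) = _
      rw [hw]
      cases f <;> rfl
    · ext n r x
      change Structure.RelMap r (fun i => (x i : K)) ↔ _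
      rw [hw]
      cases r with
      | dvd => rfl
      | N => rfl
      | pow m =>
        constructor
        · rintro ⟨y, hy⟩
          have hyE : y ∈ E := hE y (IsIntegral.of_pow m.pos (by
            rw [← hy]; exact isIntegral_algebraMap (R := E)))
          exact ⟨⟨y, hyE⟩, Subtype.ext hy⟩
        · rintro ⟨y, hy⟩
          exact ⟨y, congrArg Subtype.val hy⟩
  intro n φ x
  have := hC.realize_algebraMap_iff φ hKw hS hw x default
  rw [Formula.Realize, Formula.Realize, ← this]
  congr!

end Elementary

/-- Let `K` be a valued field whose value group has a least
positive element, regarded as an `L_VR`-structure, elementarily equivalent to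
`ℂ((t))`, with residue field `k`.  Then for every algebraically closed subfield
`D ⊆ k` there is an elementary `L_VR`-substructure `K₀` of `K` whose residue
field (the image of `O_K ∩ K₀` under the residue map) equals `D`. -/
theorem stmt_15 {K : Type*} [Field K] {Γ₀ : Type*} [LinearOrderedCommGroupWithZero Γ₀]
    (v : Valuation K Γ₀) (hsurj : Function.Surjective v)
    (γ₁ : Γ₀) (hγ₁ : IsLeastPos γ₁) :
    letI : LVR.Structure K := valuedStructure v γ₁
    letI : LVR.Structure (LaurentSeries ℂ) := laurentStructure
    ∀ (_ : K ≅[LVR] LaurentSeries ℂ)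
      (D : Subfield (IsLocalRing.ResidueField v.valuationSubring))
      (_ : IsAlgClosed D),
      ∃ S : LVR.Substructure K, S.IsElementary ∧
        {u | ∃ a : v.valuationSubring, (a : K) ∈ S ∧
          IsLocalRing.residue v.valuationSubring a = u} = (D : Set _) := by
  let _ : LVR.Structure K := valuedStructure v γ₁
  let _ : LVR.Structure (LaurentSeries ℂ) := laurentStructure
  intro hK D hD
  obtain ⟨t, rfl⟩ := hsurj γ₁
  have hv : IsValuedStructure v (v t) := rfl
  have hL : IsValuedStructure (Valued.v : Valuation (LaurentSeries ℂ) (WithZero (Multiplicative ℤ)))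
      (Valued.v (HahnSeries.single 1 1 : LaurentSeries ℂ)) := by
    have : (Valued.v (HahnSeries.single 1 1 : LaurentSeries ℂ) : WithZero (Multiplicative ℤ)) =
        WithZero.exp (-1) := LaurentSeries.valuation_single_zpow ℂ 1
    rw [this]
    rfl
  have ht : IsT v t := IsT.of_elementarilyEquivalent hL hv LaurentSeries.isT hK.symm
  obtain ⟨E, htE, hE⟩ := ht.exists_maximal_residuesIn (D := D)
  have hcl (x : K) (hx : IsIntegral E x) : x ∈ E :=
    mem_of_maximal_residuesIn_of_isIntegral hE hx
  have hres (n : ℕ) : ResClosed E v n := IsT.resClosed (t := (⟨t, htE⟩ : E))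
    (IsT.of_algebraicallyClosed ht fun x hx => ⟨⟨x, hcl x hx⟩, rfl⟩) n
  obtain ⟨S, hS, hSE⟩ := ht.exists_isElementary hv E htE hcl
  refine ⟨S, hS, Set.Subset.antisymm ?_ fun u hu => ?_⟩
  · rintro _ ⟨a, ha, rfl⟩
    exact ((mem_residuePreimage D).1 (hE.1 a ((hSE a).1 ha) a.2)).2
  · obtain ⟨x, rfl⟩ := IsLocalRing.residue_surjective u
    obtain ⟨e, he, hxe⟩ := exists_sub_lt_one_of_maximal_residuesIn hE hres
      ((mem_residuePreimage D).2 ⟨x.2, hu⟩)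
    have he' := mem_residuePreimage_of_sub ((mem_residuePreimage D).2 ⟨x.2, hu⟩) hxe
    refine ⟨⟨e, ((mem_residuePreimage D).1 he').1⟩, (hSE e).2 he, ?_⟩
    have := (residue_eq_zero_iff_val_lt_one (x - ⟨e, ((mem_residuePreimage D).1 he').1⟩)).2 hxe
    rw [map_sub, sub_eq_zero] at this
    exact this.symm
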